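/- arXiv:1602.06755 — 4 statements merged into one kernel-verified Lean document; each statement's English description precedes it below -/
import Mathlib

section
/- Let $Y$ be a simply connected Peano continuum and let $K\subset Y$ be a compact subset separating two points $x,y\in Y\setminus K$. Then $K$ contains a minimal compact subset $K'$ which still separates $x$ and $y$, and any such minimal separating compact set $K'$ is connected. -/
open Set

/-- A set `K` separates the points `x` and `y` in the ambient space if every connected
subset containing both `x` and `y` meets `K`. -/
def SeparatesPoints' {Y : Type*} [TopologicalSpace Y] (K : Set Y) (x y : Y) : Prop :=
  ∀ S : Set Y, IsConnected S → x ∈ S → y ∈ S → (S ∩ K).Nonempty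

open Filter Topology

/-! ### Complete locally connected metric spaces are locally path connected -/

section LocallyPathConnected

variable {Y : Type*} [MetricSpace Y]

/-- Two points are `ε`-linked if they lie in a common preconnected set of diameter at most `ε`. -/
def ConnectedLink (ε : ℝ) (p q : Y) : Prop :=
  ∃ V : Set Y, IsPreconnected V ∧ p ∈ V ∧ q ∈ V ∧ ∀ z ∈ V, ∀ w ∈ V, dist z w ≤ ε

theorem ConnectedLink.symm {ε : ℝ} {p q : Y} (h : ConnectedLink ε p q) : ConnectedLink ε q p :=
  let ⟨V, hV, hp, hq, hd⟩ := h
  ⟨V, hV, hq, hp, hd⟩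

theorem ConnectedLink.dist_le {ε : ℝ} {p q : Y} (h : ConnectedLink ε p q) : dist p q ≤ ε :=
  let ⟨_, _, hp, hq, hd⟩ := h
  hd _ hp _ hq

theorem ConnectedLink.refl {ε : ℝ} (hε : 0 ≤ ε) (p : Y) : ConnectedLink ε p p :=
  ⟨{p}, isPreconnected_singleton, rfl, rfl, by rintro z rfl w rfl; simpa using hε⟩

theorem eventually_connectedLink [LocallyConnectedSpace Y] {ε : ℝ} (hε : 0 < ε) (p : Y) :
    ∀ᶠ q in 𝓝 p, ConnectedLink ε p q := by
  obtain ⟨V, hVU, hVo, hpV, hV⟩ := locallyConnectedSpace_iff_subsets_isOpen_isConnected.1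
    (inferInstance : LocallyConnectedSpace Y) p _ (Metric.ball_mem_nhds p (half_pos hε))
  filter_upwards [hVo.mem_nhds hpV] with q hq
  refine ⟨V, hV.isPreconnected, hpV, hq, fun z hz w hw => ?_⟩
  have h₁ := Metric.mem_ball.1 (hVU hz)
  have h₂ := Metric.mem_ball'.1 (hVU hw)
  linarith [dist_triangle z p w]

/-- A chain for a relation can be realised by an eventually constant sequence. -/
theorem Relation.ReflTransGen.exists_seq {α : Type*} {r : α → α → Prop} {p q : α}
    (h : Relation.ReflTransGen r p q) (hq : r q q) :
    ∃ (N : ℕ) (u : ℕ → α), u 0 = p ∧ (∀ i, N ≤ i → u i = q) ∧ ∀ i, r (u i) (u (i + 1)) := by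
  induction h using Relation.ReflTransGen.head_induction_on with
  | refl => exact ⟨0, fun _ => q, rfl, fun _ _ => rfl, fun _ => hq⟩
  | @head a b hab _ ih =>
    obtain ⟨N, u, hu0, huN, hu⟩ := ih
    refine ⟨N + 1, fun i => Nat.casesOn i a u, rfl, fun i hi => ?_, fun i => ?_⟩
    · cases i with
      | zero => omega
      | succ i => exact huN i (by omega)
    · cases i with
      | zero => simpa [hu0] using hab
      | succ i => exact hu i

/-- An `ε`-link can be subdivided into a finite chain of `δ`-links staying `ε`-close to its
starting point. -/
theorem ConnectedLink.exists_refinement [LocallyConnectedSpace Y] {ε δ : ℝ} (hδ : 0 < δ) {p q : Y}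
    (h : ConnectedLink ε p q) :
    ∃ (N : ℕ) (u : ℕ → Y), u 0 = p ∧ (∀ i, N ≤ i → u i = q) ∧
      (∀ i, ConnectedLink δ (u i) (u (i + 1))) ∧ ∀ i, dist (u i) p ≤ ε := by
  obtain ⟨V, hV, hp, hq, hd⟩ := h
  let r : Y → Y → Prop := fun a b => a ∈ V ∧ b ∈ V ∧ ConnectedLink δ a b
  have hr : Relation.ReflTransGen r p q := by
    refine hV.induction₂ (Relation.ReflTransGen r) (fun a ha => ?_)
      (fun _ _ _ _ _ _ h₁ h₂ => h₁.trans h₂) (fun a b _ hb hab => ?_) hp hq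
    · filter_upwards [nhdsWithin_le_nhds (eventually_connectedLink hδ a), self_mem_nhdsWithin]
        with b hab hb
      exact .single ⟨ha, hb, hab⟩
    · clear hb
      induction hab with
      | refl => exact .refl
      | tail _ hbc ih => exact .head ⟨hbc.2.1, hbc.1, hbc.2.2.symm⟩ ih
  obtain ⟨N, u, hu0, huN, hu⟩ := hr.exists_seq ⟨hq, hq, ConnectedLink.refl hδ.le q⟩
  exact ⟨N, u, hu0, huN, fun i => (hu i).2.2, fun i => hd _ (hu i).1 _ hp⟩

/-- A chain of `ε`-links from `a` to `b`, of length `M`, prolonged by the constant `b`. -/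
structure IsLinkChain (ε : ℝ) (a b : Y) (M : ℕ) (u : ℕ → Y) : Prop where
  pos : 0 < M
  zero : u 0 = a
  eq_of_le : ∀ i, M ≤ i → u i = b
  link : ∀ i, ConnectedLink ε (u i) (u (i + 1))

theorem IsLinkChain.exists_refinement [LocallyConnectedSpace Y] {ε δ : ℝ} (hε : 0 ≤ ε) (hδ : 0 < δ)
    {a b : Y} {M : ℕ} {u : ℕ → Y} (h : IsLinkChain ε a b M u) :
    ∃ (N : ℕ) (v : ℕ → Y), 0 < N ∧ IsLinkChain δ a b (M * N) v ∧
      ∀ n, dist (v n) (u (n / N)) ≤ ε := by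
  have key : ∃ N, 0 < N ∧ ∀ i, ∃ w : ℕ → Y, w 0 = u i ∧ w N = u (i + 1) ∧
      (∀ j, ConnectedLink δ (w j) (w (j + 1))) ∧ (∀ j, dist (w j) (u i) ≤ ε) ∧
      (M ≤ i → ∀ j, w j = b) := by
    choose N w hw0 hwN hwl hwd using fun i => (h.link i).exists_refinement hδ
    refine ⟨(Finset.range M).sup N + 1, Nat.succ_pos _, fun i => ?_⟩
    rcases lt_or_ge i M with hi | hi
    · refine ⟨w i, hw0 i, hwN i _ ?_, hwl i, hwd i, fun h => absurd h (by omega)⟩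
      exact (Finset.le_sup (f := N) (Finset.mem_range.2 hi)).trans (Nat.le_succ _)
    · refine ⟨fun _ => b, (h.eq_of_le i hi).symm, (h.eq_of_le _ (by omega)).symm,
        fun _ => .refl hδ.le b, fun _ => ?_, fun _ _ => rfl⟩
      simpa [h.eq_of_le i hi] using hε
  obtain ⟨N, hN, hw⟩ := key
  choose w hw0 hwN hwl hwd hwb using hw
  refine ⟨N, fun n => w (n / N) (n % N), hN, ⟨Nat.mul_pos h.pos hN, ?_, fun i hi => ?_,
    fun n => ?_⟩, fun n => hwd _ _⟩
  · simp [hw0, h.zero]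
  · exact hwb _ ((Nat.le_div_iff_mul_le hN).2 hi) _
  · have hn := Nat.div_add_mod n N
    have hlt := Nat.mod_lt n hN
    have hl := hwl (n / N) (n % N)
    rcases Nat.lt_or_ge (n % N + 1) N with h1 | h1
    · have hd : (n + 1) / N = n / N := by
        rw [Nat.div_eq_iff hN, mul_comm]; omega
      have hm : (n + 1) % N = n % N + 1 := by
        have := Nat.div_add_mod (n + 1) N
        rw [hd] at this; omega
      simpa only [hd, hm] using hl
    · have hmod : n % N + 1 = N := by omega
      have hn1 : n + 1 = N * (n / N + 1) := by rw [mul_add]; omega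
      have hd : (n + 1) / N = n / N + 1 := by rw [hn1, Nat.mul_div_cancel_left _ hN]
      have hm : (n + 1) % N = 0 := by rw [hn1, Nat.mul_mod_right]
      simp only [hd, hm, hw0]
      rwa [hmod, hwN] at hl

/-- In a complete locally connected metric space, `ε`-linked points are joined by a path
staying `3 * ε`-close to its starting point. -/
theorem ConnectedLink.exists_path [CompleteSpace Y] [LocallyConnectedSpace Y] {ε : ℝ} (hε : 0 < ε)
    {a b : Y} (h : ConnectedLink ε a b) : ∃ γ : Path a b, ∀ t, dist (γ t) a ≤ 3 * ε := by
  have hεk : ∀ k : ℕ, 0 < ε / 2 ^ k := fun k => by positivity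
  let C : ℕ → Type _ := fun k => {c : ℕ × (ℕ → Y) // IsLinkChain (ε / 2 ^ k) a b c.1 c.2}
  have step : ∀ k (c : C k), ∃ (c' : C (k + 1)) (N : ℕ), 0 < N ∧ c'.1.1 = c.1.1 * N ∧
      ∀ n, dist (c'.1.2 n) (c.1.2 (n / N)) ≤ ε / 2 ^ k := by
    rintro k ⟨c, hc⟩
    obtain ⟨N, v, hN, hv, hd⟩ := hc.exists_refinement (hεk k).le (hεk (k + 1))
    exact ⟨⟨(_, v), hv⟩, N, hN, rfl, hd⟩
  have base : IsLinkChain (ε / 2 ^ 0) a b 1 (fun i => Nat.casesOn i a fun _ => b) := by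
    refine ⟨one_pos, rfl, fun i hi => ?_, fun i => ?_⟩
    · cases i with
      | zero => omega
      | succ i => rfl
    · cases i with
      | zero => simpa using h
      | succ i => exact .refl (hεk 0).le b
  choose next N hN hM hd using step
  let c : ∀ k, C k := fun k => Nat.rec ⟨(1, _), base⟩ next k
  let M : ℕ → ℕ := fun k => (c k).1.1
  let g : ℕ → ℝ → Y := fun k t => (c k).1.2 ⌊M k * t⌋₊
  have hMpos : ∀ k, 0 < M k := fun k => (c k).2.pos
  have hg : ∀ t k, dist (g k t) (g (k + 1) t) ≤ (2 * ε) / 2 / 2 ^ k := by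
    intro t k
    have hMk : M (k + 1) = M k * N k (c k) := hM k (c k)
    have hfl : ⌊M (k + 1) * t⌋₊ / N k (c k) = ⌊M k * t⌋₊ := by
      rw [← Nat.floor_div_natCast, hMk]
      have : (N k (c k) : ℝ) ≠ 0 := by exact_mod_cast (hN k (c k)).ne'
      congr 1
      push_cast
      field_simp
    have := hd k (c k) ⌊M (k + 1) * t⌋₊
    rw [hfl] at this
    rw [dist_comm, mul_div_cancel_left₀ _ (two_ne_zero)]
    exact this
  choose f hf using fun t => cauchySeq_tendsto_of_complete
    (cauchySeq_of_le_geometric_two (hg t))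
  have hfd : ∀ t k, dist (g k t) (f t) ≤ 2 * ε / 2 ^ k := fun t k =>
    dist_le_of_le_geometric_two_of_tendsto (hg t) (hf t) k
  have hlink : ∀ k (s t : ℝ), s ≤ t → t < s + 1 / M k → dist (g k s) (g k t) ≤ ε / 2 ^ k := by
    intro k s t hst hts
    have hMk : (0 : ℝ) < M k := by exact_mod_cast hMpos k
    have h1 : ⌊M k * s⌋₊ ≤ ⌊M k * t⌋₊ := Nat.floor_mono (by gcongr)
    have h2 : ⌊M k * t⌋₊ ≤ ⌊M k * s⌋₊ + 1 := by
      rcases le_or_gt 0 s with hs | hs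
      · rw [← Nat.floor_add_one (by positivity)]
        refine Nat.floor_mono ?_
        calc M k * t ≤ M k * (s + 1 / M k) := by gcongr
          _ = M k * s + 1 := by field_simp
      · have : M k * t < 1 := by
          calc M k * t < M k * (s + 1 / M k) := by gcongr
            _ = M k * s + 1 := by field_simp
            _ < 1 := by nlinarith
        rw [Nat.floor_eq_zero.2 this]
        omega
    rcases (by omega : ⌊M k * t⌋₊ = ⌊M k * s⌋₊ ∨ ⌊M k * t⌋₊ = ⌊M k * s⌋₊ + 1) with h3 | h3
    · simp only [g, h3, dist_self]
      exact (hεk k).le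
    · simp only [g, h3]
      exact ((c k).2.link _).dist_le
  have hcont : Continuous f := by
    rw [Metric.continuous_iff]
    intro t η hη
    obtain ⟨k, hk⟩ : ∃ k : ℕ, 5 * ε / 2 ^ k < η := by
      obtain ⟨k, hk⟩ := exists_pow_lt_of_lt_one (div_pos hη (by positivity : 0 < 5 * ε))
        (by norm_num : (1 / 2 : ℝ) < 1)
      refine ⟨k, ?_⟩
      rw [lt_div_iff₀ (by positivity)] at hk
      rw [one_div, inv_pow] at hk
      rw [div_eq_mul_inv]
      linarith
    have hMk : (0 : ℝ) < M k := by exact_mod_cast hMpos k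
    refine ⟨1 / M k, by positivity, fun s hs => ?_⟩
    rw [Real.dist_eq, abs_lt] at hs
    have hgst : dist (g k s) (g k t) ≤ ε / 2 ^ k := by
      rcases le_total s t with hst | hst
      · exact hlink k s t hst (by linarith)
      · rw [dist_comm]
        exact hlink k t s hst (by linarith)
    have e : 5 * ε / 2 ^ k = 2 * ε / 2 ^ k + ε / 2 ^ k + 2 * ε / 2 ^ k := by ring
    have hs' := hfd s k
    rw [dist_comm] at hs'
    linarith [dist_triangle4 (f s) (g k s) (g k t) (f t), hfd t k]
  have hf0 : f 0 = a := by
    refine tendsto_nhds_unique (hf 0) ?_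
    have : ∀ k, g k 0 = a := fun k => by simp only [g, mul_zero, Nat.floor_zero]; exact (c k).2.zero
    simp [this]
  have hf1 : f 1 = b := by
    refine tendsto_nhds_unique (hf 1) ?_
    have : ∀ k, g k 1 = b := fun k => by
      simp only [g, mul_one, Nat.floor_natCast]; exact (c k).2.eq_of_le _ le_rfl
    simp [this]
  refine ⟨⟨⟨fun t => f t, by fun_prop⟩, by simpa using hf0, by simpa using hf1⟩, fun t => ?_⟩
  have hg0 : dist (g 0 t) a ≤ ε := by
    change dist (Nat.casesOn ⌊M 0 * (t : ℝ)⌋₊ a fun _ => b) a ≤ ε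
    cases ⌊M 0 * (t : ℝ)⌋₊ with
    | zero => simpa using hε.le
    | succ i => exact h.symm.dist_le
  have h0 := hfd t 0
  rw [pow_zero, div_one, dist_comm] at h0
  change dist (f t) a ≤ 3 * ε
  linarith [dist_triangle (f t) (g 0 t) a]

theorem LocallyPathConnectedSpace.of_complete_locallyConnected
    [CompleteSpace Y] [LocallyConnectedSpace Y] : LocallyPathConnectedSpace Y := by
  rw [locallyPathConnectedSpace_iff_pathComponentIn_mem_nhds]
  intro p U hU hp
  obtain ⟨r, hr, hrU⟩ := Metric.isOpen_iff.1 hU p hp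
  filter_upwards [eventually_connectedLink (by positivity : 0 < r / 6) p] with q hq
  obtain ⟨γ, hγ⟩ := hq.exists_path (by positivity)
  exact ⟨γ, fun t => hrU (Metric.mem_ball.2 ((hγ t).trans_lt (by linarith)))⟩

end LocallyPathConnected

/-! ### Frontiers and separation -/

section Separation

variable {Y : Type*} [TopologicalSpace Y]

theorem separatesPoints'_frontier {U : Set Y} {x y : Y} (hU : IsOpen U) (hx : x ∈ U) (hy : y ∉ U) :
    SeparatesPoints' (frontier U) x y := by
  intro S hS hxS hyS
  by_contra hne
  have hsub : S ⊆ U ∪ (closure U)ᶜ := by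
    intro z hz
    by_contra hzU
    simp only [mem_union, mem_compl_iff, not_or, not_not] at hzU
    exact hne ⟨z, hz, by rw [hU.frontier_eq]; exact ⟨hzU.2, hzU.1⟩⟩
  exact hy (hS.isPreconnected.subset_left_of_subset_union hU isClosed_closure.isOpen_compl
    (disjoint_compl_right.mono_left subset_closure) hsub ⟨x, hxS, hx⟩ hyS)

theorem SeparatesPoints'.symm {K : Set Y} {x y : Y} (h : SeparatesPoints' K x y) :
    SeparatesPoints' K y x :=
  fun S hS hy hx => h S hS hx hy

theorem SeparatesPoints'.notMem_connectedComponentIn {K : Set Y} {x y : Y}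
    (h : SeparatesPoints' K x y) (hx : x ∉ K) : y ∉ connectedComponentIn Kᶜ x := by
  intro hy
  obtain ⟨z, hz, hzK⟩ := h _ (isConnected_connectedComponentIn_iff.2 hx)
    (mem_connectedComponentIn hx) hy
  exact connectedComponentIn_subset _ _ hz hzK

theorem frontier_connectedComponentIn_subset_compl [LocallyConnectedSpace Y] {O : Set Y}
    (hO : IsOpen O) (x : Y) : frontier (connectedComponentIn O x) ⊆ Oᶜ := by
  intro z hz hzO
  rw [hO.connectedComponentIn.frontier_eq] at hz
  obtain ⟨w, hw, hwx⟩ := mem_closure_iff.1 hz.1 _ hO.connectedComponentIn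
    (mem_connectedComponentIn hzO)
  apply hz.2
  rw [connectedComponentIn_eq hwx, ← connectedComponentIn_eq hw]
  exact mem_connectedComponentIn hzO

theorem SeparatesPoints'.exists_minimal [CompactSpace Y] [LocallyConnectedSpace Y]
    {K : Set Y} (hK : IsClosed K) {x y : Y}
    (hx : x ∉ K) (hy : y ∉ K) (hsep : SeparatesPoints' K x y) :
    ∃ K' ⊆ K, IsCompact K' ∧ SeparatesPoints' K' x y ∧
      ∀ K'' ⊆ K', IsClosed K'' → SeparatesPoints' K'' x y → K'' = K' := by
  set U := connectedComponentIn Kᶜ x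
  have hUo : IsOpen U := hK.isOpen_compl.connectedComponentIn
  have hxU : x ∈ U := mem_connectedComponentIn hx
  have hfU : frontier U ⊆ K := by
    simpa using frontier_connectedComponentIn_subset_compl hK.isOpen_compl x
  have hyU : y ∉ closure U := fun h => hy <| hfU <| by
    rw [hUo.frontier_eq]
    exact ⟨h, hsep.notMem_connectedComponentIn hx⟩
  set W := connectedComponentIn (closure U)ᶜ y
  have hWo : IsOpen W := isClosed_closure.isOpen_compl.connectedComponentIn
  have hyW : y ∈ W := mem_connectedComponentIn hyU
  have hWU : Disjoint W U :=
    (disjoint_compl_left.mono_left (connectedComponentIn_subset _ y)).mono_right subset_closure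
  have hfWU : frontier W ⊆ closure U := by
    simpa using frontier_connectedComponentIn_subset_compl isClosed_closure.isOpen_compl y
  have hfWU' : Disjoint (frontier W) U :=
    (hWU.closure_left hUo).mono_left frontier_subset_closure
  have hfW : frontier W ⊆ K := fun z hz => hfU <| by
    rw [hUo.frontier_eq]
    exact ⟨hfWU hz, hfWU'.notMem_of_mem_left hz⟩
  refine ⟨frontier W, hfW, isClosed_frontier.isCompact,
    (separatesPoints'_frontier hWo hyW fun h => hWU.notMem_of_mem_left h hxU).symm,
    fun K'' hK'' hcl hs => hK''.antisymm fun p hp => ?_⟩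
  by_contra hpK
  set V := connectedComponentIn K''ᶜ p
  have hVo : IsOpen V := hcl.isOpen_compl.connectedComponentIn
  have hpV : p ∈ V := mem_connectedComponentIn hpK
  have hVU : (U ∩ V).Nonempty := by
    obtain ⟨z, hz⟩ := mem_closure_iff.1 (hfWU hp) V hVo hpV
    exact ⟨z, hz.2, hz.1⟩
  have hVW : (V ∩ W).Nonempty := mem_closure_iff.1 (frontier_subset_closure hp) V hVo hpV
  have hUc : IsPreconnected U := isPreconnected_connectedComponentIn
  have hVc : IsPreconnected V := isPreconnected_connectedComponentIn
  have hWc : IsPreconnected W := isPreconnected_connectedComponentIn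
  have hUVW : IsPreconnected (U ∪ V ∪ W) :=
    (hUc.union' hVU hVc).union' (hVW.mono (inter_subset_inter_left _ subset_union_right)) hWc
  obtain ⟨z, hz, hzK⟩ := hs _ ⟨⟨x, .inl (.inl hxU)⟩, hUVW⟩ (.inl (.inl hxU)) (.inr hyW)
  rcases hz with (hz | hz) | hz
  · exact hfWU'.notMem_of_mem_left (hK'' hzK) hz
  · exact connectedComponentIn_subset _ _ hz hzK
  · exact (hWo.frontier_eq ▸ hK'' hzK).2 hz

end Separation

/-- A continuous real function taking integer values on a preconnected set is constant on the
closure of that set. -/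
theorem IsPreconnected.eqOn_closure_of_int {Y : Type*} [TopologicalSpace Y] {S : Set Y}
    (hS : IsPreconnected S) {G : Y → ℝ} (hG : Continuous G) (hint : ∀ p ∈ S, ∃ n : ℤ, G p = n) :
    ∃ c : ℝ, ∀ p ∈ closure S, G p = c := by
  obtain ⟨c, -, hc⟩ := hS.eqOn_const_of_mapsTo (T := range ((↑) : ℤ → ℝ))
    (isDiscrete_iff_discreteTopology.2
      (Int.isClosedEmbedding_coe_real.isEmbedding.toHomeomorph.symm.isEmbedding.discreteTopology))
    hG.continuousOn (fun p hp => let ⟨n, hn⟩ := hint p hp; ⟨n, hn.symm⟩) (range_nonempty _)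
  exact ⟨c, fun p hp => (EqOn.closure hc hG continuous_const) hp⟩

/-- In a simply connected, locally path connected normal space, a closed set that is the common
frontier of two disjoint open preconnected sets is preconnected. -/
theorem isPreconnected_of_eq_frontier {Y : Type*} [TopologicalSpace Y] [NormalSpace Y]
    [SimplyConnectedSpace Y] [LocallyPathConnectedSpace Y] {K U W : Set Y}
    (hU : IsPreconnected U) (hW : IsPreconnected W)
    (hUW : Disjoint U W) (hKU : frontier U = K) (hKW : frontier W = K) : IsPreconnected K := by
  classical
  rw [isPreconnected_iff_subset_of_fully_disjoint_closed (hKU ▸ isClosed_frontier)]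
  intro A B hA hB hAB hd
  by_contra! hne
  obtain ⟨⟨p, hpK, hpA⟩, q, hqK, hqB⟩ :=
    And.intro (not_subset.1 hne.1) (not_subset.1 hne.2)
  have hpB : p ∈ B := (hAB hpK).resolve_left hpA
  have hqA : q ∈ A := (hAB hqK).resolve_right hqB
  obtain ⟨φ, hφA, hφB, -⟩ := exists_continuous_zero_one_of_isClosed hA hB hd
  let f : Y → UnitAddCircle := fun z => if z ∈ U then (φ z : UnitAddCircle) else 0
  have hf : Continuous f := by
    refine Continuous.if (fun z hz => ?_)
      ((AddCircle.isCoveringMap_coe (1 : ℝ)).continuous.comp φ.continuous) continuous_const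
    rcases hAB (hKU ▸ hz) with h | h
    · simp [hφA h]
    · simp [hφB h]
  obtain ⟨e, he⟩ := QuotientAddGroup.mk_surjective (f p)
  obtain ⟨F, ⟨-, hF⟩, -⟩ := (AddCircle.isCoveringMap_coe (1 : ℝ)).existsUnique_continuousMap_lifts
    ⟨f, hf⟩ p e he
  have hF' : ∀ z, (F z : UnitAddCircle) = f z := fun z => congrFun hF z
  obtain ⟨c, hc⟩ := hU.eqOn_closure_of_int (G := fun z => F z - φ z) (by fun_prop) fun z hz => by
    have := hF' z
    simp only [f, if_pos hz] at this
    rw [← sub_eq_zero, ← AddCircle.coe_sub, AddCircle.coe_eq_zero_iff] at this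
    obtain ⟨n, hn⟩ := this
    exact ⟨n, by simp [← hn]⟩
  obtain ⟨d, hd'⟩ := hW.eqOn_closure_of_int F.continuous fun z hz => by
    have := hF' z
    simp only [f, if_neg (hUW.notMem_of_mem_right hz)] at this
    rw [AddCircle.coe_eq_zero_iff] at this
    obtain ⟨n, hn⟩ := this
    exact ⟨n, by simp [← hn]⟩
  have hcl : ∀ z ∈ K, φ z = d - c := fun z hz => by
    have h1 := hc z (frontier_subset_closure (hKU ▸ hz))
    have h2 := hd' z (frontier_subset_closure (hKW ▸ hz))
    linarith
  have h1 : φ p = 1 := hφB hpB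
  have h0 : φ q = 0 := hφA hqA
  linarith [hcl p hpK, hcl q hqK]

/-- In a simply connected Peano continuum `Y` (compact, connected,
locally connected metric space), any compact set `K` separating two points `x, y ∉ K`
contains a minimal compact separating subset, and every minimal compact subset of `K`
separating `x` and `y` is connected. -/
theorem minimal_separating_compact_connected
    (Y : Type*) [MetricSpace Y] [CompactSpace Y] [ConnectedSpace Y]
    [LocallyConnectedSpace Y] [SimplyConnectedSpace Y]
    (K : Set Y) (hK : IsCompact K) (x y : Y) (hxy : x ≠ y)
    (hx : x ∉ K) (hy : y ∉ K) (hsep : SeparatesPoints' K x y) :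
    (∃ K' ⊆ K, IsCompact K' ∧ SeparatesPoints' K' x y ∧
      ∀ K'' ⊆ K', IsCompact K'' → SeparatesPoints' K'' x y → K'' = K') ∧
    (∀ K' ⊆ K, IsCompact K' → SeparatesPoints' K' x y →
      (∀ K'' ⊆ K', IsCompact K'' → SeparatesPoints' K'' x y → K'' = K') →
      IsConnected K') := by
  refine ⟨?_, fun K' hK'K hK' hs hmin => ⟨?_, ?_⟩⟩
  · obtain ⟨K', hK'K, hK', hs, hmin⟩ := hsep.exists_minimal hK.isClosed hx hy
    exact ⟨K', hK'K, hK', hs, fun K'' h hc => hmin K'' h hc.isClosed⟩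
  · simpa using hs univ isConnected_univ (mem_univ x) (mem_univ y)
  · have : LocallyPathConnectedSpace Y := .of_complete_locallyConnected
    have hxK' : x ∉ K' := fun h => hx (hK'K h)
    have hyK' : y ∉ K' := fun h => hy (hK'K h)
    have hO : IsOpen K'ᶜ := hK'.isClosed.isOpen_compl
    have hyU := hs.notMem_connectedComponentIn hxK'
    have hxW := hs.symm.notMem_connectedComponentIn hyK'
    have hsub : ∀ z, frontier (connectedComponentIn K'ᶜ z) ⊆ K' := fun z => by
      simpa using frontier_connectedComponentIn_subset_compl hO z
    refine isPreconnected_of_eq_frontier (isPreconnected_connectedComponentIn (F := K'ᶜ) (x := x))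
      (isPreconnected_connectedComponentIn (F := K'ᶜ) (x := y)) ?_
      (hmin _ (hsub x) isClosed_frontier.isCompact
        (separatesPoints'_frontier hO.connectedComponentIn (mem_connectedComponentIn hxK') hyU))
      (hmin _ (hsub y) isClosed_frontier.isCompact
        (separatesPoints'_frontier hO.connectedComponentIn
          (mem_connectedComponentIn hyK') hxW).symm)
    refine disjoint_left.2 fun z hzx hzy => hyU ?_
    rw [connectedComponentIn_eq hzx, ← connectedComponentIn_eq hzy]
    exact mem_connectedComponentIn hyK'
end

section
/- Let $Y$ be a compact metric space homeomorphic to $S^2$, and let $K\subset Y$ be a compact subset separating two points $x,y\in Y\setminus K$ with $l=\mathcal H^1(K)<\infty$. Then $K$ contains a rectifiable Jordan curve of length at most $l$ which still separates $x$ from $y$. -/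
open Set MeasureTheory
open scoped ENNReal

local notation "S2" => Metric.sphere (0 : EuclideanSpace ℝ (Fin 3)) 1

open Filter Topology

/-! ### Complex exponentials -/

theorem Complex.eq_of_exp_eq_exp_of_norm_sub_lt {a b : ℂ} (h : Complex.exp a = Complex.exp b)
    (hab : ‖a - b‖ < 6) : a = b := by
  obtain ⟨n, hn⟩ := Complex.exp_eq_exp_iff_exists_int.1 h
  have hsub : a - b = n * (2 * Real.pi * Complex.I) := by rw [hn]; ring
  rw [hsub] at hab
  simp only [norm_mul, Complex.norm_intCast, Complex.norm_ofNat, Complex.norm_real,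
    Complex.norm_I, mul_one, Real.norm_eq_abs, abs_of_pos Real.pi_pos] at hab
  have hpi := Real.pi_gt_three
  have hn1 : |(n : ℝ)| < 1 := by
    by_contra! hcon
    nlinarith
  have hn0 : n = 0 := by
    rw [← Int.abs_lt_one_iff]
    exact_mod_cast hn1
  simpa [hn0] using hn

theorem Complex.norm_log_le_one {q : ℂ} (hq : ‖q - 1‖ ≤ 1 / 2) : ‖Complex.log q‖ ≤ 1 := by
  have h := Complex.norm_log_one_add_half_le_self hq
  rw [add_sub_cancel] at h
  linarith

theorem Complex.eq_log_of_norm_le_two {a q : ℂ} (ha : ‖a‖ ≤ 2) (h : Complex.exp a = q) :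
    a = Complex.log q := by
  have him := abs_le.1 ((Complex.abs_im_le_norm a).trans ha)
  have hpi := Real.pi_gt_three
  rw [← h, Complex.log_exp (by linarith) (by linarith)]

theorem Complex.eqOn_const_of_exp_eq {Z : Type*} [TopologicalSpace Z] {S : Set Z}
    (hS : IsPreconnected S) {h : Z → ℂ} (hc : ContinuousOn h S) {c : ℂ}
    (hexp : ∀ z ∈ S, Complex.exp (h z) = c) {z w : Z} (hz : z ∈ S) (hw : w ∈ S) :
    h z = h w := by
  have : PreconnectedSpace S := isPreconnected_iff_preconnectedSpace.1 hS
  have hc' : Continuous (S.domRestrict h) := continuousOn_iff_continuous_domRestrict.1 hc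
  have hloc : IsLocallyConstant (S.domRestrict h) := by
    rw [IsLocallyConstant.iff_eventually_eq]
    intro u
    have hev := Metric.tendsto_nhds.1 (hc'.tendsto u) 6 (by norm_num)
    filter_upwards [hev] with v hv
    rw [dist_eq_norm] at hv
    exact Complex.eq_of_exp_eq_exp_of_norm_sub_lt ((hexp v v.2).trans (hexp u u.2).symm) hv
  exact hloc.apply_eq_of_isPreconnected (s := univ) isPreconnected_univ
    (mem_univ ⟨z, hz⟩) (mem_univ ⟨w, hw⟩)

/-! ### Approximate loops -/

/-- A closed curve `g` of length at most `T`, up to jumps of size `ε`, together with a branch `ℓ`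
of the logarithm of `f` along `g` that does not close up. -/
structure IsApproxLoop {X : Type*} [PseudoMetricSpace X] (f : X → ℂ) (η ε T : ℝ) (g : ℝ → X)
    (ℓ : ℝ → ℂ) : Prop where
  exp_mul : ∀ s t, Complex.exp (ℓ t - ℓ s) * f (g s) = f (g t)
  dist_le : ∀ s t, dist (g s) (g t) ≤ |t - s| + ε
  norm_le : ∀ s t, |t - s| ≤ η → ‖ℓ t - ℓ s‖ ≤ 1
  closed : g 0 = g T
  ne : ℓ 0 ≠ ℓ T

namespace IsApproxLoop

variable {X : Type*} [MetricSpace X] {f : X → ℂ} {δ η ε T : ℝ} {g : ℝ → X} {ℓ : ℝ → ℂ}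

theorem norm_sub_zero_le (h : IsApproxLoop f η ε T g ℓ) (n : ℕ) :
    ∀ t, |t| ≤ n * η → ‖ℓ t - ℓ 0‖ ≤ n := by
  induction n with
  | zero =>
    intro t ht
    have : t = 0 := by simpa using ht
    simp [this]
  | succ n ih =>
    intro t ht
    have hn : (0 : ℝ) < n + 1 := by positivity
    push_cast at ht ⊢
    have h1 : |t * (n / (n + 1))| ≤ n * η := by
      rw [abs_mul, abs_of_nonneg (by positivity : (0 : ℝ) ≤ n / (n + 1)), mul_div_assoc',
        div_le_iff₀ hn]
      nlinarith [(Nat.cast_nonneg n : (0 : ℝ) ≤ n)]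
    have h2 : |t - t * (n / (n + 1))| ≤ η := by
      have : t - t * (n / (n + 1)) = t / (n + 1) := by field_simp; ring
      rw [this, abs_div, abs_of_pos hn, div_le_iff₀ hn]
      linarith
    calc ‖ℓ t - ℓ 0‖ = ‖(ℓ t - ℓ (t * (n / (n + 1)))) + (ℓ (t * (n / (n + 1))) - ℓ 0)‖ := by
          congr 1; ring
      _ ≤ 1 + n := (norm_add_le _ _).trans (add_le_add (h.norm_le _ _ h2) (ih _ h1))
      _ = n + 1 := by ring

theorem six_le_norm (hf0 : ∀ x, f x ≠ 0) (h : IsApproxLoop f η ε T g ℓ) :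
    6 ≤ ‖ℓ T - ℓ 0‖ := by
  by_contra! hcon
  refine h.ne (Complex.eq_of_exp_eq_exp_of_norm_sub_lt ?_ hcon).symm
  have := h.exp_mul 0 T
  rw [← h.closed, Complex.exp_sub] at this
  have h3 : Complex.exp (ℓ T) / Complex.exp (ℓ 0) = 1 :=
    mul_right_cancel₀ (hf0 _) (by simpa using this)
  rwa [div_eq_one_iff_eq (Complex.exp_ne_zero _)] at h3

theorem exists_of_tendsto [CompactSpace X] (hf : Continuous f) (hf0 : ∀ x, f x ≠ 0) (hη : 0 < η)
    {τ e : ℕ → ℝ} (hτ : Tendsto τ atTop (𝓝 T)) (he : Tendsto e atTop (𝓝 0))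
    (h : ∀ n, ∃ g ℓ, IsApproxLoop f η (e n) (τ n) g ℓ) :
    ∃ g ℓ, IsApproxLoop f η 0 T g ℓ := by
  choose G Λ hG using h
  have hU : (hyperfilter ℕ : Filter ℕ) ≤ atTop := Nat.hyperfilter_le_atTop
  have hlimG : ∀ t, ∃ x, Tendsto (fun n => G n t) (hyperfilter ℕ) (𝓝 x) := fun t =>
    ⟨_, ((hyperfilter ℕ).map fun n => G n t).le_nhds_lim⟩
  have hlimΛ : ∀ t, ∃ a, Tendsto (fun n => Λ n t - Λ n 0) (hyperfilter ℕ) (𝓝 a) := by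
    intro t
    obtain ⟨N, hN⟩ := exists_nat_ge (|t| / η)
    have hN' : |t| ≤ N * η := by rwa [div_le_iff₀ hη] at hN
    obtain ⟨a, -, ha⟩ := (isCompact_closedBall (0 : ℂ) N).ultrafilter_le_nhds
      ((hyperfilter ℕ).map fun n => Λ n t - Λ n 0) (tendsto_principal.2
        (Eventually.of_forall fun n => by simpa using (hG n).norm_sub_zero_le N t hN'))
    exact ⟨a, ha⟩
  choose g hg using hlimG
  choose ℓ hℓ using hlimΛ
  have hdist : ∀ s t, dist (g s) (g t) ≤ |t - s| + 0 := fun s t =>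
    le_of_tendsto_of_tendsto ((hg s).dist (hg t)) (tendsto_const_nhds.add (he.mono_left hU))
      (Eventually.of_forall fun n => (hG n).dist_le s t)
  have hsub : ∀ s t, Tendsto (fun n => Λ n t - Λ n s) (hyperfilter ℕ) (𝓝 (ℓ t - ℓ s)) :=
    fun s t => ((hℓ t).sub (hℓ s)).congr fun n => by ring
  refine ⟨g, ℓ, ⟨fun s t => ?_, hdist, fun s t hst => ?_, ?_, ?_⟩⟩
  · have h1 := ((Complex.continuous_exp.tendsto _).comp (hsub s t)).mul
      ((hf.tendsto _).comp (hg s))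
    have h2 := (hf.tendsto _).comp (hg t)
    refine tendsto_nhds_unique h1 (h2.congr fun n => ((hG n).exp_mul s t).symm)
  · exact le_of_tendsto (hsub s t).norm (Eventually.of_forall fun n => (hG n).norm_le s t hst)
  · have h1 : ∀ n, dist (G n 0) (G n T) ≤ |T - τ n| + e n := fun n => by
      rw [(hG n).closed]; exact (hG n).dist_le _ _
    have h2 : Tendsto (fun n => |T - τ n| + e n) (hyperfilter ℕ) (𝓝 0) := by
      have := ((tendsto_const_nhds (x := T)).sub hτ).abs.add he
      simpa using this.mono_left hU
    exact dist_le_zero.1 (le_of_tendsto_of_tendsto ((hg 0).dist (hg T)) h2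
      (Eventually.of_forall h1))
  · have hev : ∀ᶠ n in (hyperfilter ℕ : Filter ℕ), (5 : ℝ) ≤ ‖Λ n T - Λ n 0‖ := by
      filter_upwards [hU (Metric.tendsto_nhds.1 hτ η hη)] with n hn
      have h1 := (hG n).six_le_norm hf0
      have h2 := (hG n).norm_le T (τ n) (by rw [← Real.dist_eq]; exact hn.le)
      have h3 : Λ n (τ n) - Λ n 0 = (Λ n (τ n) - Λ n T) + (Λ n T - Λ n 0) := by ring
      rw [h3] at h1
      linarith [norm_add_le (Λ n (τ n) - Λ n T) (Λ n T - Λ n 0)]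
    have := ge_of_tendsto (hsub 0 T).norm hev
    intro hcon
    rw [hcon] at this
    norm_num at this

theorem sub_eq_log (hf0 : ∀ x, f x ≠ 0) (h : IsApproxLoop f η ε T g ℓ) {s t : ℝ}
    (hst : ‖ℓ t - ℓ s‖ ≤ 2) : ℓ t - ℓ s = Complex.log (f (g t) / f (g s)) :=
  Complex.eq_log_of_norm_le_two hst (by rw [eq_div_iff (hf0 _), h.exp_mul])

theorem continuous_curve (h : IsApproxLoop f η 0 T g ℓ) : Continuous g :=
  (LipschitzWith.of_dist_le_mul (K := 1) fun s t => by
    simpa [Real.dist_eq, abs_sub_comm s t] using h.dist_le s t).continuous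

theorem continuous_log (hf : Continuous f) (hf0 : ∀ x, f x ≠ 0) (hη : 0 < η)
    (h : IsApproxLoop f η 0 T g ℓ) : Continuous ℓ := by
  rw [continuous_iff_continuousAt]
  intro s
  have h1 : ContinuousAt (fun t => ℓ s + Complex.log (f (g t) / f (g s))) s := by
    refine continuousAt_const.add (ContinuousAt.clog ?_ ?_)
    · exact ((hf.comp h.continuous_curve).div_const _).continuousAt
    · rw [div_self (hf0 _)]; exact Complex.one_mem_slitPlane
  refine h1.congr ?_
  filter_upwards [Metric.ball_mem_nhds s hη] with t ht
  rw [Metric.mem_ball, Real.dist_eq] at ht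
  rw [← h.sub_eq_log hf0 ((h.norm_le s t ht.le).trans (by norm_num))]
  ring

theorem norm_sub_le_one (hf0 : ∀ x, f x ≠ 0)
    (hδ : ∀ x y, dist x y < δ → ‖f y / f x - 1‖ ≤ 1 / 2) {a : ℂ} {x y : X} (hxy : dist x y < δ)
    (ha : ‖a‖ ≤ 2) (h : Complex.exp a * f x = f y) : ‖a‖ ≤ 1 := by
  rw [Complex.eq_log_of_norm_le_two ha (by rw [← h, mul_div_cancel_right₀ _ (hf0 x)] :
    Complex.exp a = f y / f x)]
  exact Complex.norm_log_le_one (hδ _ _ hxy)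

/-- A loop of minimal length is simple. -/
theorem injOn_of_minimal (hf0 : ∀ x, f x ≠ 0) (hηδ : η < δ)
    (hδ : ∀ x y, dist x y < δ → ‖f y / f x - 1‖ ≤ 1 / 2)
    (h : IsApproxLoop f η 0 T g ℓ)
    (hmin : ∀ T' g' ℓ', 0 ≤ T' → IsApproxLoop f η 0 T' g' ℓ' → T ≤ T') :
    InjOn g (Ico 0 T) := by
  suffices H : ∀ s t, 0 ≤ s → s < t → t < T → g s ≠ g t by
    intro s hs t ht hst
    rcases lt_trichotomy s t with hlt | heq | hlt
    · exact (H s t hs.1 hlt ht.2 hst).elim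
    · exact heq
    · exact (H t s ht.1 hlt hs.2 hst.symm).elim
  intro s t hs hst htT hgst
  by_cases hℓ : ℓ s = ℓ t
  · let c : ℝ → ℝ := fun u => if u ≤ s then u else u + (t - s)
    have hc_le : ∀ u, u ≤ s → c u = u := fun u hu => if_pos hu
    have hc_gt : ∀ u, s < u → c u = u + (t - s) := fun u hu => if_neg hu.not_ge
    have hdist : ∀ u v, u ≤ v → dist (g (c u)) (g (c v)) ≤ |v - u| + 0 := by
      intro u v huv
      rcases le_or_gt v s with hv | hv
      · rw [hc_le v hv, hc_le u (huv.trans hv)]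
        exact h.dist_le u v
      rcases le_or_gt u s with hu | hu
      · rw [hc_le u hu, hc_gt v hv]
        have h1 := h.dist_le u s
        have h2 := h.dist_le t (v + (t - s))
        have h3 := dist_triangle (g u) (g s) (g (v + (t - s)))
        rw [hgst] at h1 h3
        rw [abs_of_nonneg (by linarith)] at h1 h2 ⊢
        linarith
      · rw [hc_gt u hu, hc_gt v hv]
        simpa using h.dist_le (u + (t - s)) (v + (t - s))
    have hnorm : ∀ u v, u ≤ v → |v - u| ≤ η → ‖ℓ (c v) - ℓ (c u)‖ ≤ 1 := by
      intro u v huv huvη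
      rcases le_or_gt v s with hv | hv
      · rw [hc_le v hv, hc_le u (huv.trans hv)]
        exact h.norm_le u v huvη
      rcases le_or_gt u s with hu | hu
      · refine norm_sub_le_one hf0 hδ ((hdist u v huv).trans_lt (by linarith)) ?_ (h.exp_mul _ _)
        rw [hc_le u hu, hc_gt v hv]
        rw [abs_of_nonneg (by linarith)] at huvη
        have h1 := h.norm_le u s (by rw [abs_of_nonneg (by linarith)]; linarith)
        have h2 := h.norm_le t (v + (t - s)) (by rw [abs_of_nonneg (by linarith)]; linarith)
        have h3 : ℓ (v + (t - s)) - ℓ u = (ℓ (v + (t - s)) - ℓ t) + (ℓ s - ℓ u) := by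
          rw [hℓ]; ring
        rw [h3]
        linarith [norm_add_le (ℓ (v + (t - s)) - ℓ t) (ℓ s - ℓ u)]
      · rw [hc_gt u hu, hc_gt v hv]
        exact h.norm_le _ _ (by simpa using huvη)
    have hcT : c (T - (t - s)) = T := by rw [hc_gt _ (by linarith)]; ring
    have := hmin (T - (t - s)) (g ∘ c) (ℓ ∘ c) (by linarith) ⟨fun u v => h.exp_mul _ _,
      fun u v => ?_, fun u v huv => ?_, ?_, ?_⟩
    · linarith
    · rcases le_total u v with huv | huv
      · exact hdist u v huv
      · rw [dist_comm, abs_sub_comm]; exact hdist v u huv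
    · rcases le_total u v with h' | h'
      · exact hnorm u v h' huv
      · rw [norm_sub_rev]; exact hnorm v u h' (by rwa [abs_sub_comm])
    · simp only [Function.comp_apply, hcT, hc_le 0 hs, h.closed]
    · simp only [Function.comp_apply, hcT, hc_le 0 hs]
      exact h.ne
  · have := hmin (t - s) (fun u => g (s + u)) (fun u => ℓ (s + u)) (by linarith)
      ⟨fun u v => h.exp_mul _ _, fun u v => by simpa using h.dist_le (s + u) (s + v),
        fun u v huv => h.norm_le _ _ (by simpa using huv), by simpa using hgst, by simpa using hℓ⟩
    linarith

end IsApproxLoop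

/-! ### Weights of walks -/

namespace SimpleGraph.Walk

variable {V A : Type*} {G : SimpleGraph V}

/-- The sum of the weights `w` of the successive steps of a walk. -/
def weight [AddMonoid A] (w : V → V → A) : ∀ {u v : V}, G.Walk u v → A
  | _, _, nil => 0
  | u, _, cons (v := v) _ p => w u v + p.weight w

@[simp]
theorem weight_nil [AddMonoid A] (w : V → V → A) (u : V) : (nil : G.Walk u u).weight w = 0 := rfl

@[simp]
theorem weight_cons [AddMonoid A] (w : V → V → A) {u v x : V} (h : G.Adj u v) (p : G.Walk v x) :
    (cons h p).weight w = w u v + p.weight w := rfl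

theorem weight_append [AddMonoid A] (w : V → V → A) {u v x : V} (p : G.Walk u v)
    (q : G.Walk v x) : (p.append q).weight w = p.weight w + q.weight w := by
  induction p with
  | nil => simp
  | cons h p ih => simp [ih, add_assoc]

theorem weight_reverse [AddCommGroup A] (w : V → V → A) (hw : ∀ u v, G.Adj u v → w v u = -w u v)
    {u v : V} (p : G.Walk u v) : p.reverse.weight w = -p.weight w := by
  induction p with
  | nil => simp
  | cons h p ih =>
    rw [reverse_cons, weight_append, ih]
    simp [hw _ _ h, add_comm]

theorem exists_isPath_weight_eq [AddCommGroup A] {w : V → V → A}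
    (hw : ∀ (u v : V) (h : G.Adj u v) (q : G.Walk v u), q.IsPath → (cons h q).weight w = 0)
    {u v : V} (p : G.Walk u v) : ∃ q : G.Walk u v, q.IsPath ∧ q.weight w = p.weight w := by
  classical
  induction p with
  | nil => exact ⟨nil, IsPath.nil, rfl⟩
  | @cons a b c h p ih =>
    obtain ⟨q, hq, hqp⟩ := ih
    by_cases ha : a ∈ q.support
    · refine ⟨q.dropUntil a ha, hq.dropUntil ha, ?_⟩
      have h1 := hw a b h (q.takeUntil a ha) (hq.takeUntil ha)
      have h2 := congrArg (weight w) (q.take_spec ha)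
      rw [weight_append] at h2
      rw [weight_cons] at h1 ⊢
      rw [← hqp, ← h2, ← add_assoc, h1, zero_add]
    · exact ⟨cons h q, hq.cons ha, by simp [hqp]⟩

/-- If all simple cycles have weight zero then so do all closed walks. -/
theorem weight_eq_zero [AddCommGroup A] {w : V → V → A}
    (hw : ∀ (u v : V) (h : G.Adj u v) (q : G.Walk v u), q.IsPath → (cons h q).weight w = 0)
    {u : V} (p : G.Walk u u) : p.weight w = 0 := by
  obtain ⟨q, hq, hqp⟩ := exists_isPath_weight_eq hw p
  rw [← hqp, (isPath_iff_nil.1 hq).eq_nil, weight_nil]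

theorem weight_add_le_two_mul_sum (d : V → ℝ) {u v : V} (p : G.Walk u v) :
    p.weight (fun i j => d i + d j) + d u + d v ≤ 2 * (p.support.map d).sum := by
  induction p with
  | nil => simp; linarith
  | cons h p ih => simp only [weight_cons, support_cons, List.map_cons, List.sum_cons]; linarith

theorem IsPath.weight_cons_le [Fintype V] {d : V → ℝ} (hd : ∀ i, 0 ≤ d i) {u v : V}
    (h : G.Adj u v) {q : G.Walk v u} (hq : q.IsPath) :
    (cons h q).weight (fun i j => d i + d j) ≤ 2 * ∑ i, d i := by
  classical
  have h1 := q.weight_add_le_two_mul_sum d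
  have h2 : (q.support.map d).sum ≤ ∑ i, d i := by
    rw [← List.sum_toFinset d hq.support_nodup]
    exact Finset.sum_le_sum_of_subset_of_nonneg (Finset.subset_univ _) fun i _ _ => hd i
  rw [weight_cons]
  linarith

end SimpleGraph.Walk

/-- A weight whose sum over simple cycles vanishes is the difference of a potential. -/
theorem SimpleGraph.exists_potential {V A : Type*} [AddCommGroup A] (G : SimpleGraph V)
    {w : V → V → A} (hanti : ∀ u v, G.Adj u v → w v u = -w u v)
    (hw : ∀ (u v : V) (h : G.Adj u v) (q : G.Walk v u), q.IsPath →
      (Walk.cons h q).weight w = 0) :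
    ∃ (r : V → V) (p : ∀ v, G.Walk (r v) v), ∀ u v, G.Adj u v → r u = r v ∧
      (p v).weight w = (p u).weight w + w u v := by
  let r : V → V := fun v => (G.connectedComponentMk v).out
  have hr : ∀ v, G.Reachable (r v) v := fun v =>
    ConnectedComponent.exact (Quot.out_eq (G.connectedComponentMk v))
  refine ⟨r, fun v => (hr v).some, fun u v h => ?_⟩
  have hruv : r u = r v := by
    simp only [r, ConnectedComponent.sound h.reachable]
  refine ⟨hruv, ?_⟩
  have key : ∀ (a b : V) (hab : a = b) (P : G.Walk a u) (Q : G.Walk b v),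
      Q.weight w = P.weight w + w u v := by
    rintro a _ rfl P Q
    have h0 := Walk.weight_eq_zero hw (P.append (Walk.cons h Q.reverse))
    rw [Walk.weight_append, Walk.weight_cons, Walk.weight_reverse w hanti, ← add_assoc,
      ← sub_eq_add_neg, sub_eq_zero] at h0
    exact h0.symm
  exact key _ _ hruv _ _

section Nerve

variable {X : Type*} [MetricSpace X] {f : X → ℂ} {δ η ε : ℝ}

/-- A walk gives a step function whose branch of the logarithm is read off from its weight. -/
theorem exists_step_curve_of_walk (hf0 : ∀ x, f x ≠ 0)
    (hδ : ∀ x y, dist x y < δ → ‖f y / f x - 1‖ ≤ 1 / 2) (hηδ : η + ε < δ) (hη : 0 ≤ η)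
    {V : Type*} {G : SimpleGraph V} {x : V → X} {d : V → ℝ} (hd : ∀ i, 0 < d i)
    (hdε : ∀ i j, d i + d j ≤ ε) (hdist : ∀ i j, G.Adj i j → dist (x i) (x j) ≤ d i + d j)
    {u v : V} (p : G.Walk u v) :
    ∃ (g : ℝ → X) (ℓ : ℝ → ℂ), g 0 = x u ∧ ℓ 0 = 0 ∧
      (∀ t, p.weight (fun i j => d i + d j) ≤ t →
        g t = x v ∧ ℓ t = p.weight fun i j => Complex.log (f (x j) / f (x i))) ∧
      (∀ t, 0 ≤ t → dist (g 0) (g t) ≤ t) ∧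
      (∀ s t, Complex.exp (ℓ t - ℓ s) * f (g s) = f (g t)) ∧
      (∀ s t, s ≤ t → dist (g s) (g t) ≤ t - s + ε) ∧
      (∀ s t, s ≤ t → t - s ≤ η → ‖ℓ t - ℓ s‖ ≤ 1) := by
  induction p with
  | @nil u =>
    have hε : 0 ≤ ε := (add_pos (hd u) (hd u)).le.trans (hdε u u)
    refine ⟨fun _ => x u, fun _ => 0, rfl, rfl, by simp, by simp, by simp, ?_, by simp⟩
    intro s t hst
    simp only [dist_self]
    linarith
  | @cons a b c h p ih =>
    obtain ⟨g, ℓ, hg0, hℓ0, hend, hlip0, hexp, hlip, hnorm⟩ := ih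
    set D := d a + d b with hD
    have hDpos : 0 < D := add_pos (hd a) (hd b)
    have hDε : D ≤ ε := hdε a b
    have hab := hdist a b h
    set w := Complex.log (f (x b) / f (x a)) with hw
    have hwexp : Complex.exp w * f (x a) = f (x b) := by
      rw [hw, Complex.exp_log (div_ne_zero (hf0 _) (hf0 _)), div_mul_cancel₀ _ (hf0 _)]
    have hw1 : ‖w‖ ≤ 1 := Complex.norm_log_le_one (hδ _ _ (by linarith))
    let g' : ℝ → X := fun t => if t < D then x a else g (t - D)
    let ℓ' : ℝ → ℂ := fun t => if t < D then 0 else w + ℓ (t - D)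
    have g_lt : ∀ t, t < D → g' t = x a := fun t ht => if_pos ht
    have ℓ_lt : ∀ t, t < D → ℓ' t = 0 := fun t ht => if_pos ht
    have g_ge : ∀ t, D ≤ t → g' t = g (t - D) := fun t ht => if_neg ht.not_gt
    have ℓ_ge : ∀ t, D ≤ t → ℓ' t = w + ℓ (t - D) := fun t ht => if_neg ht.not_gt
    have hfar : ∀ t, D ≤ t → dist (x a) (g (t - D)) ≤ t := fun t ht => by
      have h1 := hlip0 (t - D) (by linarith)
      rw [hg0] at h1
      linarith [dist_triangle (x a) (x b) (g (t - D))]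
    have hexp0 : ∀ t, D ≤ t → Complex.exp (ℓ' t) * f (x a) = f (g' t) := fun t ht => by
      have h1 := hexp 0 (t - D)
      rw [hℓ0, sub_zero, hg0] at h1
      rw [ℓ_ge t ht, g_ge t ht, Complex.exp_add, ← h1, ← hwexp]
      ring
    have hexp' : ∀ t, Complex.exp (ℓ' t) * f (x a) = f (g' t) := fun t => by
      rcases lt_or_ge t D with ht | ht
      · simp [ℓ_lt t ht, g_lt t ht]
      · exact hexp0 t ht
    have hexp'' : ∀ s t, Complex.exp (ℓ' t - ℓ' s) * f (g' s) = f (g' t) := fun s t => by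
      rw [← hexp' s, ← hexp' t, ← mul_assoc, ← Complex.exp_add, sub_add_cancel]
    have hlip' : ∀ s t, s ≤ t → dist (g' s) (g' t) ≤ t - s + ε := by
      intro s t hst
      rcases lt_or_ge t D with ht | ht
      · rw [g_lt t ht, g_lt s (hst.trans_lt ht), dist_self]
        linarith
      rcases lt_or_ge s D with hs | hs
      · rw [g_lt s hs, g_ge t ht]
        linarith [hfar t ht]
      · rw [g_ge s hs, g_ge t ht]
        linarith [hlip (s - D) (t - D) (by linarith)]
    refine ⟨g', ℓ', g_lt 0 hDpos, ℓ_lt 0 hDpos, ?_, ?_, hexp'', hlip', ?_⟩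
    · intro t ht
      rw [SimpleGraph.Walk.weight_cons] at ht
      have hp0 : 0 ≤ p.weight (fun i j => d i + d j) := by
        clear * - hd
        induction p with
        | nil => simp
        | @cons a b _ _ p ih =>
          rw [SimpleGraph.Walk.weight_cons]
          linarith [hd a, hd b]
      have hDt : D ≤ t := by linarith
      obtain ⟨h1, h2⟩ := hend (t - D) (by linarith)
      exact ⟨(g_ge t hDt).trans h1, by rw [ℓ_ge t hDt, h2, SimpleGraph.Walk.weight_cons]⟩
    · intro t ht
      rw [g_lt 0 hDpos]
      rcases lt_or_ge t D with h' | h'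
      · rw [g_lt t h', dist_self]; exact ht
      · rw [g_ge t h']; exact hfar t h'
    · intro s t hst hstη
      rcases lt_or_ge t D with ht | ht
      · simp [ℓ_lt t ht, ℓ_lt s (hst.trans_lt ht)]
      rcases lt_or_ge s D with hs | hs
      · refine IsApproxLoop.norm_sub_le_one hf0 hδ ((hlip' s t hst).trans_lt (by linarith)) ?_
          (hexp'' s t)
        have h1 := hnorm 0 (t - D) (by linarith) (by linarith)
        rw [hℓ0, sub_zero] at h1
        rw [ℓ_lt s hs, ℓ_ge t ht, sub_zero]
        linarith [norm_add_le w (ℓ (t - D))]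
      · rw [ℓ_ge s hs, ℓ_ge t ht, add_sub_add_left_eq_sub]
        exact hnorm _ _ (by linarith) (by linarith)

theorem exists_log_of_forall_cycle (hf : Continuous f) (hf0 : ∀ x, f x ≠ 0)
    (hδ : ∀ x y, dist x y < δ → ‖f y / f x - 1‖ ≤ 1 / 2) {V : Type*} {E : V → Set X}
    (hE : ∀ i, IsOpen (E i)) (hcover : ∀ z, ∃ i, z ∈ E i) {x : V → X} (hx : ∀ i, x i ∈ E i)
    {G : SimpleGraph V} (hG : ∀ i j, i ≠ j → (E i ∩ E j).Nonempty → G.Adj i j)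
    (hGδ : ∀ i j, G.Adj i j → dist (x i) (x j) < δ)
    (hdiam : ∀ i, ∀ y ∈ E i, ∀ z ∈ E i, dist y z < δ)
    (hcycle : ∀ (u v : V) (h : G.Adj u v) (q : G.Walk v u), q.IsPath →
      (SimpleGraph.Walk.cons h q).weight (fun i j => Complex.log (f (x j) / f (x i))) = 0) :
    ∃ L : X → ℂ, Continuous L ∧ ∀ z, Complex.exp (L z) = f z := by
  have hslit : ∀ y z, dist y z < δ → f z / f y ∈ Complex.slitPlane := fun y z hyz => by
    have h1 := hδ y z hyz
    have h2 : f z / f y ∈ Metric.ball (1 : ℂ) 1 := by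
      rw [mem_ball_iff_norm]; linarith
    exact Complex.ball_one_subset_slitPlane h2
  have hexplog : ∀ y z, Complex.exp (Complex.log (f z / f y)) = f z / f y := fun y z =>
    Complex.exp_log (div_ne_zero (hf0 _) (hf0 _))
  have hanti : ∀ i j, G.Adj i j →
      Complex.log (f (x i) / f (x j)) = -Complex.log (f (x j) / f (x i)) := by
    intro i j h
    have h1 := Complex.norm_log_le_one (hδ _ _ (hGδ i j h))
    have h2 := Complex.norm_log_le_one (hδ _ _ (hGδ j i h.symm))
    refine Complex.eq_of_exp_eq_exp_of_norm_sub_lt ?_ ?_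
    · rw [Complex.exp_neg, hexplog, hexplog, inv_div]
    · rw [sub_neg_eq_add]
      linarith [norm_add_le (Complex.log (f (x i) / f (x j))) (Complex.log (f (x j) / f (x i)))]
  obtain ⟨r, p, hp⟩ := G.exists_potential hanti hcycle
  let w : V → V → ℂ := fun i j => Complex.log (f (x j) / f (x i))
  let a : V → ℂ := fun i => Complex.log (f (x (r i))) + (p i).weight w
  have hwalk : ∀ {i j : V} (q : G.Walk i j), Complex.exp (q.weight w) * f (x i) = f (x j) := by
    intro i j q
    induction q with
    | nil => simp
    | @cons u v _ h q ih =>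
      rw [SimpleGraph.Walk.weight_cons, Complex.exp_add, ← ih]
      simp only [w]
      rw [hexplog]
      field_simp [hf0 (x u)]
  have ha : ∀ i, Complex.exp (a i) = f (x i) := fun i => by
    rw [Complex.exp_add, Complex.exp_log (hf0 _), mul_comm, hwalk]
  have hadj : ∀ i j, G.Adj i j → a j = a i + w i j := fun i j h => by
    obtain ⟨h1, h2⟩ := hp i j h
    simp only [a, ← h1]
    rw [add_assoc]
    exact congrArg _ h2
  choose ι hι using hcover
  let L : X → ℂ := fun z => a (ι z) + Complex.log (f z / f (x (ι z)))
  have hL : ∀ i, ∀ z ∈ E i, L z = a i + Complex.log (f z / f (x i)) := by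
    intro i z hz
    simp only [L]
    rcases eq_or_ne (ι z) i with h | h
    · rw [h]
    have hij : G.Adj (ι z) i := hG _ _ h ⟨z, hι z, hz⟩
    rw [hadj _ _ hij, add_assoc (a (ι z))]
    refine congrArg (a (ι z) + ·) ?_
    have h1 := Complex.norm_log_le_one (hδ _ _ (hdiam _ _ (hx (ι z)) _ (hι z)))
    have h2 := Complex.norm_log_le_one (hδ _ _ (hdiam _ _ (hx i) _ hz))
    have h3 := Complex.norm_log_le_one (hδ _ _ (hGδ _ _ hij))
    refine Complex.eq_of_exp_eq_exp_of_norm_sub_lt ?_ ?_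
    · simp only [w]
      rw [Complex.exp_add, hexplog, hexplog, hexplog]
      field_simp [hf0 (x i), hf0 (x (ι z))]
    · refine (norm_sub_le _ _).trans_lt ?_
      have := norm_add_le (w (ι z) i) (Complex.log (f z / f (x i)))
      simp only [w] at this ⊢
      linarith
  refine ⟨L, ?_, fun z => ?_⟩
  · rw [continuous_iff_continuousAt]
    intro z
    have h1 : ContinuousAt (fun y => a (ι z) + Complex.log (f y / f (x (ι z)))) z :=
      continuousAt_const.add ((hf.div_const _).continuousAt.clog
        (hslit _ _ (hdiam _ _ (hx (ι z)) _ (hι z))))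
    exact h1.congr (by
      filter_upwards [(hE (ι z)).mem_nhds (hι z)] with y hy using (hL _ y hy).symm)
  · simp only [L]
    rw [Complex.exp_add, ha, hexplog, mul_div_cancel₀ _ (hf0 _)]

end Nerve

/-! ### Compact spaces of finite length -/

theorem exists_finite_open_cover_sum_diam_le {X : Type*} [MetricSpace X] [CompactSpace X]
    [MeasurableSpace X] [BorelSpace X] (hX : μH[1] (univ : Set X) < ⊤) {ε : ℝ} (hε : 0 < ε) :
    ∃ (V : Finset ℕ) (E : V → Set X) (x : V → X) (d : V → ℝ), (∀ i, IsOpen (E i)) ∧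
      (∀ z, ∃ i, z ∈ E i) ∧ (∀ i, x i ∈ E i) ∧ (∀ i, 0 < d i) ∧ (∀ i, d i ≤ ε) ∧
      (∀ i, ∀ y ∈ E i, ∀ z ∈ E i, dist y z ≤ d i) ∧
      ∑ i, d i ≤ (μH[1] (univ : Set X)).toReal + 2 := by
  classical
  have hε2 : 0 < ENNReal.ofReal (ε / 2) := ENNReal.ofReal_pos.2 (by positivity)
  have hlt : (⨅ (t : ℕ → Set X) (_ : univ ⊆ ⋃ n, t n)
      (_ : ∀ n, Metric.ediam (t n) ≤ ENNReal.ofReal (ε / 2)),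
      ∑' n, ⨆ _ : (t n).Nonempty, Metric.ediam (t n) ^ (1 : ℝ)) < μH[1] (univ : Set X) + 1 := by
    refine lt_of_le_of_lt ?_ (ENNReal.lt_add_right hX.ne one_ne_zero)
    rw [Measure.hausdorffMeasure_apply]
    exact le_iSup₂_of_le _ hε2 le_rfl
  simp only [iInf_lt_iff] at hlt
  obtain ⟨t, htcover, htdiam, htsum⟩ := hlt
  obtain ⟨c, hc0, hcsum⟩ := ENNReal.exists_pos_sum_of_countable
    (ε := min 1 (ENNReal.ofReal (ε / 2))) (by simp [hε]) ℕ
  have hcε : ∀ n, (c n : ℝ) ≤ ε / 2 := fun n => by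
    have h1 := (ENNReal.le_tsum n).trans (hcsum.le.trans (min_le_right _ _))
    rw [← ENNReal.ofReal_coe_nnreal] at h1
    exact (ENNReal.ofReal_le_ofReal_iff (by positivity)).1 h1
  have htfin : ∀ n, Metric.ediam (t n) ≠ ⊤ := fun n =>
    ((htdiam n).trans_lt ENNReal.ofReal_lt_top).ne
  let E : ℕ → Set X := fun n => Metric.thickening (c n / 2) (t n)
  have htE : ∀ n, t n ⊆ E n := fun n =>
    Metric.self_subset_thickening (half_pos (NNReal.coe_pos.2 (hc0 n))) _
  obtain ⟨F, hF⟩ := isCompact_univ.elim_finite_subcover E (fun n => Metric.isOpen_thickening)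
    (htcover.trans (iUnion_mono htE))
  have hV : ∀ n : (F.filter fun n => (t n).Nonempty), (t n).Nonempty := fun n =>
    (Finset.mem_filter.1 n.2).2
  choose x hx using hV
  let d : ℕ → ℝ := fun n => Metric.diam (t n) + c n
  refine ⟨F.filter fun n => (t n).Nonempty, fun n => E n, x, fun n => d n,
    fun n => Metric.isOpen_thickening, fun z => ?_, fun n => htE n (hx n),
    fun n => ?_, fun n => ?_, fun n y hy z hz => ?_, ?_⟩
  · obtain ⟨n, hn, hz⟩ := mem_iUnion₂.1 (hF (mem_univ z))
    obtain ⟨y, hy, -⟩ := Metric.mem_thickening_iff.1 hz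
    exact ⟨⟨n, Finset.mem_filter.2 ⟨hn, y, hy⟩⟩, hz⟩
  · exact add_pos_of_nonneg_of_pos Metric.diam_nonneg (NNReal.coe_pos.2 (hc0 n))
  · have h1 : Metric.diam (t n) ≤ ε / 2 := by
      have := ENNReal.toReal_mono ENNReal.ofReal_ne_top (htdiam n)
      rwa [ENNReal.toReal_ofReal (by positivity)] at this
    linarith [hcε n]
  · obtain ⟨a, ha, hya⟩ := Metric.mem_thickening_iff.1 hy
    obtain ⟨b, hb, hzb⟩ := Metric.mem_thickening_iff.1 hz
    have h1 := Metric.dist_le_diam_of_mem' (htfin n) ha hb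
    have h2 := dist_triangle4 y a b z
    rw [dist_comm b z] at h2
    simp only [d]
    linarith
  · rw [Finset.sum_coe_sort (F.filter fun n => (t n).Nonempty) d]
    have h1 : ∑ n ∈ F.filter (fun n => (t n).Nonempty), ENNReal.ofReal (d n) ≤
        μH[1] (univ : Set X) + 2 := by
      calc ∑ n ∈ F.filter (fun n => (t n).Nonempty), ENNReal.ofReal (d n)
          ≤ ∑ n ∈ F.filter (fun n => (t n).Nonempty),
            ((⨆ _ : (t n).Nonempty, Metric.ediam (t n) ^ (1 : ℝ)) + c n) := by
            refine Finset.sum_le_sum fun n hn => ?_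
            rw [ENNReal.ofReal_add Metric.diam_nonneg (NNReal.coe_nonneg _),
              ENNReal.ofReal_coe_nnreal, Metric.diam, ENNReal.ofReal_toReal (htfin n)]
            simp [(Finset.mem_filter.1 hn).2]
        _ ≤ ∑' n, ((⨆ _ : (t n).Nonempty, Metric.ediam (t n) ^ (1 : ℝ)) + c n) :=
            ENNReal.sum_le_tsum _
        _ ≤ (μH[1] (univ : Set X) + 1) + 1 := by
            rw [ENNReal.tsum_add]
            exact add_le_add htsum.le (hcsum.le.trans (min_le_left _ _))
        _ = μH[1] (univ : Set X) + 2 := by rw [add_assoc, one_add_one_eq_two]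
    rw [← ENNReal.ofReal_sum_of_nonneg fun n _ =>
      add_nonneg Metric.diam_nonneg (NNReal.coe_nonneg _)] at h1
    have h2 := ENNReal.toReal_mono (by finiteness) h1
    rw [ENNReal.toReal_add hX.ne (by simp), ENNReal.toReal_ofReal (Finset.sum_nonneg fun n _ =>
      add_nonneg Metric.diam_nonneg (NNReal.coe_nonneg _))] at h2
    simpa using h2

theorem exists_pos_forall_norm_div_sub_one_le {X : Type*} [MetricSpace X] [CompactSpace X]
    {f : X → ℂ} (hf : Continuous f) (hf0 : ∀ x, f x ≠ 0) :
    ∃ δ > 0, ∀ x y, dist x y < δ → ‖f y / f x - 1‖ ≤ 1 / 2 := by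
  obtain ⟨c, hc0, hc⟩ : ∃ c > 0, ∀ x, c ≤ ‖f x‖ := by
    rcases isEmpty_or_nonempty X with h | h
    · exact ⟨1, one_pos, fun x => h.elim x⟩
    · obtain ⟨x, -, hx⟩ := isCompact_univ.exists_isMinOn univ_nonempty hf.norm.continuousOn
      exact ⟨‖f x‖, norm_pos_iff.2 (hf0 x), fun y => hx (mem_univ y)⟩
  obtain ⟨δ, hδ, h⟩ := Metric.uniformContinuous_iff.1
    (CompactSpace.uniformContinuous_of_continuous hf) (c / 2) (by positivity)
  refine ⟨δ, hδ, fun x y hxy => ?_⟩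
  have h1 := h hxy
  rw [dist_comm, dist_eq_norm] at h1
  have h2 : f y / f x - 1 = (f y - f x) / f x := by field_simp [hf0 x]
  rw [h2, norm_div, div_le_iff₀ (norm_pos_iff.2 (hf0 x))]
  linarith [hc x]

theorem exists_isApproxLoop_of_forall_no_log {X : Type*} [MetricSpace X] [CompactSpace X]
    [MeasurableSpace X] [BorelSpace X] (hX : μH[1] (univ : Set X) < ⊤) {f : X → ℂ}
    (hf : Continuous f) (hf0 : ∀ x, f x ≠ 0)
    (hlog : ¬∃ L : X → ℂ, Continuous L ∧ ∀ z, Complex.exp (L z) = f z) {δ η ε : ℝ}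
    (hδ : ∀ x y, dist x y < δ → ‖f y / f x - 1‖ ≤ 1 / 2) (hη : 0 ≤ η) (hε : 0 < ε)
    (hηδ : η + ε < δ) :
    ∃ g ℓ, IsApproxLoop f η ε (2 * ((μH[1] (univ : Set X)).toReal + 2)) g ℓ := by
  obtain ⟨V, E, x, d, hE, hcover, hx, hd, hdε, hdiam, hsum⟩ :=
    exists_finite_open_cover_sum_diam_le hX (half_pos hε)
  let G : SimpleGraph V := SimpleGraph.fromRel fun i j => (E i ∩ E j).Nonempty
  have hG : ∀ i j, G.Adj i j ↔ i ≠ j ∧ (E i ∩ E j).Nonempty := fun i j => by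
    simp only [G, SimpleGraph.fromRel_adj, inter_comm (E j), or_self]
  have hdist : ∀ i j, G.Adj i j → dist (x i) (x j) ≤ d i + d j := by
    intro i j h
    obtain ⟨z, hzi, hzj⟩ := ((hG i j).1 h).2
    exact (dist_triangle _ z _).trans
      (add_le_add (hdiam i _ (hx i) _ hzi) (hdiam j _ hzj _ (hx j)))
  have hdε' : ∀ i j, d i + d j ≤ ε := fun i j => by linarith [hdε i, hdε j]
  obtain ⟨u, v, h, q, hq, hne⟩ : ∃ (u v : V) (h : G.Adj u v) (q : G.Walk v u), q.IsPath ∧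
      (SimpleGraph.Walk.cons h q).weight
        (fun i j => Complex.log (f (x j) / f (x i))) ≠ 0 := by
    by_contra! hcon
    exact hlog (exists_log_of_forall_cycle hf hf0 hδ hE hcover hx
      (fun i j hij hne => (hG i j).2 ⟨hij, hne⟩)
      (fun i j hij => by linarith [hdist i j hij, hdε' i j])
      (fun i y hy z hz => by linarith [hdiam i y hy z hz, hdε i]) hcon)
  obtain ⟨g, ℓ, hg0, hℓ0, hend, -, hexp, hlip, hnorm⟩ :=
    exists_step_curve_of_walk hf0 hδ hηδ hη hd hdε' hdist (SimpleGraph.Walk.cons h q)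
  obtain ⟨hgT, hℓT⟩ := hend (2 * ((μH[1] (univ : Set X)).toReal + 2))
    ((hq.weight_cons_le (fun i => (hd i).le) h).trans (by linarith))
  refine ⟨g, ℓ, hexp, fun s t => ?_, fun s t hst => ?_, hg0.trans hgT.symm, ?_⟩
  · rcases le_total s t with h' | h'
    · rw [abs_of_nonneg (sub_nonneg.2 h')]
      exact hlip s t h'
    · rw [abs_sub_comm, abs_of_nonneg (sub_nonneg.2 h'), dist_comm]
      exact hlip t s h'
  · rcases le_total s t with h' | h'
    · exact hnorm s t h' ((le_abs_self _).trans hst)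
    · rw [norm_sub_rev]
      rw [abs_sub_comm] at hst
      exact hnorm t s h' ((le_abs_self _).trans hst)
  · rw [hℓ0, hℓT]
    exact hne.symm

/-- In a compact space of finite length, the absence of a continuous logarithm is detected by
a simple closed curve. -/
theorem exists_simple_loop_of_forall_no_log {X : Type*} [MetricSpace X] [CompactSpace X]
    [MeasurableSpace X] [BorelSpace X] (hX : μH[1] (univ : Set X) < ⊤) {f : X → ℂ}
    (hf : Continuous f) (hf0 : ∀ x, f x ≠ 0)
    (hlog : ¬∃ L : X → ℂ, Continuous L ∧ ∀ z, Complex.exp (L z) = f z) :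
    ∃ (T : ℝ) (g : ℝ → X), 0 < T ∧ Continuous g ∧ g 0 = g T ∧ InjOn g (Ico 0 T) ∧
      ¬∃ L : X → ℂ, ContinuousOn L (g '' Icc 0 T) ∧
        ∀ z ∈ g '' Icc 0 T, Complex.exp (L z) = f z := by
  obtain ⟨δ, hδ0, hδ⟩ := exists_pos_forall_norm_div_sub_one_le hf hf0
  have hη : 0 < δ / 2 := half_pos hδ0
  set M := 2 * ((μH[1] (univ : Set X)).toReal + 2) with hM
  have hM0 : 0 ≤ M := by positivity
  have hex : ∃ g ℓ, IsApproxLoop f (δ / 2) 0 M g ℓ := by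
    refine IsApproxLoop.exists_of_tendsto (e := fun n : ℕ => δ / 3 * (1 / ((n : ℝ) + 1))) hf hf0 hη
      (tendsto_const_nhds (x := M)) ?_ fun n => ?_
    · simpa using (tendsto_one_div_add_atTop_nhds_zero_nat (𝕜 := ℝ)).const_mul (δ / 3)
    · refine exists_isApproxLoop_of_forall_no_log hX hf hf0 hlog hδ hη.le (by positivity) ?_
      have h1 : (1 : ℝ) / ((n : ℝ) + 1) ≤ 1 := by
        rw [div_le_one (by positivity)]
        linarith [(Nat.cast_nonneg n : (0 : ℝ) ≤ n)]
      nlinarith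
  let A : Set ℝ := {T | 0 ≤ T ∧ ∃ g ℓ, IsApproxLoop f (δ / 2) 0 T g ℓ}
  have hAne : A.Nonempty := ⟨M, hM0, hex⟩
  have hAbdd : BddBelow A := ⟨0, fun T hT => hT.1⟩
  obtain ⟨τ, -, hτ, hτA⟩ := exists_seq_tendsto_sInf hAne hAbdd
  obtain ⟨g, ℓ, h⟩ := IsApproxLoop.exists_of_tendsto hf hf0 hη hτ tendsto_const_nhds
    fun n => (hτA n).2
  have hT0 : 0 ≤ sInf A := Real.sInf_nonneg fun T hT => hT.1
  have hT : 0 < sInf A := hT0.lt_of_ne fun h0 => h.ne (by rw [← h0])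
  refine ⟨sInf A, g, hT, h.continuous_curve, h.closed,
    h.injOn_of_minimal hf0 (half_lt_self hδ0) hδ
      fun T' g' ℓ' hT' h' => csInf_le hAbdd ⟨hT', g', ℓ', h'⟩, ?_⟩
  rintro ⟨L, hL, hLf⟩
  have hmem : ∀ t ∈ Icc 0 (sInf A), g t ∈ g '' Icc 0 (sInf A) := fun t ht =>
    mem_image_of_mem g ht
  have h0 : (0 : ℝ) ∈ Icc 0 (sInf A) := left_mem_Icc.2 hT0
  have h1 : sInf A ∈ Icc 0 (sInf A) := right_mem_Icc.2 hT0
  have hconst := Complex.eqOn_const_of_exp_eq (isPreconnected_Icc (a := 0) (b := sInf A))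
    (h := fun t => L (g t) - ℓ t) (c := f (g 0) / Complex.exp (ℓ 0))
    ((hL.comp h.continuous_curve.continuousOn hmem).sub
      (h.continuous_log hf hf0 hη).continuousOn)
    (fun t ht => by
      rw [Complex.exp_sub, hLf _ (hmem t ht), ← h.exp_mul 0 t, Complex.exp_sub]
      field_simp [Complex.exp_ne_zero]) h0 h1
  rw [← h.closed] at hconst
  exact h.ne (sub_right_injective hconst)

/-! ### Logarithms and separation in the plane -/

theorem IsOpen.frontier_connectedComponentIn_subset_compl {Z : Type*} [TopologicalSpace Z]
    [LocallyConnectedSpace Z] {W : Set Z} (hW : IsOpen W) (x : Z) :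
    frontier (connectedComponentIn W x) ⊆ Wᶜ := by
  intro z hz hzW
  rw [hW.connectedComponentIn.frontier_eq] at hz
  obtain ⟨w, hwz, hwx⟩ := mem_closure_iff.1 hz.1 _ hW.connectedComponentIn
    (mem_connectedComponentIn hzW)
  have heq := (connectedComponentIn_eq hwz).trans (connectedComponentIn_eq hwx).symm
  exact hz.2 (heq ▸ mem_connectedComponentIn hzW)

theorem Complex.not_exists_log_on_sphere {R : ℝ} (hR : 0 < R) {Λ : ℂ → ℂ} (hΛ : Continuous Λ)
    (h : ∀ z ∈ Metric.sphere (0 : ℂ) R, Complex.exp (Λ z) = z) : False := by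
  have hneg : ∀ z ∈ Metric.sphere (0 : ℂ) R, -z ∈ Metric.sphere (0 : ℂ) R := fun z hz => by
    simpa using hz
  have hne : ∀ z ∈ Metric.sphere (0 : ℂ) R, z ≠ 0 := fun z hz => by
    rintro rfl
    simp [hR.ne] at hz
  have hRmem : (R : ℂ) ∈ Metric.sphere (0 : ℂ) R := by simp [abs_of_pos hR]
  have hexp : ∀ z ∈ Metric.sphere (0 : ℂ) R, Complex.exp (Λ z - Λ (-z)) = -1 := fun z hz => by
    rw [Complex.exp_sub, h z hz, h _ (hneg z hz), div_neg, div_self (hne z hz)]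
  have hconst := Complex.eqOn_const_of_exp_eq
    (isPreconnected_sphere (by rw [Complex.rank_real_complex]; norm_num) (0 : ℂ) R)
    (h := fun z => Λ z - Λ (-z)) (by fun_prop) hexp hRmem (hneg _ hRmem)
  have h0 : Λ R - Λ (-R) = 0 := by
    rw [neg_neg] at hconst
    linear_combination hconst / 2
  have := hexp _ hRmem
  rw [h0, Complex.exp_zero] at this
  norm_num at this

/-- A set on which `z` has a continuous logarithm does not enclose the origin. -/
theorem Complex.not_isBounded_connectedComponentIn_of_log {K : Set ℂ} (hK : IsClosed K)
    (h0 : (0 : ℂ) ∉ K) {L : ℂ → ℂ} (hL : Continuous L) (hLK : ∀ z ∈ K, Complex.exp (L z) = z) :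
    ¬Bornology.IsBounded (connectedComponentIn Kᶜ 0) := by
  classical
  intro hbdd
  set U := connectedComponentIn Kᶜ 0 with hU
  have h0U : (0 : ℂ) ∈ U := mem_connectedComponentIn h0
  have hfr : frontier U ⊆ K := by
    simpa using hK.isOpen_compl.frontier_connectedComponentIn_subset_compl 0
  have hF : Continuous (U.piecewise (fun z => Complex.exp (L z)) id) :=
    Continuous.piecewise (fun z hz => hLK z (hfr hz)) (by fun_prop) continuous_id
  have hF0 : ∀ z, U.piecewise (fun z => Complex.exp (L z)) id z ≠ 0 := by
    intro z
    by_cases hz : z ∈ U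
    · rw [piecewise_eq_of_mem _ _ _ hz]
      exact Complex.exp_ne_zero _
    · rw [piecewise_eq_of_notMem _ _ _ hz]
      rintro rfl
      exact hz h0U
  obtain ⟨Λ, ⟨-, hΛ⟩, -⟩ := Complex.isCoveringMapOn_exp.existsUnique_continuousMap_lifts
    ⟨_, hF⟩ (a₀ := 0) (Complex.exp_log (hF0 0)) hF0
  obtain ⟨R, hR0, hR⟩ := hbdd.subset_ball_lt 0 0
  refine Complex.not_exists_log_on_sphere hR0 Λ.continuous fun z hz => ?_
  have hzU : z ∉ U := fun hzU => by
    have := hR hzU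
    rw [mem_ball_zero_iff] at this
    rw [mem_sphere_zero_iff_norm] at hz
    linarith
  have := congrFun hΛ z
  simpa [piecewise_eq_of_notMem _ _ _ hzU] using this

/-- The function `z - p` has a continuous logarithm on `T`. -/
def HasLogAt (T : Set ℂ) (p : ℂ) : Prop :=
  ∃ L : ℂ → ℂ, ContinuousOn L T ∧ ∀ z ∈ T, Complex.exp (L z) = z - p

theorem HasLogAt.of_norm_sub_lt {T : Set ℂ} {p q : ℂ} (h : HasLogAt T p)
    (hpq : ∀ z ∈ T, ‖p - q‖ < ‖z - p‖) : HasLogAt T q := by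
  obtain ⟨L, hL, hLp⟩ := h
  have hne : ∀ z ∈ T, z - p ≠ 0 := fun z hz =>
    norm_pos_iff.1 ((norm_nonneg _).trans_lt (hpq z hz))
  have hslit : ∀ z ∈ T, 1 + (p - q) / (z - p) ∈ Complex.slitPlane := fun z hz => by
    refine Complex.ball_one_subset_slitPlane ?_
    rw [mem_ball_iff_norm, add_sub_cancel_left, norm_div,
      div_lt_one (norm_pos_iff.2 (hne z hz))]
    exact hpq z hz
  refine ⟨fun z => L z + Complex.log (1 + (p - q) / (z - p)), hL.add (ContinuousOn.clog ?_ hslit),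
    fun z hz => ?_⟩
  · exact continuousOn_const.add (continuousOn_const.div (by fun_prop) hne)
  · rw [Complex.exp_add, hLp z hz, Complex.exp_log (Complex.slitPlane_ne_zero (hslit z hz)),
      mul_add, mul_div_cancel₀ _ (hne z hz)]
    ring

theorem hasLogAt_of_norm_lt {T : Set ℂ} {p : ℂ} (hp : ∀ z ∈ T, ‖z‖ < ‖p‖) : HasLogAt T p := by
  rcases T.eq_empty_or_nonempty with rfl | ⟨z₀, hz₀⟩
  · exact ⟨0, continuousOn_empty _, by simp⟩
  have hp0 : p ≠ 0 := norm_pos_iff.1 ((norm_nonneg _).trans_lt (hp z₀ hz₀))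
  have hslit : ∀ z ∈ T, 1 - z / p ∈ Complex.slitPlane := fun z hz => by
    refine Complex.ball_one_subset_slitPlane ?_
    rw [mem_ball_iff_norm, sub_sub_cancel_left, norm_neg, norm_div,
      div_lt_one (norm_pos_iff.2 hp0)]
    exact hp z hz
  refine ⟨fun z => Complex.log (-p) + Complex.log (1 - z / p),
    continuousOn_const.add (ContinuousOn.clog (by fun_prop) hslit), fun z hz => ?_⟩
  rw [Complex.exp_add, Complex.exp_log (neg_ne_zero.2 hp0),
    Complex.exp_log (Complex.slitPlane_ne_zero (hslit z hz))]
  field_simp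
  ring

theorem eventually_hasLogAt_iff {T : Set ℂ} (hT : IsClosed T) {p : ℂ} (hp : p ∉ T) :
    ∀ᶠ q in 𝓝 p, q ∉ T ∧ (HasLogAt T q ↔ HasLogAt T p) := by
  obtain ⟨r, hr, hball⟩ := Metric.isOpen_iff.1 hT.isOpen_compl p hp
  filter_upwards [Metric.ball_mem_nhds p (half_pos hr), hT.isOpen_compl.mem_nhds hp] with q hq hqT
  have hfar : ∀ z ∈ T, r ≤ ‖z - p‖ := fun z hz => by
    by_contra! hlt
    exact hball (mem_ball_iff_norm.2 hlt) hz
  rw [mem_ball_iff_norm] at hq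
  refine ⟨hqT, fun h => h.of_norm_sub_lt fun z hz => ?_, fun h => h.of_norm_sub_lt fun z hz => ?_⟩
  · have h1 := norm_add_le (z - q) (q - p)
    rw [sub_add_sub_cancel] at h1
    linarith [hfar z hz]
  · rw [norm_sub_rev]
    linarith [hfar z hz]

/-! ### Punctured spheres -/

/-- Coordinates on the complement of a point `y`, centred at `x`. -/
structure PlaneChart {Y : Type*} [TopologicalSpace Y] (x y : Y) (φ : Y → ℂ) (ψ : ℂ → Y) :
    Prop where
  continuousOn : ContinuousOn φ {y}ᶜ
  continuous_symm : Continuous ψ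
  symm_ne : ∀ z, ψ z ≠ y
  right_inv : ∀ z, φ (ψ z) = z
  left_inv : ∀ w, w ≠ y → ψ (φ w) = w
  map_center : φ x = 0

theorem exists_planeChart {Y : Type*} [TopologicalSpace Y] (e : Y ≃ₜ S2) (x y : Y) :
    ∃ φ ψ, PlaneChart x y φ ψ := by
  have : Fact (Module.finrank ℝ (EuclideanSpace ℝ (Fin 3)) = 2 + 1) := ⟨by simp⟩
  let σ := stereographic' 2 (e y)
  have hσs : σ.source = {e y}ᶜ := stereographic'_source (e y)
  have hσt : σ.target = univ := stereographic'_target (e y)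
  let β : EuclideanSpace ℝ (Fin 2) ≃ₗᵢ[ℝ] ℂ := Complex.orthonormalBasisOneI.repr.symm
  have hmem : ∀ w, w ≠ y → e w ∈ σ.source := fun w hw => by
    rw [hσs]; simpa using hw
  have htgt : ∀ v, v ∈ σ.target := fun v => by rw [hσt]; trivial
  refine ⟨fun w => β (σ (e w)) - β (σ (e x)),
    fun z => e.symm (σ.symm (β.symm (z + β (σ (e x))))), ?_, ?_, ?_, ?_, ?_, ?_⟩
  · exact (β.continuous.comp_continuousOn
      (σ.continuousOn.comp e.continuous.continuousOn fun w hw => hmem w hw)).sub continuousOn_const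
  · have h1 : Continuous σ.symm := by
      rw [← continuousOn_univ, ← hσt]
      exact σ.continuousOn_symm
    exact e.symm.continuous.comp (h1.comp (β.symm.continuous.comp (by fun_prop)))
  · intro z hz
    have h1 := σ.map_target (htgt (β.symm (z + β (σ (e x)))))
    rw [hσs] at h1
    exact h1 (by rw [mem_singleton_iff, ← hz, e.apply_symm_apply])
  · intro z
    simp [σ.right_inv (htgt _)]
  · intro w hw
    simp [σ.left_inv (hmem w hw)]
  · simp

namespace PlaneChart

variable {Y : Type*} [TopologicalSpace Y] {x y : Y} {φ : Y → ℂ} {ψ : ℂ → Y}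

theorem symm_zero (h : PlaneChart x y φ ψ) (hxy : x ≠ y) : ψ 0 = x := by
  rw [← h.map_center, h.left_inv x hxy]

theorem injOn (h : PlaneChart x y φ ψ) : InjOn φ {y}ᶜ := fun v hv w hw hvw => by
  rw [← h.left_inv v hv, ← h.left_inv w hw, hvw]

theorem isCompact_image (h : PlaneChart x y φ ψ) {K : Set Y} (hK : IsCompact K) (hy : y ∉ K) :
    IsCompact (φ '' K) :=
  hK.image_of_continuousOn (h.continuousOn.mono fun _ hw hwy => hy (hwy ▸ hw))

theorem zero_notMem_image (h : PlaneChart x y φ ψ) {K : Set Y} (hxy : x ≠ y) (hx : x ∉ K)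
    (hy : y ∉ K) : (0 : ℂ) ∉ φ '' K := by
  rintro ⟨k, hk, hk0⟩
  rw [← h.map_center] at hk0
  exact hx (h.injOn (fun hky => hy (hky ▸ hk)) hxy hk0 ▸ hk)

variable [T2Space Y]

/-- A set on which the coordinate has a continuous logarithm does not separate the two poles. -/
theorem not_exists_log [CompactSpace Y] (h : PlaneChart x y φ ψ) {K : Set Y} (hK : IsCompact K)
    (hxy : x ≠ y) (hx : x ∉ K) (hy : y ∉ K) (hsep : SeparatesPoints' K x y) :
    ¬∃ L : K → ℂ, Continuous L ∧ ∀ k : K, Complex.exp (L k) = φ k := by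
  rintro ⟨L, hL, hLφ⟩
  obtain ⟨M, hM⟩ := ContinuousMap.exists_restrict_eq hK.isClosed (⟨L, hL⟩ : C(K, ℂ))
  have hML : ∀ k : K, M k = L k := fun k => congrFun (congrArg DFunLike.coe hM) k
  have h0 := h.zero_notMem_image hxy hx hy
  have hcpt := h.isCompact_image hK hy
  have hunb := Complex.not_isBounded_connectedComponentIn_of_log hcpt.isClosed h0
    (M.continuous.comp h.continuous_symm) (by
      rintro _ ⟨k, hk, rfl⟩
      rw [Function.comp_apply, h.left_inv k fun hky => hy (hky ▸ hk), hML ⟨k, hk⟩, hLφ])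
  set U := connectedComponentIn (φ '' K)ᶜ 0 with hU
  have h0U : (0 : ℂ) ∈ U := mem_connectedComponentIn h0
  have hycl : y ∈ closure (ψ '' U) := by
    rw [mem_closure_iff]
    intro N hN hyN
    have hb := (h.isCompact_image hN.isClosed_compl.isCompact (by simpa using hyN)).isBounded
    by_contra hcon
    refine hunb (hb.subset fun u hu => ⟨ψ u, fun huN => ?_, h.right_inv u⟩)
    exact hcon ⟨ψ u, huN, mem_image_of_mem ψ hu⟩
  have hpre : IsPreconnected (insert y (ψ '' U)) :=
    (isPreconnected_connectedComponentIn.image ψ h.continuous_symm.continuousOn).subset_closure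
      (subset_insert _ _) (insert_subset hycl subset_closure)
  obtain ⟨w, hw, hwK⟩ := hsep _ ⟨⟨y, mem_insert _ _⟩, hpre⟩
    (mem_insert_of_mem _ ⟨0, h0U, h.symm_zero hxy⟩) (mem_insert _ _)
  rcases hw with rfl | ⟨u, hu, rfl⟩
  · exact hy hwK
  · exact connectedComponentIn_subset _ _ hu ⟨ψ u, hwK, h.right_inv u⟩

/-- A set on which the coordinate has no continuous logarithm separates the two poles. -/
theorem separatesPoints (h : PlaneChart x y φ ψ) {T : Set Y} (hT : IsCompact T) (hxy : x ≠ y)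
    (hy : y ∉ T) (hlog : ¬HasLogAt (φ '' T) 0) : SeparatesPoints' T x y := by
  intro S hS hxS hyS
  by_contra hST
  have hST' : ∀ w ∈ S, w ∉ T := fun w hw hwT => hST ⟨w, hw, hwT⟩
  have hcpt := h.isCompact_image hT hy
  have hopen : ∀ b : Prop, IsOpen {p | p ∉ φ '' T ∧ (HasLogAt (φ '' T) p ↔ b)} := fun b => by
    rw [isOpen_iff_mem_nhds]
    rintro p ⟨hp, hpb⟩
    filter_upwards [eventually_hasLogAt_iff hcpt.isClosed hp] with q hq
    exact ⟨hq.1, hq.2.trans hpb⟩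
  have hopenY : ∀ b : Prop, IsOpen ({y}ᶜ ∩ φ ⁻¹' {p | p ∉ φ '' T ∧ (HasLogAt (φ '' T) p ↔ b)}) :=
    fun b => h.continuousOn.isOpen_inter_preimage isOpen_compl_singleton (hopen b)
  obtain ⟨R, hR⟩ := hcpt.isBounded.subset_closedBall 0
  have hfar : IsOpen (ψ '' Metric.closedBall 0 R)ᶜ :=
    ((isCompact_closedBall 0 R).image h.continuous_symm).isClosed.isOpen_compl
  have hmem : ∀ w ∈ S, w ≠ y → φ w ∉ φ '' T := by
    rintro w hw hwy ⟨t, ht, htw⟩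
    exact hST' w hw (h.injOn (fun hty => hy (hty ▸ ht)) hwy htw ▸ ht)
  have hyfar : y ∈ (ψ '' Metric.closedBall 0 R)ᶜ := fun ⟨z, _, hz⟩ => h.symm_ne z hz
  obtain ⟨w, hwS, hwu, hwv⟩ := hS.isPreconnected _ _ ((hopenY True).union hfar) (hopenY False)
    (fun w hw => by
      by_cases hwy : w = y
      · exact Or.inl (Or.inr (hwy ▸ hyfar))
      · by_cases hl : HasLogAt (φ '' T) (φ w)
        · exact Or.inl (Or.inl ⟨hwy, hmem w hw hwy, iff_true_intro hl⟩)
        · exact Or.inr ⟨hwy, hmem w hw hwy, iff_false_intro hl⟩)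
    ⟨y, hyS, Or.inr hyfar⟩
    ⟨x, hxS, hxy, hmem x hxS hxy, by rw [h.map_center]; exact iff_false_intro hlog⟩
  obtain ⟨hwy, -, hwl⟩ := hwv
  rcases hwu with ⟨-, -, hwl'⟩ | hwfar
  · exact hwl.1 (hwl'.2 trivial)
  · refine hwl.1 (hasLogAt_of_norm_lt fun z hz => ?_)
    have h1 := mem_closedBall_zero_iff.1 (hR hz)
    by_contra! h2
    exact hwfar ⟨φ w, mem_closedBall_zero_iff.2 (h2.trans h1), h.left_inv w hwy⟩

end PlaneChart

theorem nonempty_image_Icc_homeomorph_circle {X : Type*} [TopologicalSpace X] [T2Space X]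
    {T : ℝ} (hT : 0 < T) {g : ℝ → X} (hg : Continuous g) (hclosed : g 0 = g T)
    (hinj : InjOn g (Ico 0 T)) : Nonempty (↥(g '' Icc 0 T) ≃ₜ Circle) := by
  have : Fact (0 < T) := ⟨hT⟩
  let G := AddCircle.liftIco T 0 g
  have hG : Continuous G := AddCircle.liftIco_zero_continuous hclosed hg.continuousOn
  have hrep : ∀ a : AddCircle T, ∃ t ∈ Ico 0 T, (t : AddCircle T) = a := fun a => by
    obtain ⟨t, ht, hta⟩ := (AddCircle.coe_image_Ico_eq T 0).symm ▸ mem_univ a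
    exact ⟨t, by simpa using ht, hta⟩
  have hGinj : Function.Injective G := by
    intro a b hab
    obtain ⟨s, hs, rfl⟩ := hrep a
    obtain ⟨t, ht, rfl⟩ := hrep b
    simp only [G, AddCircle.liftIco_zero_coe_apply hs, AddCircle.liftIco_zero_coe_apply ht] at hab
    rw [hinj hs ht hab]
  have hrange : range G = g '' Icc 0 T := by
    ext z
    constructor
    · rintro ⟨a, rfl⟩
      obtain ⟨s, hs, rfl⟩ := hrep a
      exact ⟨s, Ico_subset_Icc_self hs, (AddCircle.liftIco_zero_coe_apply hs).symm⟩
    · rintro ⟨s, hs, rfl⟩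
      rcases hs.2.lt_or_eq with h | rfl
      · exact ⟨s, AddCircle.liftIco_zero_coe_apply ⟨hs.1, h⟩⟩
      · exact ⟨(0 : ℝ), by rw [← hclosed]; exact AddCircle.liftIco_zero_coe_apply ⟨le_rfl, hT⟩⟩
  rw [← hrange]
  exact ⟨(hG.isClosedEmbedding hGinj).isEmbedding.toHomeomorph.symm.trans
    (AddCircle.homeomorphCircle hT.ne')⟩

/-- Let `Y` be a compact metric space homeomorphic to the 2-sphere and
let `K ⊆ Y` be a compact set of finite Hausdorff 1-measure `l` separating two points
`x, y ∉ K`. Then `K` contains a rectifiable Jordan curve (a homeomorphic copy of the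
circle) of length (`ℋ¹`-measure) at most `l` which still separates `x` from `y`. -/
theorem separating_jordan_curve_in_finite_length_compact
    (Y : Type*) [MetricSpace Y] [MeasurableSpace Y] [BorelSpace Y] [CompactSpace Y]
    (hsphere : Nonempty (Y ≃ₜ S2))
    (K : Set Y) (hK : IsCompact K) (x y : Y) (hx : x ∉ K) (hy : y ∉ K)
    (hsep : SeparatesPoints' K x y)
    (l : ℝ≥0∞) (hl : μH[1] K = l) (hlfin : l < ⊤) :
    ∃ T ⊆ K, Nonempty (↥T ≃ₜ Circle) ∧ μH[1] T ≤ l ∧ SeparatesPoints' T x y := by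
  obtain ⟨e⟩ := hsphere
  have hxy : x ≠ y := by
    rintro rfl
    obtain ⟨w, rfl, hw⟩ := hsep {x} isConnected_singleton rfl rfl
    exact hx hw
  obtain ⟨φ, ψ, h⟩ := exists_planeChart e x y
  have : CompactSpace K := isCompact_iff_compactSpace.1 hK
  have hfin : μH[1] (univ : Set K) < ⊤ := by
    rw [← isometry_subtype_coe.hausdorffMeasure_image (Or.inl zero_le_one), image_univ,
      Subtype.range_coe, hl]
    exact hlfin
  have hKy : K ⊆ {y}ᶜ := fun w hw hwy => hy (hwy ▸ hw)
  have hφK : Continuous fun k : K => φ k :=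
    continuousOn_iff_continuous_domRestrict.1 (h.continuousOn.mono hKy)
  have hφ0 : ∀ k : K, φ k ≠ 0 := fun k hk =>
    h.zero_notMem_image hxy hx hy ⟨k, k.2, hk⟩
  obtain ⟨τ, g, hτ, hg, hclosed, hinj, hlog⟩ := exists_simple_loop_of_forall_no_log hfin hφK hφ0
    (h.not_exists_log hK hxy hx hy hsep)
  have himg : (fun t => (g t : Y)) '' Icc 0 τ ⊆ K := by
    rintro _ ⟨t, -, rfl⟩
    exact (g t).2
  have hg' : Continuous fun t => (g t : Y) := continuous_subtype_val.comp hg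
  refine ⟨(fun t => (g t : Y)) '' Icc 0 τ, himg,
    nonempty_image_Icc_homeomorph_circle hτ hg' (congrArg _ hclosed)
      (fun s hs t ht hst => hinj hs ht (Subtype.ext hst)),
    hl ▸ measure_mono himg,
    h.separatesPoints (isCompact_Icc.image hg') hxy (fun hyT => hy (himg hyT)) ?_⟩
  rintro ⟨L, hL, hLφ⟩
  have hmaps : ∀ k ∈ g '' Icc 0 τ, φ k ∈ φ '' ((fun t => (g t : Y)) '' Icc 0 τ) := by
    rintro _ ⟨t, ht, rfl⟩
    exact mem_image_of_mem φ ⟨t, ht, rfl⟩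
  exact hlog ⟨fun k => L (φ k), hL.comp hφK.continuousOn hmaps,
    fun k hk => by rw [hLφ _ (hmaps k hk), sub_zero]⟩
end

section
/- Let $Y$ be a compact, locally contractible metric space and let $\gamma:S^1\to Y$ be a continuous loop which is not null-homotopic in $Y$. Then there exists a weakly monotone parametrization $\eta:S^1\to Y$ of a Jordan curve $T\subset\gamma(S^1)$ such that $\eta$ is not null-homotopic in $Y$, and such that for every continuous map $F:Y\to X$ into another metric space one has $\ell_X(F\circ\eta)\leq\ell_X(F\circ\gamma)$. -/
open Set Filter Topology
open scoped ENNReal Real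

/-- The length of a loop `g` on a metric space, parametrized over the circle via
`Circle.exp` on `[0, 2π]`. -/
noncomputable def loopLength {X : Type*} [MetricSpace X] (g : Circle → X) : ℝ≥0∞ :=
  eVariationOn (fun t : ℝ => g (Circle.exp t)) (Icc 0 (2 * π))

/-- A continuous map `η : S¹ → Y` is a weakly monotone parametrization of the Jordan
curve `T ⊆ Y` if it is a uniform limit of homeomorphisms `S¹ → T`. -/
def IsWeaklyMonotoneParam {Y : Type*} [MetricSpace Y] (η : Circle → Y) (T : Set Y) : Prop :=
  ∃ h : ℕ → (Circle ≃ₜ ↥T),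
    TendstoUniformly (fun n z => ((h n z : Y))) η atTop

/-- A space is locally contractible if every neighborhood `U` of a point contains a
smaller neighborhood `V` whose inclusion into `U` is null-homotopic. -/
def LocallyContractible (Y : Type*) [TopologicalSpace Y] : Prop :=
  ∀ x : Y, ∀ U ∈ 𝓝 x, ∃ V ∈ 𝓝 x, ∃ hVU : V ⊆ U, ∃ p : ↥U,
    ContinuousMap.Homotopic
      ⟨Set.inclusion hVU, continuous_inclusion hVU⟩
      (ContinuousMap.const ↥V p)

/-- A loop is null-homotopic if it is homotopic to a constant map. -/
def NullHomotopicLoop {Y : Type*} [TopologicalSpace Y] (γ : C(Circle, Y)) : Prop :=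
  ∃ y : Y, ContinuousMap.Homotopic γ (ContinuousMap.const Circle y)

theorem circle_exp_surjOn (p : ℝ) (z : Circle) : ∃ x ∈ Icc p (p + 2 * π), Circle.exp x = z := by
  obtain ⟨y, rfl⟩ := Circle.exp_surjective z
  refine ⟨toIcoMod Real.two_pi_pos p y, Ico_subset_Icc_self (toIcoMod_mem_Ico _ _ _), ?_⟩
  have : toIcoMod Real.two_pi_pos p y = y - toIcoDiv Real.two_pi_pos p y • (2 * π) := rfl
  rw [this, Circle.periodic_exp.sub_zsmul_eq]

theorem circle_exp_eq_cases {p x y : ℝ} (hx : x ∈ Icc p (p + 2 * π)) (hy : y ∈ Icc p (p + 2 * π))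
    (h : Circle.exp x = Circle.exp y) (hxy : x < y) : x = p ∧ y = p + 2 * π := by
  obtain ⟨m, hm⟩ := Circle.exp_eq_exp.1 h
  have hpi := Real.pi_pos
  have h1 : m < 0 := by
    by_contra! h0
    have : (0 : ℝ) ≤ m := by exact_mod_cast h0
    nlinarith
  have h2 : m = -1 := by
    by_contra h0
    have h3 : m ≤ -2 := by omega
    have : (m : ℝ) ≤ -2 := by exact_mod_cast h3
    have := hx.1
    have := hy.2
    nlinarith
  subst h2
  push_cast at hm
  constructor <;> linarith [hx.1, hy.2]

/-- A family of functions on a period interval with equal end values descends to the circle. -/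
theorem exists_circle_lift {Y Z : Type*} [TopologicalSpace Y] [TopologicalSpace Z] [CompactSpace Z]
    [T2Space Z] (p : ℝ) (W : ℝ × Z → Y) (hW : ContinuousOn W (Icc p (p + 2 * π) ×ˢ univ))
    (hp : ∀ z, W (p, z) = W (p + 2 * π, z)) :
    ∃ F : C(Circle × Z, Y), ∀ x ∈ Icc p (p + 2 * π), ∀ z, F (Circle.exp x, z) = W (x, z) := by
  let q : C(Icc p (p + 2 * π) × Z, Circle × Z) :=
    ⟨fun a => (Circle.exp a.1, a.2), by fun_prop⟩
  have hq : IsQuotientMap q := by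
    refine q.continuous.isClosedMap.isQuotientMap q.continuous ?_
    rintro ⟨z, w⟩
    obtain ⟨x, hx, rfl⟩ := circle_exp_surjOn p z
    exact ⟨(⟨x, hx⟩, w), rfl⟩
  let w : C(Icc p (p + 2 * π) × Z, Y) :=
    ⟨fun a => W (a.1, a.2), hW.comp_continuous (by fun_prop) (fun a => ⟨a.1.2, mem_univ _⟩)⟩
  have hfac : Function.FactorsThrough w q := by
    rintro ⟨⟨x, hx⟩, z⟩ ⟨⟨y, hy⟩, z'⟩ h
    obtain ⟨h1, h2⟩ := Prod.mk.inj h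
    dsimp only at h1 h2
    subst h2
    change W (x, z) = W (y, z)
    rcases lt_trichotomy x y with hlt | rfl | hlt
    · obtain ⟨rfl, rfl⟩ := circle_exp_eq_cases hx hy h1 hlt
      exact hp z
    · rfl
    · obtain ⟨rfl, rfl⟩ := circle_exp_eq_cases hy hx h1.symm hlt
      exact (hp z).symm
  refine ⟨hq.lift w hfac, fun x hx z => ?_⟩
  exact DFunLike.congr_fun (hq.lift_comp w hfac) (⟨x, hx⟩, z)

theorem exists_circle_lift_path {Y : Type*} [TopologicalSpace Y] (p : ℝ) (w : ℝ → Y)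
    (hw : ContinuousOn w (Icc p (p + 2 * π))) (hp : w p = w (p + 2 * π)) :
    ∃ F : C(Circle, Y), ∀ x ∈ Icc p (p + 2 * π), F (Circle.exp x) = w x := by
  obtain ⟨F, hF⟩ := exists_circle_lift (Z := Unit) p (fun a => w a.1)
    (hw.comp continuousOn_fst fun a ha => ha.1) (fun _ => hp)
  exact ⟨F.comp ⟨fun z => (z, ()), by fun_prop⟩, fun x hx => hF x hx ()⟩

/-- Over `[r, s]`, a free deformation `W` of the loop `f` can be traded for a deformation of `f`
relative to the complementary arc; it ends with the two end traces of `W`. -/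
theorem exists_homotopic_tent {Y : Type*} [TopologicalSpace Y] (f : C(Circle, Y)) {r s : ℝ}
    (hrs : r < s) (hs : s ≤ r + 2 * π) (W : C(ℝ × ℝ, Y))
    (h0 : ∀ x ∈ Icc r s, W (x, 0) = f (Circle.exp x)) :
    ∃ f' : C(Circle, Y), f.Homotopic f' ∧
      (∀ x ∈ Icc s (r + 2 * π), f' (Circle.exp x) = f (Circle.exp x)) ∧
      ∀ x ∈ Icc r s, f' (Circle.exp x) = W (max r (min s (3 * x - r - s)),
        min 1 (min (3 * (x - r) / (s - r)) (3 * (s - x) / (s - r)))) := by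
  have hd : 0 < s - r := sub_pos.2 hrs
  set c : ℝ → ℝ := fun x => max r (min s (3 * x - r - s)) with hc
  set τ : ℝ → ℝ := fun x => min 1 (min (3 * (x - r) / (s - r)) (3 * (s - x) / (s - r))) with hτ
  have hcc : Continuous c := by fun_prop
  have hτc : Continuous τ := by fun_prop
  have cr : c r = r := by
    simp only [hc]; rw [min_eq_right (by linarith), max_eq_left (by linarith)]
  have cs : c s = s := by
    simp only [hc]; rw [min_eq_left (by linarith), max_eq_right (by linarith)]
  have τr : τ r = 0 := by
    have : 0 ≤ 3 * (s - r) / (s - r) := by positivity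
    simp [hτ, this]
  have τs : τ s = 0 := by
    have : 0 ≤ 3 * (s - r) / (s - r) := by positivity
    simp [hτ, this]
  let G : ℝ × unitInterval → Y := fun a => if a.1 ≤ s then
    W ((1 - (a.2 : ℝ)) * a.1 + a.2 * c a.1, a.2 * τ a.1) else f (Circle.exp a.1)
  have hG : Continuous G := by
    refine Continuous.if_le (by fun_prop) (by fun_prop) (by fun_prop) (by fun_prop) ?_
    rintro ⟨x, u⟩ hx
    dsimp only at hx
    subst hx
    dsimp only
    rw [cs, τs, mul_zero, ← h0 x ⟨hrs.le, le_rfl⟩]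
    congr 2; ring
  have Gout : ∀ x ∈ Icc s (r + 2 * π), ∀ u, G (x, u) = f (Circle.exp x) := by
    intro x hx u
    rcases hx.1.eq_or_lt with rfl | hlt
    · simp only [G, le_refl, if_true]
      rw [cs, τs, mul_zero, ← h0 s ⟨hrs.le, le_rfl⟩]
      congr 2; ring
    · simp [G, not_le.2 hlt]
  obtain ⟨F, hF⟩ := exists_circle_lift r G hG.continuousOn (by
    intro u
    rw [Gout _ ⟨hs, le_rfl⟩, Circle.periodic_exp r]
    simp only [G, hrs.le, if_true]
    rw [cr, τr, mul_zero, ← h0 r ⟨le_rfl, hrs.le⟩]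
    congr 2; ring)
  refine ⟨F.comp ⟨fun z => (z, 1), by fun_prop⟩, ⟨⟨F.comp ⟨fun a => (a.2, a.1), by fun_prop⟩,
    ?_, fun z => rfl⟩⟩, fun x hx => ?_, fun x hx => ?_⟩
  · intro z
    obtain ⟨x, hx, rfl⟩ := circle_exp_surjOn r z
    change F (Circle.exp x, 0) = _
    rw [hF x hx]
    rcases le_total x s with h | h
    · simp [G, h, h0 x ⟨hx.1, h⟩]
    · exact Gout x ⟨h, hx.2⟩ 0
  · change F (Circle.exp x, 1) = _
    rw [hF x ⟨hrs.le.trans hx.1, hx.2⟩, Gout x hx]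
  · change F (Circle.exp x, 1) = _
    rw [hF x ⟨hx.1, hx.2.trans hs⟩]
    simp [G, hx.2, hc, hτ]

/-- Two loops that agree off an arc are homotopic if over this arc both deform to the same point,
with equal traces of the end points. -/
theorem homotopic_of_contractions {Y : Type*} [TopologicalSpace Y] (f g : C(Circle, Y)) {r s : ℝ}
    (hrs : r < s) (hs : s ≤ r + 2 * π)
    (hfg : ∀ x ∈ Icc s (r + 2 * π), f (Circle.exp x) = g (Circle.exp x))
    (Wf Wg : C(ℝ × ℝ, Y)) (p : Y)
    (hf0 : ∀ x ∈ Icc r s, Wf (x, 0) = f (Circle.exp x)) (hf1 : ∀ x ∈ Icc r s, Wf (x, 1) = p)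
    (hg0 : ∀ x ∈ Icc r s, Wg (x, 0) = g (Circle.exp x)) (hg1 : ∀ x ∈ Icc r s, Wg (x, 1) = p)
    (hr : ∀ u ∈ Icc (0 : ℝ) 1, Wf (r, u) = Wg (r, u))
    (hs' : ∀ u ∈ Icc (0 : ℝ) 1, Wf (s, u) = Wg (s, u)) : f.Homotopic g := by
  obtain ⟨f', hff', f1, f2⟩ := exists_homotopic_tent f hrs hs Wf hf0
  obtain ⟨g', hgg', g1, g2⟩ := exists_homotopic_tent g hrs hs Wg hg0
  suffices f' = g' from hff'.trans (this ▸ hgg'.symm)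
  have hd : 0 < s - r := sub_pos.2 hrs
  ext z
  obtain ⟨x, hx, rfl⟩ := circle_exp_surjOn r z
  rcases le_total s x with h | h
  · rw [f1 x ⟨h, hx.2⟩, g1 x ⟨h, hx.2⟩, hfg x ⟨h, hx.2⟩]
  have hx' : x ∈ Icc r s := ⟨hx.1, h⟩
  rw [f2 x hx', g2 x hx']
  have hτ : min 1 (min (3 * (x - r) / (s - r)) (3 * (s - x) / (s - r))) ∈ Icc (0 : ℝ) 1 := by
    refine ⟨le_min zero_le_one (le_min ?_ ?_), min_le_left _ _⟩
    · exact div_nonneg (by linarith [hx.1]) hd.le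
    · exact div_nonneg (by linarith) hd.le
  rcases lt_or_ge (3 * (x - r)) (s - r) with h1 | h1
  · rw [max_eq_left (min_le_of_right_le (by linarith))]
    exact hr _ hτ
  rcases lt_or_ge (3 * (s - x)) (s - r) with h2 | h2
  · rw [min_eq_left (by linarith : s ≤ 3 * x - r - s), max_eq_right hrs.le]
    exact hs' _ hτ
  rw [min_eq_left (le_min ((one_le_div hd).2 h1) ((one_le_div hd).2 h2)),
    hf1 _ ⟨le_max_left _ _, max_le hrs.le (min_le_left _ _)⟩,
    hg1 _ ⟨le_max_left _ _, max_le hrs.le (min_le_left _ _)⟩]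

/-- Two loops that agree off an arc are homotopic if they map this arc into a set which is
contractible in the ambient space. -/
theorem homotopic_of_mapsTo_contractible {Y : Type*} [TopologicalSpace Y] {V : Set Y} {p : Y}
    (hV : ContinuousMap.Homotopic (⟨Subtype.val, continuous_subtype_val⟩ : C(V, Y))
      (ContinuousMap.const V p))
    (f g : C(Circle, Y)) {r s : ℝ} (hrs : r ≤ s) (hs : s ≤ r + 2 * π)
    (hfg : ∀ x ∈ Icc s (r + 2 * π), f (Circle.exp x) = g (Circle.exp x))
    (hr : f (Circle.exp r) = g (Circle.exp r))
    (hf : ∀ x ∈ Icc r s, f (Circle.exp x) ∈ V) (hg : ∀ x ∈ Icc r s, g (Circle.exp x) ∈ V) :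
    f.Homotopic g := by
  rcases hrs.eq_or_lt with rfl | hlt
  · suffices f = g from this ▸ .refl _
    ext z
    obtain ⟨x, hx, rfl⟩ := circle_exp_surjOn r z
    exact hfg x hx
  obtain ⟨H⟩ := hV
  have key : ∀ f : C(Circle, Y), (∀ x ∈ Icc r s, f (Circle.exp x) ∈ V) → ∃ W : C(ℝ × ℝ, Y),
      ∀ x ∈ Icc r s, ∀ hx : f (Circle.exp x) ∈ V, ∀ u, W (x, u) =
        H (projIcc 0 1 zero_le_one u, ⟨f (Circle.exp x), hx⟩) := by
    intro f hf
    refine ⟨⟨fun a => H (projIcc 0 1 zero_le_one a.2,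
      ⟨f (Circle.exp (projIcc r s hrs a.1)), hf _ (projIcc r s hrs a.1).2⟩), ?_⟩, ?_⟩
    · refine H.continuous.comp (Continuous.prodMk (by fun_prop) (Continuous.subtype_mk ?_ _))
      fun_prop
    · intro x hx hx' u
      simp [projIcc_of_mem hrs hx]
  obtain ⟨Wf, hWf⟩ := key f hf
  obtain ⟨Wg, hWg⟩ := key g hg
  have ms : s ∈ Icc r s := ⟨hrs, le_rfl⟩
  have mr : r ∈ Icc r s := ⟨le_rfl, hrs⟩
  refine homotopic_of_contractions f g hlt hs hfg Wf Wg p ?_ ?_ ?_ ?_ ?_ ?_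
  · intro x hx; rw [hWf x hx (hf x hx)]; simp
  · intro x hx; rw [hWf x hx (hf x hx)]; simp
  · intro x hx; rw [hWg x hx (hg x hx)]; simp
  · intro x hx; rw [hWg x hx (hg x hx)]; simp
  · intro u _
    rw [hWf r mr (hf r mr), hWg r mr (hg r mr)]
    simp only [hr]
  · intro u _
    rw [hWf s ms (hf s ms), hWg s ms (hg s ms)]
    simp only [hfg s ⟨le_rfl, hs⟩]

theorem LocallyContractible.exists_contractible_balls {Y : Type*} [MetricSpace Y] [CompactSpace Y]
    (hY : LocallyContractible Y) : ∃ δ > 0, ∀ x : Y, ∃ p : Y,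
      ContinuousMap.Homotopic (⟨Subtype.val, continuous_subtype_val⟩ : C(Metric.ball x δ, Y))
        (ContinuousMap.const _ p) := by
  choose V hV _ p hp using fun x : Y => hY x univ univ_mem
  obtain ⟨δ, hδ, h⟩ := lebesgue_number_lemma_of_metric (s := univ) (c := fun x => interior (V x))
    isCompact_univ (fun _ => isOpen_interior)
    (fun x _ => mem_iUnion.2 ⟨x, mem_interior_iff_mem_nhds.2 (hV x)⟩)
  refine ⟨δ, hδ, fun x => ?_⟩
  obtain ⟨y, hy⟩ := h x (mem_univ x)
  have hyV : Metric.ball x δ ⊆ V y := hy.trans interior_subset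
  obtain ⟨H⟩ := hp y
  refine ⟨p y, ⟨⟨⟨fun a => (H (a.1, inclusion hyV a.2) : Y), ?_⟩, fun a => ?_, fun a => ?_⟩⟩⟩
  · have := continuous_inclusion hyV
    fun_prop
  · simp
  · simp

/-- Uniformly close loops which agree on a closed set of parameters, one of them being constant on
the gaps of this set, are homotopic. -/
theorem homotopic_of_close {Y : Type*} [MetricSpace Y] {δ : ℝ} (hδ : 0 < δ)
    (hball : ∀ x : Y, ∃ p : Y,
      ContinuousMap.Homotopic (⟨Subtype.val, continuous_subtype_val⟩ : C(Metric.ball x δ, Y))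
        (ContinuousMap.const _ p))
    (f g : C(Circle, Y)) (p : ℝ) {S : Set ℝ} (hS : IsClosed S) (hSp : S ⊆ Icc p (p + 2 * π))
    (hp : p ∈ S) (hp' : p + 2 * π ∈ S) (hfg : ∀ s ∈ S, f (Circle.exp s) = g (Circle.exp s))
    (hgap : ∀ s ∈ S, ∀ t ∈ S, s < t → (∀ x ∈ Ioo s t, x ∉ S) →
      ∀ x ∈ Icc s t, f (Circle.exp x) = f (Circle.exp t))
    (hdist : ∀ z, dist (f z) (g z) < δ / 2) : f.Homotopic g := by
  have hpi := Real.pi_pos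
  have huc : UniformContinuousOn (fun x => f (Circle.exp x)) (Icc p (p + 2 * π)) :=
    isCompact_Icc.uniformContinuousOn_of_continuous (by fun_prop)
  obtain ⟨μ', hμ', hμ''⟩ := Metric.uniformContinuousOn_iff.1 huc (δ / 2) (by linarith)
  obtain ⟨μ, hμ, hlt⟩ := exists_between hμ'
  have hexists : ∀ s ∈ S, ∃ N : C(Circle, Y), ∀ x ∈ Icc p (p + 2 * π), N (Circle.exp x) =
      if x ≤ s then g (Circle.exp x) else f (Circle.exp x) := by
    intro s hs
    refine exists_circle_lift_path p _ (Continuous.continuousOn ?_) ?_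
    · refine Continuous.if_le (by fun_prop) (by fun_prop) (by fun_prop) (by fun_prop) ?_
      rintro x rfl
      exact (hfg x hs).symm
    · have := hfg p hp
      rw [if_pos (hSp hs).1, Circle.periodic_exp p, ← this, ite_self]
  have main : ∀ n : ℕ, ∀ s ∈ S, s ≤ p + n * μ → ∀ N : C(Circle, Y),
      (∀ x ∈ Icc p (p + 2 * π), N (Circle.exp x) =
        if x ≤ s then g (Circle.exp x) else f (Circle.exp x)) → f.Homotopic N := by
    intro n
    induction n with
    | zero =>
      intro s hs hsp N hN
      suffices f = N from this ▸ .refl _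
      ext z
      obtain ⟨x, hx, rfl⟩ := circle_exp_surjOn p z
      rw [hN x hx]
      split_ifs with h
      · have : x = p := le_antisymm (h.trans (by simpa using hsp)) hx.1
        rw [this, hfg p hp]
      · rfl
    | succ n ih =>
      intro s hs hsp N hN
      rcases le_or_gt s (p + n * μ) with hle | hgt
      · exact ih s hs hle N hN
      set q := p + n * μ with hq
      have hpq : p ≤ q := by rw [hq]; linarith [mul_nonneg n.cast_nonneg hμ.le]
      have hc1 : IsCompact (S ∩ Icc p q) := isCompact_Icc.inter_left hS
      have hc2 : IsCompact (S ∩ Icc q s) := isCompact_Icc.inter_left hS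
      obtain ⟨r, ⟨hrS, hr⟩, hrmax⟩ := hc1.exists_isGreatest ⟨p, hp, le_rfl, hpq⟩
      obtain ⟨r', ⟨hrS', hr'⟩, hrmin⟩ := hc2.exists_isLeast ⟨s, hs, hgt.le, le_rfl⟩
      have hrs : r ≤ s := hr.2.trans hgt.le
      have hfs : ∀ x ∈ Icc r s, dist (f (Circle.exp x)) (f (Circle.exp s)) < δ / 2 := by
        have hclose : ∀ x ∈ Icc r' s, dist (f (Circle.exp x)) (f (Circle.exp s)) < δ / 2 := by
          intro x hx
          refine hμ'' x ⟨?_, hx.2.trans (hSp hs).2⟩ s (hSp hs) ?_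
          · exact (hSp hrS').1.trans hx.1
          · rw [Real.dist_eq, abs_lt]
            have : s ≤ q + μ := by push_cast at hsp; linarith
            constructor <;> linarith [hx.1, hx.2, hr'.1]
        intro x hx
        rcases le_total r' x with h | h
        · exact hclose x ⟨h, hx.2⟩
        rcases (hr.2.trans hr'.1).eq_or_lt with h' | h'
        · exact hclose x ⟨h' ▸ hx.1, hx.2⟩
        rw [hgap r hrS r' hrS' h' ?_ x ⟨hx.1, h⟩]
        · exact hclose r' ⟨le_rfl, hr'.2⟩
        · intro y hy hyS
          rcases le_total y q with h'' | h''
          · exact absurd (hrmax ⟨hyS, hr.1.trans hy.1.le, h''⟩) (not_le.2 hy.1)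
          · exact absurd (hrmin ⟨hyS, h'', hy.2.le.trans hr'.2⟩) (not_le.2 hy.2)
      obtain ⟨M, hM⟩ := hexists r hrS
      refine (ih r hrS hr.2 M hM).trans ?_
      obtain ⟨c, hc⟩ := hball (f (Circle.exp s))
      have hsp2 := (hSp hs).2
      have hV : ∀ x ∈ Icc r s, f (Circle.exp x) ∈ Metric.ball (f (Circle.exp s)) δ ∧
          g (Circle.exp x) ∈ Metric.ball (f (Circle.exp s)) δ := by
        intro x hx
        have h1 := hfs x hx
        have h2 := hdist (Circle.exp x)
        refine ⟨Metric.mem_ball.2 (by linarith), Metric.mem_ball.2 ?_⟩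
        have h3 := dist_triangle_left (g (Circle.exp x)) (f (Circle.exp s)) (f (Circle.exp x))
        linarith
      refine homotopic_of_mapsTo_contractible hc M N hrs (by linarith [hr.1]) ?_ ?_ ?_ ?_
      · intro x hx
        rcases le_total x (p + 2 * π) with h | h
        · have hx' : x ∈ Icc p (p + 2 * π) := ⟨(hSp hs).1.trans hx.1, h⟩
          rw [hM x hx', hN x hx']
          rcases hx.1.eq_or_lt with rfl | hlt
          · simp [hfg s hs]
          · rw [if_neg (not_le.2 hlt), if_neg (not_le.2 (hrs.trans_lt hlt))]
        · rw [← Circle.periodic_exp.sub_eq x]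
          have hx' : x - 2 * π ∈ Icc p (p + 2 * π) :=
            ⟨by linarith, by linarith [hx.2, hr.1, (hSp hrS).2]⟩
          rw [hM _ hx', hN _ hx', if_pos (by linarith [hx.2]), if_pos (by linarith [hx.2])]
      · rw [hM r (hSp hrS), hN r (hSp hrS), if_pos le_rfl, if_pos hrs]
      · intro x hx
        rw [hM x ⟨hr.1.trans hx.1, hx.2.trans hsp2⟩]
        split_ifs
        exacts [(hV x hx).2, (hV x hx).1]
      · intro x hx
        rw [hN x ⟨hr.1.trans hx.1, hx.2.trans hsp2⟩]
        split_ifs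
        exacts [(hV x hx).2, (hV x hx).1]
  obtain ⟨n, hn⟩ := exists_nat_ge (2 * π / μ)
  refine main n _ hp' ?_ g ?_
  · rw [div_le_iff₀ hμ] at hn
    linarith
  · intro x hx
    rw [if_pos hx.2]

/-- The monotone map sending `x` to the last point of `K` up to `x`, and to `sInf K` if there is
no such point. -/
noncomputable def cutMap (K : Set ℝ) (x : ℝ) : ℝ := sSup (K ∩ Iic (max x (sInf K)))

section cutMap

variable {K K' : Set ℝ}

theorem cutMap_isGreatest (hK : IsCompact K) (hne : K.Nonempty) (x : ℝ) :
    IsGreatest (K ∩ Iic (max x (sInf K))) (cutMap K x) :=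
  (hK.inter_right isClosed_Iic).isGreatest_sSup ⟨sInf K, hK.sInf_mem hne, mem_Iic.2 (le_max_right _ _)⟩

theorem cutMap_mem (hK : IsCompact K) (hne : K.Nonempty) (x : ℝ) : cutMap K x ∈ K :=
  (cutMap_isGreatest hK hne x).1.1

theorem cutMap_le (hK : IsCompact K) (hne : K.Nonempty) (x : ℝ) : cutMap K x ≤ max x (sInf K) :=
  (cutMap_isGreatest hK hne x).1.2

theorem le_cutMap (hK : IsCompact K) {x k : ℝ} (hk : k ∈ K) (hx : k ≤ x) : k ≤ cutMap K x :=
  (cutMap_isGreatest hK ⟨k, hk⟩ x).2 ⟨hk, le_max_of_le_left hx⟩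

theorem cutMap_monotone (hK : IsCompact K) (hne : K.Nonempty) : Monotone (cutMap K) := fun x y h =>
  (cutMap_isGreatest hK hne y).2 ⟨cutMap_mem hK hne x,
    (cutMap_le hK hne x).trans (max_le_max_right _ h)⟩

theorem cutMap_of_le_sInf (hK : IsCompact K) (hne : K.Nonempty) {x : ℝ} (hx : x ≤ sInf K) :
    cutMap K x = sInf K :=
  le_antisymm ((cutMap_le hK hne x).trans (max_le hx le_rfl))
    (csInf_le hK.bddBelow (cutMap_mem hK hne x))

theorem cutMap_of_mem (hK : IsCompact K) {x : ℝ} (hx : x ∈ K) : cutMap K x = x :=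
  le_antisymm ((cutMap_le hK ⟨x, hx⟩ x).trans (max_le le_rfl (csInf_le hK.bddBelow hx)))
    (le_cutMap hK hx le_rfl)

theorem cutMap_le_self (hK : IsCompact K) {x k : ℝ} (hk : k ∈ K) (hx : k ≤ x) :
    cutMap K x ≤ x :=
  (cutMap_le hK ⟨k, hk⟩ x).trans (max_le le_rfl ((csInf_le hK.bddBelow hk).trans hx))

theorem cutMap_of_sSup_le (hK : IsCompact K) (hne : K.Nonempty) {x : ℝ} (hx : sSup K ≤ x) :
    cutMap K x = sSup K :=
  le_antisymm (le_csSup hK.bddAbove (cutMap_mem hK hne x)) (le_cutMap hK (hK.sSup_mem hne) hx)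

theorem cutMap_eq_cutMap {x y : ℝ} (hxy : x ≤ y) (h : ∀ k ∈ K, x < k → ¬ k ≤ y) :
    cutMap K x = cutMap K y := by
  unfold cutMap
  congr 1
  ext k
  simp only [mem_inter_iff, mem_Iic, le_max_iff, and_congr_right_iff]
  intro hk
  refine or_congr_left ⟨fun h' => h'.trans hxy, fun h' => ?_⟩
  by_contra! h''
  exact h k hk h'' h'

theorem cutMap_cutMap (hK : IsCompact K) (hne : K.Nonempty) (hK' : IsCompact K') (h : K ⊆ K')
    (x : ℝ) : cutMap K (cutMap K' x) = cutMap K x := by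
  rcases le_total (sInf K') x with hx | hx
  · have hle := cutMap_le_self hK' (hK'.sInf_mem (hne.mono h)) hx
    exact cutMap_eq_cutMap hle fun k hk h1 h2 => absurd (le_cutMap hK' (h hk) h2) (not_le.2 h1)
  · have : sInf K' ≤ sInf K := csInf_le_csInf hK'.bddBelow hne h
    rw [cutMap_of_le_sInf hK' (hne.mono h) hx, cutMap_of_le_sInf hK hne this,
      cutMap_of_le_sInf hK hne (hx.trans this)]

end cutMap

/-- A set `K` of parameters along which the loop `g` on `[0, 2π]` can be cut: `g` takes equal
values at the end points of every gap of `K`, including the one around the base point. -/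
structure IsCutSet {Y : Type*} (g : ℝ → Y) (K : Set ℝ) : Prop where
  isCompact : IsCompact K
  nonempty : K.Nonempty
  subset : K ⊆ Icc 0 (2 * π)
  gap : ∀ s ∈ K, ∀ t ∈ K, s < t → (∀ x ∈ Ioo s t, x ∉ K) → g s = g t
  ends : g (sInf K) = g (sSup K)

section IsCutSet

variable {Y : Type*} {g : ℝ → Y} {K : Set ℝ}

theorem IsCutSet.exists_near (h : IsCutSet g K) {x y : ℝ} (hxy : x ≤ y) :
    ∃ k ∈ K, ∃ l ∈ K, g (cutMap K x) = g k ∧ g (cutMap K y) = g l ∧ dist k l ≤ y - x := by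
  have hK := h.isCompact
  by_cases hempty : ∀ k ∈ K, x < k → ¬ k ≤ y
  · refine ⟨_, cutMap_mem hK h.nonempty x, _, cutMap_mem hK h.nonempty x, rfl, ?_, ?_⟩
    · rw [cutMap_eq_cutMap hxy hempty]
    · simpa using hxy
  push Not at hempty
  obtain ⟨k₀, hk₀, hx₀, hy₀⟩ := hempty
  obtain ⟨k, ⟨hk, hxk⟩, hmin⟩ := (hK.inter_right (isClosed_Ici (a := x))).exists_isLeast
    ⟨k₀, hk₀, hx₀.le⟩
  have hky : k ≤ y := (hmin ⟨hk₀, hx₀.le⟩).trans hy₀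
  have hly := cutMap_le_self hK hk₀ hy₀
  have hlx := hx₀.le.trans (le_cutMap hK hk₀ hy₀)
  refine ⟨k, hk, _, cutMap_mem hK h.nonempty y, ?_, rfl, ?_⟩
  · rcases le_total x (sInf K) with hx | hx
    · rw [cutMap_of_le_sInf hK h.nonempty hx]
      congr 1
      exact le_antisymm (csInf_le hK.bddBelow hk) (hmin ⟨hK.sInf_mem h.nonempty, hx⟩)
    have hle : cutMap K x ≤ k := (cutMap_le_self hK (hK.sInf_mem h.nonempty) hx).trans hxk
    rcases hle.eq_or_lt with heq | hlt
    · rw [heq]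
    refine h.gap _ (cutMap_mem hK h.nonempty x) k hk hlt fun z hz hzK => ?_
    rcases le_total z x with hzx | hzx
    · exact absurd (le_cutMap hK hzK hzx) (not_le.2 hz.1)
    · exact absurd (hmin ⟨hzK, hzx⟩) (not_le.2 hz.2)
  · rw [Real.dist_eq, abs_le]
    rw [mem_Ici] at hxk
    constructor <;> linarith

/-- Cutting a loop does not increase its modulus of continuity. -/
theorem IsCutSet.dist_cutMap_lt {Y : Type*} [MetricSpace Y] {g : ℝ → Y} (h : IsCutSet g K)
    {ε μ : ℝ} (hμ : ∀ x ∈ Icc 0 (2 * π), ∀ y ∈ Icc 0 (2 * π), dist x y < μ → dist (g x) (g y) < ε)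
    {x y : ℝ} (hxy : dist x y < μ) : dist (g (cutMap K x)) (g (cutMap K y)) < ε := by
  wlog hle : x ≤ y generalizing x y
  · rw [dist_comm]
    exact this (by rwa [dist_comm]) (le_of_not_ge hle)
  obtain ⟨k, hk, l, hl, h1, h2, h3⟩ := h.exists_near hle
  rw [h1, h2]
  refine hμ k (h.subset hk) l (h.subset hl) (h3.trans_lt ?_)
  rwa [dist_comm, Real.dist_eq, abs_of_nonneg (sub_nonneg.2 hle)] at hxy

theorem IsCutSet.continuous_cutMap {Y : Type*} [MetricSpace Y] {g : ℝ → Y} (h : IsCutSet g K)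
    (hg : Continuous g) : Continuous (fun x => g (cutMap K x)) := by
  have huc : UniformContinuousOn g (Icc 0 (2 * π)) :=
    isCompact_Icc.uniformContinuousOn_of_continuous hg.continuousOn
  refine UniformContinuous.continuous (Metric.uniformContinuous_iff.2 fun ε hε => ?_)
  obtain ⟨μ, hμ, hμ'⟩ := Metric.uniformContinuousOn_iff.1 huc ε hε
  exact ⟨μ, hμ, fun _ _ hxy => h.dist_cutMap_lt hμ' hxy⟩

theorem IsCutSet.cutMap_zero (h : IsCutSet g K) : cutMap K 0 = sInf K :=
  cutMap_of_le_sInf h.isCompact h.nonempty (h.subset (h.isCompact.sInf_mem h.nonempty)).1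

theorem IsCutSet.cutMap_two_pi (h : IsCutSet g K) : cutMap K (2 * π) = sSup K :=
  cutMap_of_sSup_le h.isCompact h.nonempty (h.subset (h.isCompact.sSup_mem h.nonempty)).2

/-- `F` is the loop obtained from `g` by cutting along `K`. -/
def IsCutLoop {Y : Type*} [TopologicalSpace Y] (g : ℝ → Y) (K : Set ℝ) (F : C(Circle, Y)) : Prop :=
  ∀ x ∈ Icc 0 (2 * π), F (Circle.exp x) = g (cutMap K x)

theorem IsCutSet.exists_isCutLoop {Y : Type*} [MetricSpace Y] {g : ℝ → Y} (h : IsCutSet g K)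
    (hg : Continuous g) : ∃ F : C(Circle, Y), IsCutLoop g K F := by
  have := exists_circle_lift_path 0 (fun x => g (cutMap K x)) (h.continuous_cutMap hg).continuousOn
    (by rw [zero_add, h.cutMap_zero, h.cutMap_two_pi, h.ends])
  rwa [zero_add] at this

end IsCutSet

section minimal

variable {Y : Type*} [MetricSpace Y] {g : ℝ → Y} {K K' : Set ℝ}

theorem IsCutSet.homotopic_of_near (h : IsCutSet g K) (h' : IsCutSet g K') (hKK' : K ⊆ K')
    {δ μ : ℝ} (hδ : 0 < δ) (hball : ∀ x : Y, ∃ p : Y,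
      ContinuousMap.Homotopic (⟨Subtype.val, continuous_subtype_val⟩ : C(Metric.ball x δ, Y))
        (ContinuousMap.const _ p))
    (hμ : ∀ x ∈ Icc 0 (2 * π), ∀ y ∈ Icc 0 (2 * π), dist x y < μ → dist (g x) (g y) < δ / 4)
    (hnear : ∀ k' ∈ K', ∃ k ∈ K, dist k' k < μ) {F F' : C(Circle, Y)} (hF : IsCutLoop g K F)
    (hF' : IsCutLoop g K' F') : F.Homotopic F' := by
  have hK := h.isCompact
  have hbK := hK.sSup_mem h.nonempty
  have haK := hK.sInf_mem h.nonempty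
  have hb := h.subset hbK
  set b := sSup K
  have hFK : ∀ k ∈ K, F (Circle.exp k) = g k := fun k hk => by
    rw [hF k (h.subset hk), cutMap_of_mem hK hk]
  have hFK' : ∀ k ∈ K, F' (Circle.exp k) = g k := fun k hk => by
    rw [hF' k (h.subset hk), cutMap_of_mem h'.isCompact (hKK' hk)]
  have hpb : Circle.exp (b - 2 * π) = Circle.exp b := Circle.periodic_exp.sub_eq b
  refine homotopic_of_close hδ hball F F' (b - 2 * π) (S := insert (b - 2 * π) K)
    (hK.insert _).isClosed ?_ (mem_insert _ _) ?_ ?_ ?_ ?_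
  · rw [sub_add_cancel]
    refine insert_subset ⟨le_rfl, by linarith [Real.pi_pos]⟩ fun k hk => ⟨?_, ?_⟩
    · linarith [(h.subset hk).1, hb.2]
    · exact le_csSup hK.bddAbove hk
  · rw [sub_add_cancel]
    exact mem_insert_of_mem _ hbK
  · rintro s (rfl | hs)
    · rw [hpb, hFK b hbK, hFK' b hbK]
    · rw [hFK s hs, hFK' s hs]
  · intro s hs t ht hst hgap x hx
    have hleK : ∀ k ∈ K, b - 2 * π ≤ k := fun k hk => by linarith [(h.subset hk).1, hb.2]
    have htK : t ∈ K := by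
      rcases ht with rfl | ht
      · rcases hs with rfl | hs
        · exact absurd hst (lt_irrefl _)
        · exact absurd (hleK s hs) (not_le.2 hst)
      · exact ht
    rw [hFK t htK]
    by_cases hsK : s ∈ K
    · have hx' : x ∈ Icc 0 (2 * π) := ⟨(h.subset hsK).1.trans hx.1, hx.2.trans (h.subset htK).2⟩
      rcases hx.2.eq_or_lt with rfl | hxt
      · exact hFK x htK
      rw [hF x hx', ← cutMap_eq_cutMap hx.1 fun k hk h1 h2 =>
        hgap k ⟨h1, h2.trans_lt hxt⟩ (mem_insert_of_mem _ hk), cutMap_of_mem hK hsK]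
      exact h.gap s hsK t htK hst fun y hy hyK => hgap y hy (mem_insert_of_mem _ hyK)
    · have hsp : s = b - 2 * π := hs.resolve_right hsK
      have hta : t = sInf K := by
        refine le_antisymm ?_ (csInf_le hK.bddBelow htK)
        by_contra! hlt
        refine hgap _ ⟨lt_of_le_of_ne ?_ ?_, hlt⟩ (mem_insert_of_mem _ haK)
        · rw [hsp]
          exact hleK _ haK
        · rintro rfl
          exact hsK haK
      rw [hta]
      rcases le_total 0 x with h0 | h0
      · rw [hF x ⟨h0, hx.2.trans (h.subset htK).2⟩,
          cutMap_of_le_sInf hK h.nonempty (hta ▸ hx.2)]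
      · have hx1 := hx.1
        rw [← Circle.periodic_exp x, hF (x + 2 * π) ⟨by linarith [hb.1], by linarith⟩,
          cutMap_of_sSup_le hK h.nonempty (by linarith), h.ends]
  · intro z
    obtain ⟨x, hx, rfl⟩ := circle_exp_surjOn 0 z
    rw [zero_add] at hx
    rw [hF x hx, hF' x hx, ← cutMap_cutMap hK h.nonempty h'.isCompact hKK' x]
    have hmem := cutMap_mem h'.isCompact h'.nonempty x
    obtain ⟨k, hk, hd⟩ := hnear _ hmem
    have h1 := h.dist_cutMap_lt hμ hd
    rw [cutMap_of_mem hK hk] at h1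
    have h2 := hμ _ (h'.subset hmem) _ (h.subset hk) hd
    have h3 := dist_triangle_right (g (cutMap K (cutMap K' x))) (g (cutMap K' x)) (g k)
    linarith

theorem isCutSet_of_near (hg : Continuous g) (hK : IsCompact K) (hne : K.Nonempty)
    (hsub : K ⊆ Icc 0 (2 * π))
    (hnear : ∀ μ > 0, ∃ K', IsCutSet g K' ∧ K ⊆ K' ∧ ∀ k' ∈ K', ∃ k ∈ K, dist k' k < μ) :
    IsCutSet g K := by
  have huc : UniformContinuousOn g (Icc 0 (2 * π)) :=
    isCompact_Icc.uniformContinuousOn_of_continuous hg.continuousOn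
  have key : ∀ x ∈ Icc 0 (2 * π), ∀ y ∈ Icc 0 (2 * π),
      (∀ μ > 0, ∃ x' ∈ Icc 0 (2 * π), ∃ y' ∈ Icc 0 (2 * π), dist x x' < μ ∧ dist y y' < μ ∧
        g x' = g y') → g x = g y := by
    intro x hx y hy hxy
    refine eq_of_forall_dist_le fun ε hε => ?_
    obtain ⟨μ, hμ, hμ'⟩ := Metric.uniformContinuousOn_iff.1 huc (ε / 2) (by linarith)
    obtain ⟨x', hx', y', hy', h1, h2, h3⟩ := hxy μ hμ
    have h4 := hμ' x hx x' hx' h1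
    have h5 := hμ' y hy y' hy' h2
    have h6 := dist_triangle_right (g x) (g y) (g y')
    rw [h3] at h4
    linarith
  refine ⟨hK, hne, hsub, fun s hs t ht hst hgap => ?_, ?_⟩
  · refine key s (hsub hs) t (hsub ht) fun μ hμ => ?_
    obtain ⟨K', hK', hKK', hnear'⟩ := hnear (min μ ((t - s) / 2)) (lt_min hμ (by linarith))
    obtain ⟨x, ⟨hxK, hx⟩, hxmax⟩ := (hK'.isCompact.inter_right
      (isClosed_Iic (a := (s + t) / 2))).exists_isGreatest ⟨s, hKK' hs, mem_Iic.2 (by linarith)⟩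
    obtain ⟨y, ⟨hyK, hy⟩, hymin⟩ := (hK'.isCompact.inter_right
      (isClosed_Ici (a := (s + t) / 2))).exists_isLeast ⟨t, hKK' ht, mem_Ici.2 (by linarith)⟩
    rw [mem_Iic] at hx
    rw [mem_Ici] at hy
    have hsx : s ≤ x := hxmax ⟨hKK' hs, mem_Iic.2 (by linarith)⟩
    have hyt : y ≤ t := hymin ⟨hKK' ht, mem_Ici.2 (by linarith)⟩
    refine ⟨x, hK'.subset hxK, y, hK'.subset hyK, ?_, ?_, ?_⟩
    · obtain ⟨k, hk, hd⟩ := hnear' x hxK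
      obtain ⟨hd1, hd2⟩ := lt_min_iff.1 hd
      rw [Real.dist_eq, abs_lt] at hd1 hd2
      have hks : k ≤ s := by
        by_contra! h'
        exact hgap k ⟨h', by linarith⟩ hk
      rw [Real.dist_eq, abs_lt]
      constructor <;> linarith
    · obtain ⟨k, hk, hd⟩ := hnear' y hyK
      obtain ⟨hd1, hd2⟩ := lt_min_iff.1 hd
      rw [Real.dist_eq, abs_lt] at hd1 hd2
      have hks : t ≤ k := by
        by_contra! h'
        exact hgap k ⟨by linarith, h'⟩ hk
      rw [Real.dist_eq, abs_lt]
      constructor <;> linarith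
    · rcases (hx.trans hy).eq_or_lt with rfl | hlt
      · rfl
      refine hK'.gap x hxK y hyK hlt fun z hz hzK => ?_
      rcases le_total z ((s + t) / 2) with h' | h'
      · exact absurd (hxmax ⟨hzK, h'⟩) (not_le.2 hz.1)
      · exact absurd (hymin ⟨hzK, h'⟩) (not_le.2 hz.2)
  · refine key _ (hsub (hK.sInf_mem hne)) _ (hsub (hK.sSup_mem hne)) fun μ hμ => ?_
    obtain ⟨K', hK', hKK', hnear'⟩ := hnear μ hμ
    have haK := hK'.isCompact.sInf_mem hK'.nonempty
    have hbK := hK'.isCompact.sSup_mem hK'.nonempty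
    refine ⟨_, hK'.subset haK, _, hK'.subset hbK, ?_, ?_, hK'.ends⟩
    · obtain ⟨k, hk, hd⟩ := hnear' _ haK
      have h1 := csInf_le hK.bddBelow hk
      have h2 := csInf_le_csInf hK'.isCompact.bddBelow hne hKK'
      rw [Real.dist_eq, abs_lt] at hd ⊢
      constructor <;> linarith
    · obtain ⟨k, hk, hd⟩ := hnear' _ hbK
      have h1 := le_csSup hK.bddAbove hk
      have h2 := csSup_le_csSup hK'.isCompact.bddAbove hne hKK'
      rw [Real.dist_eq, abs_lt] at hd ⊢
      constructor <;> linarith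

/-- The cut sets of `g` whose cut loop is not null-homotopic. -/
def essentialCutSets (g : ℝ → Y) : Set (Set ℝ) :=
  {K | IsCutSet g K ∧ ∃ F : C(Circle, Y), IsCutLoop g K F ∧ ¬ NullHomotopicLoop F}

theorem NullHomotopicLoop.of_homotopic {f f' : C(Circle, Y)} (hf : NullHomotopicLoop f)
    (h : f'.Homotopic f) : NullHomotopicLoop f' := by
  obtain ⟨y, hy⟩ := hf
  exact ⟨y, h.trans hy⟩

theorem exists_minimal_essentialCutSet [CompactSpace Y] (hY : LocallyContractible Y)
    (γ : C(Circle, Y)) (hγ : ¬ NullHomotopicLoop γ) :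
    ∃ K, Minimal (· ∈ essentialCutSets fun x => γ (Circle.exp x)) K := by
  set g : ℝ → Y := fun x => γ (Circle.exp x) with hgdef
  have hg : Continuous g := by fun_prop
  have hpi := Real.two_pi_pos
  obtain ⟨δ, hδ, hball⟩ := hY.exists_contractible_balls
  have huc : UniformContinuousOn g (Icc 0 (2 * π)) :=
    isCompact_Icc.uniformContinuousOn_of_continuous hg.continuousOn
  obtain ⟨ν, hν, hν'⟩ := Metric.uniformContinuousOn_iff.1 huc (δ / 4) (by linarith)
  refine zorn_superset _ fun c hc hchain => ?_
  rcases c.eq_empty_or_nonempty with rfl | hcne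
  · refine ⟨Icc 0 (2 * π), ⟨⟨isCompact_Icc, nonempty_Icc.2 hpi.le, subset_rfl, ?_, ?_⟩, γ, ?_, hγ⟩,
      by simp⟩
    · intro s hs t ht hst hgap
      exact absurd (⟨by linarith [hs.1], by linarith [ht.2]⟩ : (s + t) / 2 ∈ Icc 0 (2 * π))
        (hgap _ ⟨by linarith, by linarith⟩)
    · rw [csInf_Icc hpi.le, csSup_Icc hpi.le]
      simp [hgdef]
    · intro x hx
      rw [cutMap_of_mem isCompact_Icc hx]
  have : Nonempty c := hcne.to_subtype
  have hdir : Directed (· ⊇ ·) (fun K : c => (K : Set ℝ)) := by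
    intro A B
    rcases hchain.total A.2 B.2 with hAB | hAB
    · exact ⟨A, subset_rfl, hAB⟩
    · exact ⟨B, hAB, subset_rfl⟩
  have hcomp : ∀ A : c, IsCompact (A : Set ℝ) := fun A => (hc A.2).1.isCompact
  have hne : (⋂ A : c, (A : Set ℝ)).Nonempty :=
    IsCompact.nonempty_iInter_of_directed_nonempty_isCompact_isClosed _ hdir
      (fun A => (hc A.2).1.nonempty) hcomp (fun A => (hcomp A).isClosed)
  set K := ⋂ A : c, (A : Set ℝ) with hK
  have hKsub : ∀ A ∈ c, K ⊆ A := fun A hA => iInter_subset (fun A : c => (A : Set ℝ)) ⟨A, hA⟩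
  obtain ⟨A₀, hA₀⟩ := hcne
  have hnear : ∀ μ > 0, ∃ A ∈ c, ∀ k' ∈ A, ∃ k ∈ K, dist k' k < μ := by
    intro μ hμ
    obtain ⟨A, hA⟩ := exists_subset_nhds_of_isCompact' hdir hcomp (fun A => (hcomp A).isClosed)
      (U := Metric.thickening μ K) fun x hx =>
        Metric.isOpen_thickening.mem_nhds (Metric.self_subset_thickening hμ _ hx)
    exact ⟨A, A.2, fun k' hk' => Metric.mem_thickening_iff.1 (hA hk')⟩
  have hKcomp : IsCompact K := (hcomp ⟨A₀, hA₀⟩).of_isClosed_subset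
    (isClosed_iInter fun A => (hcomp A).isClosed) (hKsub A₀ hA₀)
  have hKcut : IsCutSet g K := by
    refine isCutSet_of_near hg hKcomp hne ((hKsub A₀ hA₀).trans (hc hA₀).1.subset) fun μ hμ => ?_
    obtain ⟨A, hA, h⟩ := hnear μ hμ
    exact ⟨A, (hc hA).1, hKsub A hA, h⟩
  obtain ⟨F, hF⟩ := hKcut.exists_isCutLoop hg
  refine ⟨K, ⟨hKcut, F, hF, fun hnull => ?_⟩, hKsub⟩
  obtain ⟨A, hA, h⟩ := hnear ν hν
  obtain ⟨hAcut, F', hF', hF'null⟩ := hc hA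
  exact hF'null (hnull.of_homotopic
    (hKcut.homotopic_of_near hAcut (hKsub A hA) hδ hball hν' h hF hF').symm)

end minimal

section split

variable {Y : Type*} {g : ℝ → Y} {K K' : Set ℝ} {s t : ℝ}

theorem cutMap_eq_of_mem (hK : IsCompact K) (hK' : IsCompact K') (h : K ⊆ K') {x : ℝ}
    (hx : cutMap K' x ∈ K) : cutMap K x = cutMap K' x := by
  rw [← cutMap_cutMap hK ⟨_, hx⟩ hK' h, cutMap_of_mem hK hx]

theorem sInf_inter_Icc (hs : s ∈ K) (hst : s < t) : sInf (K ∩ Icc s t) = s :=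
  IsLeast.csInf_eq ⟨⟨hs, le_rfl, hst.le⟩, fun _ hx => hx.2.1⟩

theorem sSup_inter_Icc (ht : t ∈ K) (hst : s < t) : sSup (K ∩ Icc s t) = t :=
  IsGreatest.csSup_eq ⟨⟨ht, hst.le, le_rfl⟩, fun _ hx => hx.2.2⟩

theorem IsCutSet.inter_Icc (h : IsCutSet g K) (hs : s ∈ K) (ht : t ∈ K) (hst : s < t)
    (hg : g s = g t) : IsCutSet g (K ∩ Icc s t) where
  isCompact := h.isCompact.inter_right isClosed_Icc
  nonempty := ⟨s, hs, le_rfl, hst.le⟩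
  subset := inter_subset_left.trans h.subset
  gap x hx y hy hxy hgap := h.gap x hx.1 y hy.1 hxy fun z hz hzK =>
    hgap z hz ⟨hzK, hx.2.1.trans hz.1.le, hz.2.le.trans hy.2.2⟩
  ends := by rw [sInf_inter_Icc hs hst, sSup_inter_Icc ht hst, hg]

theorem IsCutSet.diff_Ioo (h : IsCutSet g K) (hs : s ∈ K) (ht : t ∈ K)
    (hg : g s = g t) : IsCutSet g (K \ Ioo s t) where
  isCompact := h.isCompact.diff isOpen_Ioo
  nonempty := ⟨s, hs, fun h' => lt_irrefl _ h'.1⟩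
  subset := sdiff_subset.trans h.subset
  gap x hx y hy hxy hgap := by
    by_cases hempty : ∀ z ∈ Ioo x y, z ∉ K
    · exact h.gap x hx.1 y hy.1 hxy hempty
    push Not at hempty
    obtain ⟨z, hz, hzK⟩ := hempty
    have hzst : z ∈ Ioo s t := by
      by_contra h'
      exact hgap z hz ⟨hzK, h'⟩
    have hxs : x = s := by
      refine le_antisymm ?_ ?_ <;> by_contra! h'
      · exact hx.2 ⟨h', hz.1.trans hzst.2⟩
      · exact hgap s ⟨h', hzst.1.trans hz.2⟩ ⟨hs, fun h'' => lt_irrefl _ h''.1⟩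
    have hyt : y = t := by
      refine le_antisymm ?_ ?_ <;> by_contra! h'
      · exact hgap t ⟨hz.1.trans hzst.2, h'⟩ ⟨ht, fun h'' => lt_irrefl _ h''.2⟩
      · exact hy.2 ⟨hzst.1.trans hz.2, h'⟩
    rw [hxs, hyt, hg]
  ends := by
    have hinf : sInf (K \ Ioo s t) = sInf K := by
      refine IsLeast.csInf_eq ⟨⟨h.isCompact.sInf_mem h.nonempty, fun h' => ?_⟩, fun x hx => ?_⟩
      · exact absurd (csInf_le h.isCompact.bddBelow hs) (not_le.2 h'.1)
      · exact csInf_le h.isCompact.bddBelow hx.1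
    have hsup : sSup (K \ Ioo s t) = sSup K := by
      refine IsGreatest.csSup_eq ⟨⟨h.isCompact.sSup_mem h.nonempty, fun h' => ?_⟩, fun x hx => ?_⟩
      · exact absurd (le_csSup h.isCompact.bddAbove ht) (not_le.2 h'.2)
      · exact le_csSup h.isCompact.bddAbove hx.1
    rw [hinf, hsup, h.ends]

/-- If the part of a cut loop over `[s, t]` is null-homotopic, it can be cut out. -/
theorem IsCutSet.homotopic_diff_Ioo [TopologicalSpace Y] (h : IsCutSet g K) (hs : s ∈ K)
    (ht : t ∈ K) (hst : s < t) (hg : g s = g t) {F F₁ F₂ : C(Circle, Y)} (hF : IsCutLoop g K F)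
    (hF₁ : IsCutLoop g (K ∩ Icc s t) F₁) (hF₂ : IsCutLoop g (K \ Ioo s t) F₂)
    (hnull : NullHomotopicLoop F₁) : F.Homotopic F₂ := by
  have hK := h.isCompact
  have h₁ := h.inter_Icc hs ht hst hg
  have h₂ := h.diff_Ioo hs ht hg
  have hs0 := h.subset hs
  have ht0 := h.subset ht
  have hpi := Real.pi_pos
  have hd : 0 < t - s := sub_pos.2 hst
  have mem_of : ∀ x ∈ Icc s t, x ∈ Icc 0 (2 * π) := fun x hx =>
    ⟨hs0.1.trans hx.1, hx.2.trans ht0.2⟩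
  have in₁ : ∀ x ∈ Icc s t, F₁ (Circle.exp x) = F (Circle.exp x) := by
    intro x hx
    rw [hF₁ x (mem_of x hx), hF x (mem_of x hx)]
    rw [cutMap_eq_of_mem h₁.isCompact hK inter_subset_left]
    exact ⟨cutMap_mem hK h.nonempty x, le_cutMap hK hs hx.1, (cutMap_le_self hK hs hx.1).trans hx.2⟩
  have out₁ : ∀ x ∈ Icc t (s + 2 * π), F₁ (Circle.exp x) = g s := by
    intro x hx
    rcases le_total x (2 * π) with hx' | hx'
    · rw [hF₁ x ⟨ht0.1.trans hx.1, hx'⟩, cutMap_of_sSup_le h₁.isCompact h₁.nonempty,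
        sSup_inter_Icc ht hst, hg]
      rw [sSup_inter_Icc ht hst]
      exact hx.1
    · rw [← Circle.periodic_exp.sub_eq x, hF₁ (x - 2 * π) ⟨by linarith, by linarith [hx.2, hs0.2]⟩,
        cutMap_of_le_sInf h₁.isCompact h₁.nonempty, sInf_inter_Icc hs hst]
      rw [sInf_inter_Icc hs hst]
      linarith [hx.2]
  have in₂ : ∀ x ∈ Icc s t, F₂ (Circle.exp x) = g s := by
    intro x hx
    rw [hF₂ x (mem_of x hx)]
    rcases hx.2.eq_or_lt with rfl | hlt
    · rw [cutMap_of_mem h₂.isCompact ⟨ht, fun h' => lt_irrefl _ h'.2⟩, hg]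
    · rw [← cutMap_eq_cutMap hx.1, cutMap_of_mem h₂.isCompact ⟨hs, fun h' => lt_irrefl _ h'.1⟩]
      exact fun k hk h1 h2 => hk.2 ⟨h1, h2.trans_lt hlt⟩
  have out₂ : ∀ x ∈ Icc 0 (2 * π), x ∉ Ioo s t → F (Circle.exp x) = F₂ (Circle.exp x) := by
    intro x hx hxst
    rw [hF x hx, hF₂ x hx, cutMap_eq_of_mem h₂.isCompact hK sdiff_subset]
    refine ⟨cutMap_mem hK h.nonempty x, fun h' => ?_⟩
    rcases le_or_gt x s with hxs | hxs
    · exact absurd ((cutMap_le hK h.nonempty x).trans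
        (max_le hxs (csInf_le hK.bddBelow hs))) (not_le.2 h'.1)
    · rcases lt_or_ge x t with hxt | hxt
      · exact hxst ⟨hxs, hxt⟩
      · exact absurd (le_cutMap hK ht hxt) (not_le.2 h'.2)
  obtain ⟨y, ⟨H⟩⟩ := hnull
  set m := (s + t) / 2 with hm
  let lam : ℝ → ℝ := fun u => 1 + min (2 * u) 1 * (2 * π / (t - s) - 1)
  have hlam : Continuous lam := by fun_prop
  let W : C(ℝ × ℝ, Y) := ⟨fun a => H (projIcc 0 1 zero_le_one (2 * a.2 - 1),
    Circle.exp (m + (a.1 - m) * lam a.2)), by fun_prop⟩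
  have hW0 : ∀ x, W (x, 0) = F₁ (Circle.exp x) := by
    intro x
    have : projIcc (0 : ℝ) 1 zero_le_one (-1) = 0 := projIcc_of_le_left _ (by norm_num)
    simp [W, lam, this]
  have hW1 : ∀ x, W (x, 1) = y := by
    intro x
    have : projIcc (0 : ℝ) 1 zero_le_one (2 - 1) = 1 := by norm_num
    simp [W, this]
  refine homotopic_of_contractions F F₂ hst (by linarith [hs0.1, ht0.2]) ?_ W
    (W.comp ⟨fun a => (s, a.2), by fun_prop⟩) y ?_ ?_ ?_ ?_ ?_ ?_
  · intro x hx
    rcases le_total x (2 * π) with hx' | hx'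
    · exact out₂ x ⟨ht0.1.trans hx.1, hx'⟩ fun h' => absurd hx.1 (not_le.2 h'.2)
    · rw [← Circle.periodic_exp.sub_eq x]
      refine out₂ _ ⟨by linarith, by linarith [hx.2, hs0.2]⟩ fun h' => ?_
      linarith [hx.2, h'.1]
  · intro x hx
    rw [hW0, in₁ x hx]
  · exact fun x _ => hW1 x
  · intro x hx
    change W (s, 0) = _
    rw [hW0, in₂ x hx, in₁ s ⟨le_rfl, hst.le⟩, hF s hs0, cutMap_of_mem hK hs]
  · exact fun x _ => hW1 s
  · exact fun u _ => rfl
  · intro u hu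
    change W (t, u) = W (s, u)
    change H (projIcc 0 1 zero_le_one (2 * u - 1), Circle.exp (m + (t - m) * lam u)) =
      H (projIcc 0 1 zero_le_one (2 * u - 1), Circle.exp (m + (s - m) * lam u))
    have hB : (t - s) * (2 * π / (t - s)) = 2 * π := mul_div_cancel₀ _ hd.ne'
    rcases le_total (2 * u) 1 with hu' | hu'
    · rw [projIcc_of_le_left _ (by linarith : 2 * u - 1 ≤ 0)]
      change H (0, _) = H (0, _)
      rw [H.apply_zero, H.apply_zero, ← Circle.periodic_exp (m + (s - m) * lam u)]
      have e : (t - s) * lam u = (t - s) + 2 * u * (2 * π - (t - s)) := by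
        simp only [lam]
        rw [min_eq_left hu']
        linear_combination 2 * u * hB
      have e1 : 0 ≤ 2 * u * (2 * π - (t - s)) :=
        mul_nonneg (by linarith [hu.1]) (by linarith [hs0.1, ht0.2])
      have e2 : 2 * u * (2 * π - (t - s)) ≤ 2 * π - (t - s) :=
        mul_le_of_le_one_left (by linarith [hs0.1, ht0.2]) hu'
      have e3 : (t - m) * lam u = (t - s) * lam u / 2 := by rw [hm]; ring
      have e4 : (s - m) * lam u = -((t - s) * lam u / 2) := by rw [hm]; ring
      rw [e3, e4, e, out₁, out₁]
      · constructor <;> linarith [hs0.1, ht0.2]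
      · constructor <;> linarith [hs0.1, ht0.2]
    · have e : (t - s) * lam u = 2 * π := by
        simp only [lam]
        rw [min_eq_right hu']
        linear_combination hB
      have e3 : m + (t - m) * lam u = (m + (s - m) * lam u) + 2 * π := by
        linear_combination e
      rw [e3, Circle.periodic_exp]

/-- For a minimal essential cut set, the fibres of the cut loop are as small as possible. -/
theorem const_or_const_of_minimal [MetricSpace Y] (hg : Continuous g)
    (hmin : Minimal (· ∈ essentialCutSets g) K) {x y : ℝ} (hxy : x ≤ y)
    (h : g (cutMap K x) = g (cutMap K y)) :
    (∀ z ∈ Icc x y, g (cutMap K z) = g (cutMap K x)) ∨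
      (∀ z ≤ x, g (cutMap K z) = g (cutMap K x)) ∧ ∀ z ≥ y, g (cutMap K z) = g (cutMap K x) := by
  obtain ⟨hcut, F, hF, hFnull⟩ := hmin.1
  have hK := hcut.isCompact
  have hmono := cutMap_monotone hK hcut.nonempty
  have hsK := cutMap_mem hK hcut.nonempty x
  have htK := cutMap_mem hK hcut.nonempty y
  set s := cutMap K x
  set t := cutMap K y
  rcases (hmono hxy).eq_or_lt with heq | hst
  · exact Or.inl fun z hz => congrArg g
      (le_antisymm ((hmono hz.2).trans heq.ge) (hmono hz.1))
  have h₁ := hcut.inter_Icc hsK htK hst h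
  have h₂ := hcut.diff_Ioo hsK htK h
  obtain ⟨F₁, hF₁⟩ := h₁.exists_isCutLoop hg
  obtain ⟨F₂, hF₂⟩ := h₂.exists_isCutLoop hg
  by_cases hnull : NullHomotopicLoop F₁
  · left
    have hsub : K ⊆ K \ Ioo s t := hmin.2 ⟨h₂, F₂, hF₂, fun h' => hFnull (h'.of_homotopic
      (hcut.homotopic_diff_Ioo hsK htK hst h hF hF₁ hF₂ hnull))⟩ sdiff_subset
    intro z hz
    have hzK := hsub (cutMap_mem hK hcut.nonempty z)
    rcases (hmono hz.1).eq_or_lt with h1 | h1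
    · exact congrArg g h1.symm
    rcases (hmono hz.2).eq_or_lt with h2 | h2
    · exact (congrArg g h2).trans h.symm
    · exact absurd ⟨h1, h2⟩ hzK.2
  · right
    have hsub : K ⊆ K ∩ Icc s t := hmin.2 ⟨h₁, F₁, hF₁, hnull⟩ inter_subset_left
    refine ⟨fun z hz => congrArg g ?_, fun z hz => Eq.trans (congrArg g ?_) h.symm⟩
    · exact le_antisymm (hmono hz) (hsub (cutMap_mem hK hcut.nonempty z)).2.1
    · exact le_antisymm (hsub (cutMap_mem hK hcut.nonempty z)).2.2 (hmono hz)

end split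

/-- The truncated oscillation of `f` around `f q` over `[q, t]`; it vanishes for `t ≤ q`. -/
noncomputable def oscFrom {Y : Type*} [MetricSpace Y] (f : ℝ → Y) (q t : ℝ) : ℝ :=
  sSup ((fun θ => min 1 (dist (f (q + θ * (max t q - q))) (f q))) '' Icc (0 : ℝ) 1)

section oscFrom

variable {Y : Type*} [MetricSpace Y] {f : ℝ → Y}

theorem bddAbove_oscFrom (f : ℝ → Y) (q t : ℝ) :
    BddAbove ((fun θ => min 1 (dist (f (q + θ * (max t q - q))) (f q))) '' Icc (0 : ℝ) 1) :=
  ⟨1, by rintro _ ⟨θ, _, rfl⟩; exact min_le_left _ _⟩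

theorem continuous_oscFrom (hf : Continuous f) (q : ℝ) : Continuous (oscFrom f q) := by
  refine isCompact_Icc.continuous_sSup
    (f := fun t θ => min 1 (dist (f (q + θ * (max t q - q))) (f q))) ?_
  simp only [Function.HasUncurry.uncurry, id]
  fun_prop

theorem le_oscFrom {q t x : ℝ} (hx : x ∈ Icc q t) : min 1 (dist (f x) (f q)) ≤ oscFrom f q t := by
  refine le_csSup (bddAbove_oscFrom f q t) ?_
  rcases hx.1.eq_or_lt with rfl | hlt
  · exact ⟨0, by simp, by simp⟩
  have hqt : 0 < t - q := by linarith [hx.2]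
  refine ⟨(x - q) / (t - q),
    ⟨div_nonneg (by linarith) hqt.le, (div_le_one hqt).2 (by linarith [hx.2])⟩, ?_⟩
  dsimp only
  rw [max_eq_left (by linarith), div_mul_cancel₀ _ hqt.ne', add_sub_cancel]

theorem oscFrom_le {q t B : ℝ} (h : ∀ x ∈ Icc q (max t q), min 1 (dist (f x) (f q)) ≤ B) :
    oscFrom f q t ≤ B := by
  refine csSup_le ((nonempty_Icc.2 zero_le_one).image _) ?_
  rintro _ ⟨θ, hθ, rfl⟩
  have h0 : 0 ≤ max t q - q := sub_nonneg.2 (le_max_right _ _)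
  refine h _ ⟨?_, ?_⟩
  · linarith [mul_nonneg hθ.1 h0]
  · linarith [mul_le_of_le_one_left h0 hθ.2]

theorem oscFrom_nonneg (f : ℝ → Y) (q t : ℝ) : 0 ≤ oscFrom f q t :=
  Real.sSup_nonneg (by rintro _ ⟨θ, _, rfl⟩; positivity)

theorem oscFrom_le_one (f : ℝ → Y) (q t : ℝ) : oscFrom f q t ≤ 1 :=
  oscFrom_le fun _ _ => min_le_left _ _

theorem oscFrom_of_le {q t : ℝ} (h : t ≤ q) : oscFrom f q t = 0 := by
  refine le_antisymm (oscFrom_le fun x hx => ?_) (oscFrom_nonneg f q t)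
  rw [max_eq_right h, Icc_self, mem_singleton_iff] at hx
  simp [hx]

theorem oscFrom_monotone (f : ℝ → Y) (q : ℝ) : Monotone (oscFrom f q) := by
  intro t t' h
  rcases le_total t q with hq | hq
  · rw [oscFrom_of_le hq]
    exact oscFrom_nonneg f q t'
  · refine oscFrom_le fun x hx => le_oscFrom ⟨hx.1, ?_⟩
    rw [max_eq_left hq] at hx
    exact hx.2.trans h

theorem oscFrom_eq_of_const {q s t : ℝ} (hst : s ≤ t) (h : ∀ x ∈ Icc s t, f x = f s) :
    oscFrom f q s = oscFrom f q t := by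
  refine le_antisymm (oscFrom_monotone f q hst) (oscFrom_le fun x hx => ?_)
  rcases le_total t q with htq | htq
  · rw [max_eq_right htq, Icc_self, mem_singleton_iff] at hx
    simpa [hx] using oscFrom_nonneg f q s
  rw [max_eq_left htq] at hx
  rcases le_total s q with hsq | hsq
  · rw [h x ⟨hsq.trans hx.1, hx.2⟩, h q ⟨hsq, htq⟩, dist_self]
    simpa using oscFrom_nonneg f q s
  · rcases le_total x s with hxs | hxs
    · exact le_oscFrom ⟨hx.1, hxs⟩
    · rw [h x ⟨hxs, hx.2⟩]
      exact le_oscFrom ⟨hsq, le_rfl⟩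

end oscFrom

/-- There is a monotone continuous function which is constant exactly on the intervals where the
given path is constant. -/
theorem exists_monotone_const_iff {Y : Type*} [MetricSpace Y] {f : ℝ → Y} (hf : Continuous f) :
    ∃ ψ : ℝ → ℝ, Continuous ψ ∧ Monotone ψ ∧
      ∀ s t, s ≤ t → (ψ s = ψ t ↔ ∀ x ∈ Icc s t, f x = f s) := by
  let u : ℕ → ℝ → ℝ := fun n t => (1 / 2) ^ n * oscFrom f (TopologicalSpace.denseSeq ℝ n) t
  have hle : ∀ n t, ‖u n t‖ ≤ (1 / 2) ^ n := by
    intro n t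
    have h0 := oscFrom_nonneg f (TopologicalSpace.denseSeq ℝ n) t
    rw [Real.norm_of_nonneg (by positivity)]
    exact mul_le_of_le_one_right (by positivity) (oscFrom_le_one _ _ _)
  have hgeo : Summable fun n : ℕ => ((1 : ℝ) / 2) ^ n := summable_geometric_two
  have hsum : ∀ t, Summable fun n => u n t := fun t =>
    Summable.of_norm_bounded hgeo fun n => hle n t
  have hmono : ∀ n, Monotone (u n) := fun n s t hst =>
    mul_le_mul_of_nonneg_left (oscFrom_monotone f _ hst) (by positivity)
  refine ⟨fun t => ∑' n, u n t, ?_, ?_, ?_⟩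
  · exact continuous_tsum (fun n => (continuous_oscFrom hf _).const_mul _) hgeo hle
  · exact fun s t hst => (hsum s).tsum_le_tsum (fun n => hmono n hst) (hsum t)
  intro s t hst
  constructor
  · intro heq
    have hterm : ∀ n, u n s = u n t := by
      intro n
      by_contra hne
      exact absurd heq (Summable.tsum_lt_tsum (fun n => hmono n hst)
        (lt_of_le_of_ne (hmono n hst) hne) (hsum s) (hsum t)).ne
    have hdense : ∀ n, TopologicalSpace.denseSeq ℝ n ∈ Ioo s t →
        f (TopologicalSpace.denseSeq ℝ n) = f t := by
      intro n hn
      have h1 := mul_left_cancel₀ (by positivity) (hterm n)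
      rw [oscFrom_of_le hn.1.le] at h1
      have h2 := le_oscFrom (f := f) (q := TopologicalSpace.denseSeq ℝ n) ⟨hn.2.le, le_refl t⟩
      rw [← h1, min_le_iff] at h2
      exact (dist_le_zero.1 (h2.resolve_left (by norm_num))).symm
    rcases hst.eq_or_lt with rfl | hlt
    · intro x hx
      rw [Icc_self, mem_singleton_iff] at hx
      rw [hx]
    have hcl : Icc s t ⊆ {x | f x = f t} := by
      rw [← closure_Ioo hlt.ne]
      refine closure_minimal ?_ (isClosed_eq hf continuous_const)
      refine ((TopologicalSpace.denseRange_denseSeq ℝ).open_subset_closure_inter isOpen_Ioo).trans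
        (closure_minimal ?_ (isClosed_eq hf continuous_const))
      rintro _ ⟨hx, n, rfl⟩
      exact hdense n hx
    intro x hx
    exact (hcl hx).trans (hcl ⟨le_rfl, hst⟩).symm
  · intro h
    dsimp only [u]
    congr 1
    ext n
    rw [oscFrom_eq_of_const hst h]

/-- A non-constant loop on `[0, 2π]` whose only coincidences come from intervals of constancy is a
monotone reparametrization of an injective loop. -/
theorem exists_injective_param {Y : Type*} [MetricSpace Y] {f : ℝ → Y} (hf : Continuous f)
    (hends : f 0 = f (2 * π)) (hne : ∃ x ∈ Icc 0 (2 * π), f x ≠ f 0)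
    (hfib : ∀ x y, x ≤ y → f x = f y → (∀ z ∈ Icc x y, f z = f x) ∨
      (∀ z ≤ x, f z = f x) ∧ ∀ z ≥ y, f z = f x) :
    ∃ (η : C(Circle, Y)) (Ψ : C(Circle, Circle)) (ρ : ℝ → ℝ), Function.Injective η ∧
      MonotoneOn ρ (Icc 0 (2 * π)) ∧ MapsTo ρ (Icc 0 (2 * π)) (Icc 0 (2 * π)) ∧
      (∀ x ∈ Icc 0 (2 * π), η (Circle.exp x) = f (ρ x)) ∧
      ∀ x ∈ Icc 0 (2 * π), η (Ψ (Circle.exp x)) = f x := by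
  have hpi := Real.two_pi_pos
  obtain ⟨ψ, hψc, hψm, hψ⟩ := exists_monotone_const_iff hf
  have hD : 0 < ψ (2 * π) - ψ 0 := by
    refine sub_pos.2 (lt_of_le_of_ne (hψm hpi.le) fun h => ?_)
    obtain ⟨x, hx, hx'⟩ := hne
    exact hx' ((hψ 0 (2 * π) hpi.le).1 h x hx)
  let φ : ℝ → ℝ := fun x => 2 * π / (ψ (2 * π) - ψ 0) * (ψ x - ψ 0)
  have hφc : Continuous φ := by fun_prop
  have hφm : Monotone φ := fun x y hxy =>
    mul_le_mul_of_nonneg_left (sub_le_sub_right (hψm hxy) _) (by positivity)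
  have hφ0 : φ 0 = 0 := by simp [φ]
  have hφ1 : φ (2 * π) = 2 * π := div_mul_cancel₀ _ hD.ne'
  have hφ : ∀ s t, s ≤ t → (φ s = φ t ↔ ∀ x ∈ Icc s t, f x = f s) := by
    intro s t hst
    rw [← hψ s t hst]
    have : 2 * π / (ψ (2 * π) - ψ 0) ≠ 0 := by positivity
    simp [φ, this]
  have hφmaps : MapsTo φ (Icc 0 (2 * π)) (Icc 0 (2 * π)) := fun x hx =>
    ⟨hφ0 ▸ hφm hx.1, hφ1 ▸ hφm hx.2⟩
  have hsurj : ∀ y : ℝ, ∃ x ∈ Icc 0 (2 * π), y ∈ Icc 0 (2 * π) → φ x = y := by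
    intro y
    by_cases hy : y ∈ Icc 0 (2 * π)
    · have h := intermediate_value_Icc hpi.le hφc.continuousOn
      rw [hφ0, hφ1] at h
      obtain ⟨x, hx, hxy⟩ := h hy
      exact ⟨x, hx, fun _ => hxy⟩
    · exact ⟨0, ⟨le_rfl, hpi.le⟩, fun h => absurd h hy⟩
  choose ρ hρ hφρ using hsurj
  have hfeq : ∀ x y, φ x = φ y → f x = f y := by
    intro x y hxy
    rcases le_total x y with h | h
    · exact ((hφ x y h).1 hxy y ⟨h, le_rfl⟩).symm
    · exact (hφ y x h).1 hxy.symm x ⟨h, le_rfl⟩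
  have hfρ : ∀ x ∈ Icc 0 (2 * π), f (ρ (φ x)) = f x := fun x hx =>
    hfeq _ _ (hφρ _ (hφmaps hx))
  have hρm : StrictMonoOn ρ (Icc 0 (2 * π)) := by
    intro x hx y hy hxy
    by_contra! h
    have := hφm h
    rw [hφρ x hx, hφρ y hy] at this
    exact absurd hxy (not_lt.2 this)
  have hcont : ContinuousOn (fun x => f (ρ x)) (Icc 0 (0 + 2 * π)) := by
    rw [zero_add, continuousOn_iff_continuous_domRestrict]
    have hqc : Continuous hφmaps.restrict := hφc.restrict hφmaps
    have hq : IsQuotientMap hφmaps.restrict :=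
      hqc.isClosedMap.isQuotientMap hqc fun y => ⟨⟨ρ y, hρ y⟩, Subtype.ext (hφρ y y.2)⟩
    rw [hq.continuous_iff]
    have : (Icc 0 (2 * π)).domRestrict (fun x => f (ρ x)) ∘ hφmaps.restrict =
        (Icc 0 (2 * π)).domRestrict f := funext fun x => hfρ x x.2
    rw [this]
    exact hf.comp continuous_subtype_val
  have m0 : (0 : ℝ) ∈ Icc 0 (2 * π) := ⟨le_rfl, hpi.le⟩
  have m1 : 2 * π ∈ Icc 0 (2 * π) := ⟨hpi.le, le_rfl⟩
  have hρ0 := hfρ 0 m0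
  have hρ1 := hfρ (2 * π) m1
  rw [hφ0] at hρ0
  rw [hφ1] at hρ1
  obtain ⟨η, hη⟩ := exists_circle_lift_path 0 (fun x => f (ρ x)) hcont
    (by rw [zero_add, hρ0, hρ1, hends])
  obtain ⟨Ψ, hΨ⟩ := exists_circle_lift_path 0 (fun x => Circle.exp (φ x))
    (by fun_prop) (by rw [zero_add, hφ0, hφ1]; simp)
  rw [zero_add] at hη hΨ
  refine ⟨η, Ψ, ρ, ?_, hρm.monotoneOn, fun x _ => hρ x, hη, fun x hx => ?_⟩
  · intro z w hzw
    obtain ⟨x, hx, rfl⟩ := circle_exp_surjOn 0 z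
    obtain ⟨y, hy, rfl⟩ := circle_exp_surjOn 0 w
    rw [zero_add] at hx hy
    wlog hxy : x ≤ y generalizing x y
    · exact (this y hy x hx hzw.symm (le_of_not_ge hxy)).symm
    rcases hxy.eq_or_lt with rfl | hlt
    · rfl
    rw [hη x hx, hη y hy] at hzw
    have hρlt := hρm hx hy hlt
    rcases hfib _ _ hρlt.le hzw with h | ⟨h1, h2⟩
    · have := (hφ _ _ hρlt.le).2 h
      rw [hφρ x hx, hφρ y hy] at this
      exact absurd this hlt.ne
    · have hx0 : φ 0 = φ (ρ x) := (hφ _ _ (hρ x).1).2 fun z hz =>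
        (h1 z hz.2).trans (h1 0 (hρ x).1).symm
      have hy0 : φ (ρ y) = φ (2 * π) := (hφ _ _ (hρ y).2).2 fun z hz =>
        (h2 z hz.1).trans (h2 (ρ y) le_rfl).symm
      rw [hφ0, hφρ x hx] at hx0
      rw [hφ1, hφρ y hy] at hy0
      rw [← hx0, hy0]
      simp
  · rw [hΨ x hx, hη _ (hφmaps hx), hfρ x hx]

/-- **curve cutting lemma.** Let `Y` be a compact, locally contractible
metric space and `γ : S¹ → Y` a continuous loop which is not null-homotopic. Then some
Jordan curve `T ⊆ γ(S¹)` admits a weakly monotone parametrization `η` that is not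
null-homotopic, and for every continuous map `F : Y → X` to a metric space,
`ℓ_X(F ∘ η) ≤ ℓ_X(F ∘ γ)`. -/
theorem curve_cutting_lemma {Y : Type*} [MetricSpace Y] [CompactSpace Y]
    (hY : LocallyContractible Y)
    (γ : C(Circle, Y)) (hγ : ¬ NullHomotopicLoop γ) :
    ∃ T : Set Y, T ⊆ Set.range γ ∧ ∃ η : C(Circle, Y),
      IsWeaklyMonotoneParam η T ∧ ¬ NullHomotopicLoop η ∧
      ∀ (X : Type*) [MetricSpace X] (F : Y → X), Continuous F →
        loopLength (F ∘ η) ≤ loopLength (F ∘ γ) := by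
  obtain ⟨K, hK⟩ := exists_minimal_essentialCutSet hY γ hγ
  set g : ℝ → Y := fun x => γ (Circle.exp x) with hgdef
  have hg : Continuous g := by fun_prop
  obtain ⟨hcut, F, hF, hFnull⟩ := hK.1
  have hends : g (cutMap K 0) = g (cutMap K (2 * π)) := by
    rw [hcut.cutMap_zero, hcut.cutMap_two_pi, hcut.ends]
  have hne : ∃ x ∈ Icc 0 (2 * π), g (cutMap K x) ≠ g (cutMap K 0) := by
    by_contra! h
    refine hFnull ⟨g (cutMap K 0), ?_⟩
    suffices F = ContinuousMap.const Circle (g (cutMap K 0)) from this ▸ .refl _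
    ext z
    obtain ⟨x, hx, rfl⟩ := circle_exp_surjOn 0 z
    rw [zero_add] at hx
    rw [hF x hx, h x hx, ContinuousMap.const_apply]
  obtain ⟨η, Ψ, ρ, hinj, hρm, hρ, hη, hηΨ⟩ := exists_injective_param (hcut.continuous_cutMap hg)
    hends hne (fun x y hxy h => const_or_const_of_minimal hg hK hxy h)
  refine ⟨range η, ?_, η, ⟨fun _ =>
    (η.continuous.isClosedEmbedding hinj).isEmbedding.toHomeomorph, ?_⟩, ?_, ?_⟩
  · rintro _ ⟨z, rfl⟩
    obtain ⟨x, hx, rfl⟩ := circle_exp_surjOn 0 z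
    rw [zero_add] at hx
    rw [hη x hx]
    exact mem_range_self _
  · exact Metric.tendstoUniformly_iff.2 fun ε hε =>
      Eventually.of_forall fun _ z => (dist_self (η z)).trans_lt hε
  · rintro ⟨y, hy⟩
    refine hFnull ⟨y, ?_⟩
    have : F = η.comp Ψ := by
      ext z
      obtain ⟨x, hx, rfl⟩ := circle_exp_surjOn 0 z
      rw [zero_add] at hx
      rw [hF x hx, ContinuousMap.comp_apply, hηΨ x hx]
    rw [this]
    exact hy.comp (.refl Ψ)
  · intro X _ G _
    unfold loopLength
    have h1 : EqOn (fun x : ℝ => (G ∘ η) (Circle.exp x))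
        ((fun x : ℝ => (G ∘ γ) (Circle.exp x)) ∘ fun x => cutMap K (ρ x)) (Icc 0 (2 * π)) :=
      fun x hx => congrArg G (hη x hx)
    rw [eVariationOn.congr h1]
    refine eVariationOn.comp_le_of_monotoneOn _ _ ?_ ?_
    · exact fun x hx y hy hxy => cutMap_monotone hcut.isCompact hcut.nonempty (hρm hx hy hxy)
    · exact fun x _ => hcut.subset (cutMap_mem hcut.isCompact hcut.nonempty _)
end

section
/- Let $X$ be a compact metric space. A continuous surjection $f:S^1\to X$ is cell-like (all fibers $f^{-1}(q)$ are cell-like) if and only if $X$ is homeomorphic to $S^1$ and $f$ is a weakly monotone parametrization of $X$ (a uniform limit of homeomorphisms $S^1\to X$). -/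
open Set Filter Topology

/-- The Hilbert cube. -/
abbrev HilbertCube : Type := ℕ → unitInterval

/-- A subset `A` of the Hilbert cube is cell-like if it is null-homotopic in every
neighborhood of itself: for every open `U ⊇ A` the inclusion `A ↪ U` is homotopic to a
constant map. -/
def IsCellLikeSet (A : Set HilbertCube) : Prop :=
  A.Nonempty ∧ ∀ U : Set HilbertCube, IsOpen U → ∀ hAU : A ⊆ U, ∃ p : ↥U,
    ContinuousMap.Homotopic
      ⟨Set.inclusion hAU, continuous_inclusion hAU⟩
      (ContinuousMap.const ↥A p)

/-- A compact metric space is cell-like if it admits an embedding into the Hilbert cube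
whose image is null-homotopic in each of its neighborhoods. -/
def IsCellLikeSpace (K : Type*) [MetricSpace K] : Prop :=
  ∃ e : K → HilbertCube, Topology.IsEmbedding e ∧ IsCellLikeSet (Set.range e)

/-- A set of points on the circle such that, of the two closed arcs joining any two of its points,
at least one stays in the set. -/
def ArcConvex (K : Set Circle) : Prop :=
  ∀ s t : ℝ, s < t → t < s + 2 * Real.pi → Circle.exp s ∈ K → Circle.exp t ∈ K →
    (∀ x ∈ Icc s t, Circle.exp x ∈ K) ∨ ∀ x ∈ Icc t (s + 2 * Real.pi), Circle.exp x ∈ K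

theorem Circle.exp_eq_exp_cases {x y : ℝ} (h : Circle.exp x = Circle.exp y) (hxy : x ≤ y)
    (hyx : y ≤ x + 2 * Real.pi) : y = x ∨ y = x + 2 * Real.pi := by
  obtain ⟨m, hm⟩ := Circle.exp_eq_exp.1 h.symm
  have hpi := Real.pi_pos
  have h0 : (-1 : ℝ) < m := by nlinarith
  have h1 : (m : ℝ) < 2 := by nlinarith
  have h0' : (-1 : ℤ) < m := by exact_mod_cast h0
  have h1' : m < (2 : ℤ) := by exact_mod_cast h1
  obtain rfl | rfl : m = 0 ∨ m = 1 := by omega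
  · left; simpa using hm
  · right; simpa using hm

theorem Circle.exists_exp_eq (a : ℝ) (z : Circle) :
    ∃ x ∈ Ico a (a + 2 * Real.pi), Circle.exp x = z := by
  obtain ⟨y, rfl⟩ := Circle.exp_surjective z
  obtain ⟨x, hx, h⟩ := Circle.periodic_exp.exists_mem_Ico Real.two_pi_pos y a
  exact ⟨x, hx, h.symm⟩

theorem IsPreconnected.arcConvex {K : Set Circle} (hK : IsPreconnected K) : ArcConvex K := by
  intro s t hst hts hs ht
  by_contra! hcon
  obtain ⟨⟨u, hu, hu'⟩, v, hv, hv'⟩ := hcon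
  have hclosed (a b : ℝ) : IsClosed (Circle.exp '' Icc a b) :=
    (isCompact_Icc.image Circle.exp.continuous).isClosed
  obtain ⟨z, hzK, ⟨x, hx, rfl⟩, y, hy, hxy⟩ :=
    isPreconnected_closed_iff.1 hK _ _ (hclosed u v) (hclosed v (u + 2 * Real.pi))
      (fun z _ ↦ by
        obtain ⟨x, hx, rfl⟩ := Circle.exists_exp_eq u z
        rcases le_total x v with h | h
        · exact Or.inl ⟨x, ⟨hx.1, h⟩, rfl⟩
        · exact Or.inr ⟨x, ⟨h, hx.2.le⟩, rfl⟩)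
      ⟨_, ht, t, ⟨hu.2, hv.1⟩, rfl⟩
      ⟨_, hs, s + 2 * Real.pi, ⟨hv.2, by linarith [hu.1]⟩, Circle.exp_add_two_pi s⟩
  rcases Circle.exp_eq_exp_cases hxy.symm (hx.2.trans hy.1) (by linarith [hx.1, hy.2]) with h | h
  · obtain rfl : x = v := by linarith [hx.2, hy.1]
    exact hv' hzK
  · obtain rfl : x = u := by linarith [hx.1, hy.2]
    exact hu' hzK

theorem ArcConvex.contractibleSpace {K : Set Circle} (hK : ArcConvex K) (hc : IsClosed K)
    (hne : K.Nonempty) (huniv : K ≠ univ) : ContractibleSpace K := by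
  obtain ⟨w, hw⟩ := (ne_univ_iff_exists_notMem K).1 huniv
  obtain ⟨v, rfl⟩ := Circle.exp_surjective w
  have hw' : Circle.exp (v + 2 * Real.pi) ∉ K := by rwa [Circle.exp_add_two_pi]
  set J : Set ℝ := Icc v (v + 2 * Real.pi) ∩ Circle.exp ⁻¹' K
  have hJc : IsCompact J := isCompact_Icc.inter_right (hc.preimage Circle.exp.continuous)
  have hJo : J.OrdConnected := by
    refine ⟨fun s hs t ht x hx ↦ ⟨⟨hs.1.1.trans hx.1, hx.2.trans ht.1.2⟩, ?_⟩⟩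
    rcases (hx.1.trans hx.2).eq_or_lt with rfl | hst
    · obtain rfl := le_antisymm hx.1 hx.2
      exact hs.2
    have hvs : s ≠ v := by rintro rfl; exact hw hs.2
    have hvs' := lt_of_le_of_ne hs.1.1 hvs.symm
    rcases hK s t hst (by linarith [ht.1.2]) hs.2 ht.2 with h | h
    · exact h x hx
    · exact absurd (h (v + 2 * Real.pi) ⟨ht.1.2, by linarith⟩) hw'
  have hJne : J.Nonempty := by
    obtain ⟨z, hz⟩ := hne
    obtain ⟨x, hx, rfl⟩ := Circle.exists_exp_eq v z
    exact ⟨x, Ico_subset_Icc_self hx, hz⟩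
  have := hJo.convex.contractibleSpace hJne
  have : CompactSpace J := isCompact_iff_compactSpace.1 hJc
  let g : J → K := fun x ↦ ⟨Circle.exp x, x.2.2⟩
  have hg : Continuous g := by fun_prop
  have hbij : Function.Bijective g := by
    refine ⟨fun x y hxy ↦ ?_, fun ⟨z, hz⟩ ↦ ?_⟩
    · have hxy' : Circle.exp x = Circle.exp y := congrArg Subtype.val hxy
      have aux (x y : J) (h : Circle.exp x = Circle.exp y) (hle : (x : ℝ) ≤ y) : x = y := by
        rcases Circle.exp_eq_exp_cases h hle (by linarith [x.2.1.1, y.2.1.2]) with h' | h'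
        · exact Subtype.ext h'.symm
        · have : (x : ℝ) = v := by linarith [x.2.1.1, y.2.1.2]
          exact absurd x.2.2 (by rw [this]; exact hw)
      rcases le_total (x : ℝ) y with h | h
      · exact aux x y hxy' h
      · exact (aux y x hxy'.symm h).symm
    · obtain ⟨x, hx, rfl⟩ := Circle.exists_exp_eq v z
      exact ⟨⟨x, Ico_subset_Icc_self hx, hz⟩, rfl⟩
  exact (hg.homeoOfEquivCompactToT2 (f := Equiv.ofBijective g hbij)).symm.contractibleSpace

instance : LocallyPathConnectedSpace Circle :=
  (isLocalHomeomorph_circleExp.isOpenMap.isQuotientMap Circle.exp.continuous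
    Circle.exp_surjective).locallyPathConnectedSpace

theorem Circle.not_contractibleSpace : ¬ ContractibleSpace Circle := by
  intro _
  obtain ⟨g, ⟨-, hg⟩, -⟩ := Circle.isCoveringMap_exp.existsUnique_continuousMap_lifts
    (ContinuousMap.id Circle) (a₀ := 1) (e₀ := 0) (by simp)
  have hlift (z : Circle) : Circle.exp (g z) = z := congrFun hg z
  have hfun : (fun t ↦ g (Circle.exp t)) = fun t ↦ t + g 1 := by
    refine Circle.isCoveringMap_exp.eq_of_comp_eq (by fun_prop) (by fun_prop) ?_ 0 (by simp)
    ext t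
    simp [hlift, Circle.exp_add]
  have h := congrFun hfun (2 * Real.pi)
  simp at h

/-- A map from a compact cell-like space to an open subset of a space with the Tietze extension
property is null-homotopic. -/
theorem IsCellLikeSpace.nullhomotopic {K Y : Type*} [MetricSpace K] [CompactSpace K]
    [TopologicalSpace Y] [TietzeExtension.{0} Y] (hK : IsCellLikeSpace K) {W : Set Y}
    (hW : IsOpen W) (u : C(K, W)) : u.Nullhomotopic := by
  obtain ⟨e, he, -, hnull⟩ := hK
  obtain ⟨g, hg⟩ := ContinuousMap.exists_extension'
    (he.continuous.isClosedEmbedding he.injective) ((⟨Subtype.val, by fun_prop⟩ : C(W, Y)).comp u)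
  have hg' (x : K) : g (e x) = u x := congrFun hg x
  have hAU : range e ⊆ g ⁻¹' W := by
    rintro _ ⟨x, rfl⟩
    change g (e x) ∈ W
    rw [hg']
    exact (u x).2
  obtain ⟨p, hp⟩ := hnull (g ⁻¹' W) (hW.preimage g.continuous) hAU
  let G : C(g ⁻¹' W, W) := ⟨fun x ↦ ⟨g x, x.2⟩, by fun_prop⟩
  let E : C(K, range e) := ⟨fun x ↦ ⟨e x, x, rfl⟩, by have := he.continuous; fun_prop⟩
  have h : ContinuousMap.Nullhomotopic
      (⟨Set.inclusion hAU, continuous_inclusion hAU⟩ : C(range e, g ⁻¹' W)) := ⟨p, hp⟩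
  convert (h.comp_right G).comp_left E
  ext x
  exact (hg' x).symm

theorem IsCellLikeSpace.preconnectedSpace {K : Type*} [MetricSpace K] [CompactSpace K]
    (hK : IsCellLikeSpace K) : PreconnectedSpace K := by
  refine preconnectedSpace_of_forall_constant fun b hb x y ↦ ?_
  let σ : Bool → ({0}ᶜ : Set ℝ) := fun b ↦ ⟨if b then 1 else -1, by cases b <;> simp⟩
  obtain ⟨p, ⟨H⟩⟩ := hK.nullhomotopic (isOpen_compl_singleton (x := (0 : ℝ)))
    ⟨fun x ↦ σ (b x), (continuous_of_discreteTopology (f := σ)).comp hb⟩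
  have hsign (z : K) : 0 < ((σ (b z) : ℝ)) ↔ 0 < (p : ℝ) := by
    have hpre : IsPreconnected (range fun t : unitInterval ↦ ((H (t, z) : ({0}ᶜ : Set ℝ)) : ℝ)) :=
      isPreconnected_range (by fun_prop)
    have h0 : ((σ (b z) : ℝ)) ∈ range fun t : unitInterval ↦ ((H (t, z) : ({0}ᶜ : Set ℝ)) : ℝ) :=
      ⟨0, by simp⟩
    have h1 : (p : ℝ) ∈ range fun t : unitInterval ↦ ((H (t, z) : ({0}ᶜ : Set ℝ)) : ℝ) :=
      ⟨1, by simp⟩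
    have hn : (0 : ℝ) ∉ range fun t : unitInterval ↦ ((H (t, z) : ({0}ᶜ : Set ℝ)) : ℝ) := by
      rintro ⟨t, ht⟩
      exact (H (t, z)).2 ht
    have ho := hpre.ordConnected
    constructor <;> intro h <;> by_contra h'
    · exact hn (ho.out h1 h0 ⟨not_lt.1 h', h.le⟩)
    · exact hn (ho.out h0 h1 ⟨not_lt.1 h', h.le⟩)
  have hxy := (hsign x).trans (hsign y).symm
  cases hx : b x <;> cases hy : b y <;> simp_all [σ]
  all_goals norm_num at hxy

theorem IsCellLikeSpace.ne_univ {K : Set Circle} (h : IsCellLikeSpace K) : K ≠ univ := by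
  rintro rfl
  have : CompactSpace (univ : Set Circle) := isCompact_iff_compactSpace.1 isCompact_univ
  have hn := h.nullhomotopic (isOpen_compl_singleton (x := (0 : ℂ)))
    ⟨fun z ↦ ⟨(z : Circle), z.1.coe_ne_zero⟩, by fun_prop⟩
  have hmem (z : ({0}ᶜ : Set ℂ)) : (z : ℂ) / ‖(z : ℂ)‖ ∈ Submonoid.unitSphere ℂ := by
    have := norm_ne_zero_iff.2 (show (z : ℂ) ≠ 0 from z.2)
    simp [Submonoid.unitSphere, this]
  have hcont : Continuous fun z : ({0}ᶜ : Set ℂ) ↦ (z : ℂ) / ‖(z : ℂ)‖ :=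
    Continuous.div (by fun_prop) (by fun_prop) fun z ↦ by
      simpa using show (z : ℂ) ≠ 0 from z.2
  let r : C(({0}ᶜ : Set ℂ), Circle) := ⟨fun z ↦ ⟨_, hmem z⟩, hcont.subtype_mk hmem⟩
  refine Circle.not_contractibleSpace ((contractible_iff_id_nullhomotopic Circle).2 ?_)
  convert (hn.comp_right r).comp_left (⟨fun z ↦ ⟨z, trivial⟩, by fun_prop⟩ : C(Circle, univ))
  ext z
  have hz : (z : ℂ) / ‖(z : ℂ)‖ = z := by
    rw [show ‖(z : ℂ)‖ = 1 from z.norm_coe, Complex.ofReal_one, div_one]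
  exact hz.symm

theorem isCellLikeSpace_of_contractibleSpace {K : Type*} [MetricSpace K] [ContractibleSpace K]
    {e : K → HilbertCube} (he : IsEmbedding e) : IsCellLikeSpace K := by
  have : ContractibleSpace (range e) := he.toHomeomorph.symm.contractibleSpace
  refine ⟨e, he, range_nonempty e, fun U _ hAU ↦ ?_⟩
  exact (id_nullhomotopic (range e)).comp_right ⟨Set.inclusion hAU, continuous_inclusion hAU⟩

theorem Circle.exists_isEmbedding_hilbertCube : ∃ e : Circle → HilbertCube, IsEmbedding e := by
  have hre (z : Circle) : |(z : ℂ).re| ≤ 1 := (Complex.abs_re_le_norm _).trans_eq z.norm_coe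
  have him (z : Circle) : |(z : ℂ).im| ≤ 1 := (Complex.abs_im_le_norm _).trans_eq z.norm_coe
  let e : Circle → HilbertCube := fun z n ↦
    if n = 0 then ⟨(1 + (z : ℂ).re) / 2, by constructor <;> linarith [abs_le.1 (hre z)]⟩
    else ⟨(1 + (z : ℂ).im) / 2, by constructor <;> linarith [abs_le.1 (him z)]⟩
  refine ⟨e, (Continuous.isClosedEmbedding (f := e) ?_ ?_).isEmbedding⟩
  · refine continuous_pi fun n ↦ ?_
    by_cases hn : n = 0 <;> simp only [e, hn, if_true, if_false] <;> fun_prop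
  · intro z w h
    have h0 := congrArg Subtype.val (congrFun h 0)
    have h1 := congrArg Subtype.val (congrFun h 1)
    simp only [e, if_true, one_ne_zero, if_false] at h0 h1
    exact Circle.ext (Complex.ext (by linarith) (by linarith))

/-- Fibers of a uniform limit of homeomorphisms onto a locally connected space are arc-convex. -/
theorem arcConvex_fiber_of_tendstoUniformly {X : Type*} [MetricSpace X] [LocallyConnectedSpace X]
    {f : Circle → X} {h : ℕ → (Circle ≃ₜ X)}
    (hlim : TendstoUniformly (fun n z ↦ h n z) f atTop) (q : X) : ArcConvex (f ⁻¹' {q}) := by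
  intro s t hst hts hs ht
  by_contra! hcon
  obtain ⟨⟨u, hu, hu'⟩, v, hv, hv'⟩ := hcon
  have hu' : f (Circle.exp u) ≠ q := hu'
  have hv' : f (Circle.exp v) ≠ q := hv'
  have hs : f (Circle.exp s) = q := hs
  have ht : f (Circle.exp t) = q := ht
  obtain ⟨Vu, hVu, Wu, hWu, hdu⟩ := Filter.disjoint_iff.1 (disjoint_nhds_nhds.2 hu')
  obtain ⟨Vv, hVv, Wv, hWv, hdv⟩ := Filter.disjoint_iff.1 (disjoint_nhds_nhds.2 hv')
  obtain ⟨W, hWsub, hWo, hqW, hWc⟩ :=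
    locallyConnectedSpace_iff_subsets_isOpen_isConnected.1 inferInstance q (Wu ∩ Wv)
      (inter_mem hWu hWv)
  have hlim' (z : Circle) := hlim.tendsto_at z
  have hW := hWo.mem_nhds hqW
  obtain ⟨n, ⟨h1, h2⟩, h3, h4⟩ := ((((hlim' _).eventually_mem (hs ▸ hW)).and
    ((hlim' _).eventually_mem (ht ▸ hW))).and
    (((hlim' _).eventually_mem hVu).and ((hlim' _).eventually_mem hVv))).exists
  have hpre : IsPreconnected (h n ⁻¹' W) := (h n).isPreconnected_preimage.2 hWc.isPreconnected
  rcases hpre.arcConvex s t hst hts h1 h2 with H | H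
  · exact hdu.ne_of_mem h3 (hWsub (H u hu)).1 rfl
  · exact hdv.ne_of_mem h4 (hWsub (H v hv)).2 rfl

/-- For every path in a compact metric space there is a continuous real function, monotone on
`[a, b]`, which is constant exactly on those subintervals on which the path is constant. -/
theorem exists_monotoneOn_eq_iff_constant {X : Type*} [MetricSpace X] [CompactSpace X]
    {γ : ℝ → X} (hγ : Continuous γ) (a b : ℝ) :
    ∃ F : ℝ → ℝ, Continuous F ∧ MonotoneOn F (Icc a b) ∧
      ∀ s ∈ Icc a b, ∀ t ∈ Icc a b, s ≤ t → (F s = F t ↔ ∀ x ∈ Icc s t, γ x = γ s) := by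
  let D : ℝ := Metric.diam (univ : Set X)
  have hD (x y : X) : dist x y ≤ D :=
    Metric.dist_le_diam_of_mem isCompact_univ.isBounded trivial trivial
  let M : ℝ → ℝ → ℝ := fun c t ↦ sSup ((fun x ↦ dist (γ c) (γ (max c (min x t)))) '' Icc a b)
  have hMcont (c : ℝ) : Continuous (M c) :=
    isCompact_Icc.continuous_sSup (f := fun t x ↦ dist (γ c) (γ (max c (min x t))))
      (by fun_prop)
  have hbdd (c t : ℝ) : BddAbove ((fun x ↦ dist (γ c) (γ (max c (min x t)))) '' Icc a b) :=
    ⟨D, by rintro _ ⟨x, -, rfl⟩; exact hD _ _⟩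
  have hM0 (c t : ℝ) : 0 ≤ M c t := by
    refine Real.sSup_nonneg ?_
    rintro _ ⟨x, -, rfl⟩
    exact dist_nonneg
  have hMD (c t : ℝ) : M c t ≤ D := by
    refine Real.sSup_le ?_ Metric.diam_nonneg
    rintro _ ⟨x, -, rfl⟩
    exact hD _ _
  have hle (c : ℝ) {x t : ℝ} (hx : x ∈ Icc a b) : dist (γ c) (γ (max c (min x t))) ≤ M c t :=
    le_csSup (hbdd c t) ⟨x, hx, rfl⟩
  have hMmono (c : ℝ) : MonotoneOn (M c) (Icc a b) := by
    intro s hs t ht hst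
    refine Real.sSup_le ?_ (hM0 c t)
    rintro _ ⟨x, hx, rfl⟩
    have hm : min (min x s) t = min x s := min_eq_left ((min_le_right x s).trans hst)
    have := hle c (x := min x s) (t := t) ⟨le_min hx.1 hs.1, (min_le_left x s).trans hx.2⟩
    rwa [hm] at this
  let d : ℕ → ℝ := TopologicalSpace.denseSeq ℝ
  have hpos (n : ℕ) : (0 : ℝ) < (1 / 2) ^ n := by positivity
  have hsum : Summable fun n : ℕ ↦ (1 / 2 : ℝ) ^ n * D := summable_geometric_two.mul_right D
  have hsumM (t : ℝ) : Summable fun n : ℕ ↦ (1 / 2 : ℝ) ^ n * M (d n) t :=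
    .of_nonneg_of_le (fun n ↦ mul_nonneg (hpos n).le (hM0 _ _))
      (fun n ↦ mul_le_mul_of_nonneg_left (hMD _ _) (hpos n).le) hsum
  have hterm {s t : ℝ} (hs : s ∈ Icc a b) (ht : t ∈ Icc a b) (hst : s ≤ t) (n : ℕ) :
      (1 / 2 : ℝ) ^ n * M (d n) s ≤ (1 / 2) ^ n * M (d n) t :=
    mul_le_mul_of_nonneg_left (hMmono _ hs ht hst) (hpos n).le
  refine ⟨fun t ↦ ∑' n : ℕ, (1 / 2 : ℝ) ^ n * M (d n) t, ?_, ?_, ?_⟩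
  · refine continuous_tsum (fun n ↦ continuous_const.mul (hMcont _)) hsum fun n t ↦ ?_
    rw [Real.norm_of_nonneg (mul_nonneg (hpos n).le (hM0 _ _))]
    exact mul_le_mul_of_nonneg_left (hMD _ _) (hpos n).le
  · exact fun s hs t ht hst ↦ (hsumM s).tsum_le_tsum (hterm hs ht hst) (hsumM t)
  · intro s hs t ht hst
    refine ⟨fun heq ↦ ?_, fun hconst ↦ ?_⟩
    · have key (n : ℕ) (hn : d n ∈ Ioo s t) (y : ℝ) (hy : y ∈ Ioo (d n) t) : γ (d n) = γ y := by
        by_contra hne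
        have hs0 : M (d n) s ≤ 0 := by
          refine Real.sSup_le ?_ le_rfl
          rintro _ ⟨x, -, rfl⟩
          simp only [max_eq_left ((min_le_right x s).trans hn.1.le), dist_self, le_refl]
        have ht0 : dist (γ (d n)) (γ y) ≤ M (d n) t := by
          have := hle (d n) (x := y) (t := t) ⟨by linarith [hs.1, hn.1, hy.1], by
            linarith [ht.2, hy.2]⟩
          rwa [min_eq_left hy.2.le, max_eq_right hy.1.le] at this
        have hlt : M (d n) s < M (d n) t := hs0.trans_lt ((dist_pos.2 hne).trans_le ht0)
        exact (Summable.tsum_lt_tsum (hterm hs ht hst) (mul_lt_mul_of_pos_left hlt (hpos n))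
          (hsumM s) (hsumM t)).ne heq
      have hIoo {x y : ℝ} (hx : x ∈ Ioo s t) (hy : y ∈ Ioo s t) : γ x = γ y := by
        obtain ⟨_, ⟨n, rfl⟩, h1, h2⟩ := (TopologicalSpace.denseRange_denseSeq ℝ).exists_between
          (lt_min hx.1 hy.1)
        have h3 := lt_min_iff.1 h2
        have hn : d n ∈ Ioo s t := ⟨h1, h3.1.trans hx.2⟩
        exact (key n hn x ⟨h3.1, hx.2⟩).symm.trans (key n hn y ⟨h3.2, hy.2⟩)
      rcases hst.eq_or_lt with rfl | hlt
      · intro x hx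
        rw [le_antisymm hx.2 hx.1]
      obtain ⟨m, hm⟩ := exists_between hlt
      have hcl : EqOn γ (fun _ ↦ γ m) (closure (Ioo s t)) :=
        EqOn.closure (fun x hx ↦ hIoo hx hm) hγ continuous_const
      rw [closure_Ioo hlt.ne] at hcl
      exact fun x hx ↦ (hcl hx).trans (hcl (left_mem_Icc.2 hst)).symm
    · have hclamp (c x : ℝ) : γ (max c (min x s)) = γ (max c (min x t)) := by
        rcases le_total x s with hxs | hxs
        · rw [min_eq_left hxs, min_eq_left (hxs.trans hst)]
        rw [min_eq_right hxs]
        have hx' : min x t ∈ Icc s t := ⟨le_min hxs hst, min_le_right _ _⟩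
        rcases le_total c s with hcs | hcs
        · rw [max_eq_right hcs, max_eq_right (hcs.trans hx'.1), hconst _ hx']
        rw [max_eq_left hcs]
        rcases le_total c (min x t) with hc | hc
        · rw [max_eq_right hc, hconst _ hx', hconst c ⟨hcs, hc.trans hx'.2⟩]
        · rw [max_eq_left hc]
      have hM (c : ℝ) : M c s = M c t := by simp only [M, hclamp]
      simp only [hM]

/-- A monotone self-map of `[0, 2π]` fixing the endpoints and having the same fibers as `p`, up to
identification of the endpoints, identifies the range of `p` with the circle. -/
theorem exists_homeomorph_circle_of_monotoneOn {Y : Type*} [TopologicalSpace Y] [T2Space Y]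
    {p : ℝ → Y} (hp : Continuous p) (hsurj : ∀ y, ∃ t ∈ Icc 0 (2 * Real.pi), p t = y)
    {F : ℝ → ℝ} (hF : Continuous F) (hmono : MonotoneOn F (Icc 0 (2 * Real.pi)))
    (hF0 : F 0 = 0) (hF1 : F (2 * Real.pi) = 2 * Real.pi)
    (hpF : ∀ s ∈ Icc 0 (2 * Real.pi), ∀ t ∈ Icc 0 (2 * Real.pi), s ≤ t →
      (p s = p t ↔ F s = F t ∨ F s = 0 ∧ F t = 2 * Real.pi)) :
    ∃ ψ : Y ≃ₜ Circle, ∀ t ∈ Icc 0 (2 * Real.pi), ψ (p t) = Circle.exp (F t) := by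
  have hpi := Real.two_pi_pos
  have hmem0 : (0 : ℝ) ∈ Icc 0 (2 * Real.pi) := left_mem_Icc.2 hpi.le
  have hmem1 : 2 * Real.pi ∈ Icc 0 (2 * Real.pi) := right_mem_Icc.2 hpi.le
  have hFmem {t : ℝ} (ht : t ∈ Icc 0 (2 * Real.pi)) : 0 ≤ F t ∧ F t ≤ 2 * Real.pi :=
    ⟨hF0 ▸ hmono hmem0 ht ht.1, (hmono ht hmem1 ht.2).trans_eq hF1⟩
  have hexp {s t : ℝ} (hs : s ∈ Icc 0 (2 * Real.pi)) (ht : t ∈ Icc 0 (2 * Real.pi))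
      (hst : s ≤ t) : p s = p t ↔ Circle.exp (F s) = Circle.exp (F t) := by
    rw [hpF s hs t ht hst]
    constructor
    · rintro (h | ⟨h0, h1⟩)
      · rw [h]
      · rw [h0, h1, Circle.exp_zero, Circle.exp_two_pi]
    · intro h
      rcases Circle.exp_eq_exp_cases h (hmono hs ht hst) (by linarith [hFmem hs, hFmem ht])
        with h' | h'
      · exact Or.inl h'.symm
      · exact Or.inr ⟨by linarith [hFmem hs, hFmem ht], by linarith [hFmem hs, hFmem ht]⟩
  let P : C(Icc 0 (2 * Real.pi), Y) := ⟨fun t ↦ p t, by fun_prop⟩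
  let G : C(Icc 0 (2 * Real.pi), Circle) := ⟨fun t ↦ Circle.exp (F t), by fun_prop⟩
  have hPsurj : Function.Surjective P := fun y ↦ by
    obtain ⟨t, ht, rfl⟩ := hsurj y
    exact ⟨⟨t, ht⟩, rfl⟩
  have hP : IsQuotientMap P := .of_surjective_continuous hPsurj P.continuous
  have hPG (s t : Icc 0 (2 * Real.pi)) : P s = P t ↔ G s = G t := by
    rcases le_total (s : ℝ) t with h | h
    · exact hexp s.2 t.2 h
    · exact eq_comm.trans ((hexp t.2 s.2 h).trans eq_comm)
  have hfac : Function.FactorsThrough G P := fun s t h ↦ (hPG s t).1 h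
  have hψ (t : Icc 0 (2 * Real.pi)) : hP.lift G hfac (P t) = G t :=
    congrArg (fun k : C(Icc 0 (2 * Real.pi), Circle) ↦ k t) (hP.lift_comp G hfac)
  have hbij : Function.Bijective (hP.lift G hfac) := by
    refine ⟨fun x y hxy ↦ ?_, fun z ↦ ?_⟩
    · obtain ⟨s, rfl⟩ := hPsurj x
      obtain ⟨t, rfl⟩ := hPsurj y
      rw [hψ, hψ] at hxy
      exact (hPG s t).2 hxy
    · obtain ⟨x, hx, rfl⟩ := Circle.exists_exp_eq 0 z
      obtain ⟨t, ht, rfl⟩ := intermediate_value_Icc hpi.le hF.continuousOn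
        (show x ∈ Icc (F 0) (F (2 * Real.pi)) by
          rw [hF0, hF1]; exact ⟨hx.1, by linarith [hx.2]⟩)
      exact ⟨P ⟨t, ht⟩, hψ ⟨t, ht⟩⟩
  have : CompactSpace Y := hPsurj.compactSpace P.continuous
  exact ⟨(hP.lift G hfac).continuous.homeoOfEquivCompactToT2 (f := Equiv.ofBijective _ hbij),
    fun t ht ↦ hψ ⟨t, ht⟩⟩

theorem Circle.dist_exp_le (x y : ℝ) : dist (Circle.exp x) (Circle.exp y) ≤ |x - y| := by
  have h : (Circle.exp x : ℂ) - Circle.exp y =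
      Circle.exp y * (Complex.exp (Complex.I * ((x - y : ℝ) : ℂ)) - 1) := by
    rw [mul_sub, Circle.coe_exp, Circle.coe_exp, ← Complex.exp_add, mul_one]
    congr 2
    push_cast
    ring
  change dist (Circle.exp x : ℂ) (Circle.exp y) ≤ _
  rw [dist_eq_norm, h, norm_mul, Circle.norm_coe, one_mul]
  exact Real.norm_exp_I_mul_ofReal_sub_one_le

/-- A circle map with arc-convex proper fibers collapses to the circle through a continuous monotone
self-map of `[0, 2π]`. -/
theorem exists_monotoneOn_collapse {X : Type*} [MetricSpace X] [CompactSpace X] {f : C(Circle, X)}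
    (hf : Function.Surjective f) (harc : ∀ q, ArcConvex (f ⁻¹' {q}))
    (hproper : ∀ q, f ⁻¹' {q} ≠ univ) :
    ∃ F : ℝ → ℝ, Continuous F ∧ MonotoneOn F (Icc 0 (2 * Real.pi)) ∧ F 0 = 0 ∧
      F (2 * Real.pi) = 2 * Real.pi ∧
      ∃ ψ : X ≃ₜ Circle, ∀ t ∈ Icc 0 (2 * Real.pi), ψ (f (Circle.exp t)) = Circle.exp (F t) := by
  have hpi := Real.two_pi_pos
  have hmem0 : (0 : ℝ) ∈ Icc 0 (2 * Real.pi) := left_mem_Icc.2 hpi.le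
  have hmem1 : 2 * Real.pi ∈ Icc 0 (2 * Real.pi) := right_mem_Icc.2 hpi.le
  have hcont : Continuous fun t ↦ f (Circle.exp t) := by fun_prop
  obtain ⟨F, hF, hmono, hconst⟩ := exists_monotoneOn_eq_iff_constant hcont 0 (2 * Real.pi)
  have hlt : F 0 < F (2 * Real.pi) := by
    refine lt_of_le_of_ne (hmono hmem0 hmem1 hpi.le) fun h ↦ ?_
    refine hproper (f (Circle.exp 0)) (eq_univ_of_forall fun z ↦ ?_)
    obtain ⟨x, hx, rfl⟩ := Circle.exists_exp_eq 0 z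
    exact (hconst 0 hmem0 _ hmem1 hpi.le).1 h x ⟨hx.1, by linarith [hx.2]⟩
  set L := F (2 * Real.pi) - F 0 with hL
  have hLpos : 0 < L := sub_pos.2 hlt
  let N : ℝ → ℝ := fun t ↦ 2 * Real.pi * ((F t - F 0) / L)
  have hN : Continuous N := by fun_prop
  have hNmono : MonotoneOn N (Icc 0 (2 * Real.pi)) := by
    intro s hs t ht hst
    have := hmono hs ht hst
    simp only [N]
    gcongr
  have hN0 : N 0 = 0 := by simp [N]
  have hN1 : N (2 * Real.pi) = 2 * Real.pi := by simp [N, ← hL, hLpos.ne']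
  have hNeq (s t : ℝ) : N s = N t ↔ F s = F t := by
    simp only [N]
    rw [mul_right_inj' hpi.ne', div_left_inj' hLpos.ne', sub_left_inj]
  refine ⟨N, hN, hNmono, hN0, hN1,
    exists_homeomorph_circle_of_monotoneOn hcont (fun y ↦ ?_) hN hNmono hN0 hN1 ?_⟩
  · obtain ⟨z, rfl⟩ := hf y
    obtain ⟨x, hx, rfl⟩ := Circle.exists_exp_eq 0 z
    exact ⟨x, ⟨hx.1, by linarith [hx.2]⟩, rfl⟩
  intro s hs t ht hst
  have hends : N s = 0 ∧ N t = 2 * Real.pi ↔ F 0 = F s ∧ F t = F (2 * Real.pi) := by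
    rw [← hNeq, ← hNeq, hN0, hN1, eq_comm]
  rw [hends, hNeq, hconst s hs t ht hst, hconst 0 hmem0 s hs hs.1, hconst t ht _ hmem1 ht.2]
  constructor
  · intro h
    rcases hst.eq_or_lt with rfl | hst'
    · left
      intro x hx
      rw [le_antisymm hx.2 hx.1]
    rcases lt_or_ge t (s + 2 * Real.pi) with hts | hts
    · rcases harc (f (Circle.exp s)) s t hst' hts rfl h.symm with H | H
      · exact Or.inl H
      · have hin (x : ℝ) (hx : x ∈ Icc 0 s) : f (Circle.exp x) = f (Circle.exp s) := by
          have := H (x + 2 * Real.pi) ⟨by linarith [ht.2, hx.1], by linarith [hx.2]⟩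
          rwa [Circle.exp_add_two_pi] at this
        refine Or.inr ⟨fun x hx ↦ (hin x hx).trans (hin 0 ⟨le_rfl, hs.1⟩).symm, fun x hx ↦ ?_⟩
        exact (H x ⟨hx.1, hx.2.trans (by linarith [hs.1])⟩ : f _ = _).trans h
    · obtain rfl : s = 0 := by linarith [hs.1, ht.2]
      obtain rfl : t = 2 * Real.pi := by linarith [ht.2]
      refine Or.inr ⟨fun x hx ↦ ?_, fun x hx ↦ ?_⟩ <;> rw [le_antisymm hx.2 hx.1]
  · rintro (h | ⟨h0, h1⟩)
    · exact (h t ⟨hst, le_rfl⟩).symm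
    · have h0' := h0 s ⟨hs.1, le_rfl⟩
      have h1' := h1 _ ⟨ht.2, le_rfl⟩
      rw [h0', ← h1', Circle.exp_zero, Circle.exp_two_pi]

/-- The circle map induced by a monotone self-map of `[0, 2π]` fixing the endpoints is perturbed to
a homeomorphism by mixing in a small multiple of the identity. -/
theorem exists_homeomorph_of_convexCombination {F : ℝ → ℝ} (hF : Continuous F)
    (hmono : MonotoneOn F (Icc 0 (2 * Real.pi))) (hF0 : F 0 = 0)
    (hF1 : F (2 * Real.pi) = 2 * Real.pi) {ε : ℝ} (hε0 : 0 < ε) (hε1 : ε ≤ 1) :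
    ∃ η : Circle ≃ₜ Circle, ∀ t ∈ Icc 0 (2 * Real.pi),
      η (Circle.exp t) = Circle.exp ((1 - ε) * F t + ε * t) := by
  have hpi := Real.two_pi_pos
  have hmem0 : (0 : ℝ) ∈ Icc 0 (2 * Real.pi) := left_mem_Icc.2 hpi.le
  have hmem1 : 2 * Real.pi ∈ Icc 0 (2 * Real.pi) := right_mem_Icc.2 hpi.le
  have hstrict : StrictMonoOn (fun t ↦ (1 - ε) * F t + ε * t) (Icc 0 (2 * Real.pi)) := by
    intro s hs t ht hst
    have h1 := mul_le_mul_of_nonneg_left (hmono hs ht hst.le) (sub_nonneg.2 hε1)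
    have h2 := mul_lt_mul_of_pos_left hst hε0
    exact add_lt_add_of_le_of_lt h1 h2
  have h0 : (1 - ε) * F 0 + ε * 0 = 0 := by simp [hF0]
  have h1 : (1 - ε) * F (2 * Real.pi) + ε * (2 * Real.pi) = 2 * Real.pi := by rw [hF1]; ring
  refine exists_homeomorph_circle_of_monotoneOn Circle.exp.continuous (fun z ↦ ?_) (by fun_prop)
    hstrict.monotoneOn h0 h1 fun s hs t ht hst ↦ ?_
  · obtain ⟨x, hx, rfl⟩ := Circle.exists_exp_eq 0 z
    exact ⟨x, ⟨hx.1, by linarith [hx.2]⟩, rfl⟩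
  · have e1 := hstrict.injOn.eq_iff hs ht
    have e2 := hstrict.injOn.eq_iff hs hmem0
    have e3 := hstrict.injOn.eq_iff ht hmem1
    simp only [h0, h1] at e1 e2 e3
    rw [e1, e2, e3]
    constructor
    · intro h
      rcases Circle.exp_eq_exp_cases h hst (by linarith [hs.1, ht.2]) with h' | h'
      · exact Or.inl h'.symm
      · exact Or.inr ⟨by linarith [hs.1, ht.2], by linarith [hs.1, ht.2]⟩
    · rintro (rfl | ⟨rfl, rfl⟩)
      · rfl
      · simp

theorem exists_tendstoUniformly_homeomorph {X : Type*} [MetricSpace X] [CompactSpace X]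
    {f : C(Circle, X)} (hf : Function.Surjective f) (harc : ∀ q, ArcConvex (f ⁻¹' {q}))
    (hproper : ∀ q, f ⁻¹' {q} ≠ univ) :
    Nonempty (X ≃ₜ Circle) ∧
      ∃ h : ℕ → (Circle ≃ₜ X), TendstoUniformly (fun n z => h n z) f atTop := by
  obtain ⟨F, hF, hmono, hF0, hF1, ψ, hψ⟩ := exists_monotoneOn_collapse hf harc hproper
  have hpi := Real.two_pi_pos
  have hFmem {t : ℝ} (ht : t ∈ Icc 0 (2 * Real.pi)) : 0 ≤ F t ∧ F t ≤ 2 * Real.pi :=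
    ⟨hF0 ▸ hmono (left_mem_Icc.2 hpi.le) ht ht.1,
      (hmono ht (right_mem_Icc.2 hpi.le) ht.2).trans_eq hF1⟩
  have hε0 (n : ℕ) : (0 : ℝ) < 1 / ((n : ℝ) + 1) := by positivity
  have hε1 (n : ℕ) : 1 / ((n : ℝ) + 1) ≤ 1 := by
    rw [div_le_one (by positivity)]
    linarith [n.cast_nonneg (α := ℝ)]
  choose η hη using fun n : ℕ ↦
    exists_homeomorph_of_convexCombination hF hmono hF0 hF1 (hε0 n) (hε1 n)
  have hlim : TendstoUniformly (fun n z ↦ η n z) (fun z ↦ ψ (f z)) atTop := by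
    refine Metric.tendstoUniformly_iff.2 fun δ hδ ↦ ?_
    have hto : Tendsto (fun n : ℕ ↦ 1 / ((n : ℝ) + 1) * (2 * Real.pi)) atTop (𝓝 0) := by
      simpa using tendsto_one_div_add_atTop_nhds_zero_nat.mul_const (2 * Real.pi)
    filter_upwards [hto.eventually_lt_const hδ] with n hn z
    obtain ⟨t, ht, rfl⟩ := Circle.exists_exp_eq 0 z
    have ht' : t ∈ Icc 0 (2 * Real.pi) := ⟨ht.1, by linarith [ht.2]⟩
    rw [hψ t ht', hη n t ht']
    refine (Circle.dist_exp_le _ _).trans_lt (lt_of_le_of_lt ?_ hn)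
    have hfac (ε : ℝ) : F t - ((1 - ε) * F t + ε * t) = ε * (F t - t) := by ring
    rw [hfac, abs_mul, abs_of_pos (hε0 n)]
    refine mul_le_mul_of_nonneg_left (abs_le.2 ⟨?_, ?_⟩) (hε0 n).le <;>
      linarith [hFmem ht', ht'.1, ht'.2]
  refine ⟨⟨ψ⟩, fun n ↦ (η n).trans ψ.symm, ?_⟩
  have huc : UniformContinuous ψ.symm :=
    CompactSpace.uniformContinuous_of_continuous ψ.symm.continuous
  have := huc.comp_tendstoUniformly hlim
  simpa [Function.comp_def] using this

/-- Let `X` be a compact metric space. A continuous surjection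
`f : S¹ → X` is cell-like (all its fibers are cell-like) if and only if `X` is
homeomorphic to `S¹` and `f` is a weakly monotone parametrization of `X`, i.e. a uniform
limit of homeomorphisms `S¹ → X`. -/
theorem cellLike_circle_map_iff_weakly_monotone
    (X : Type*) [MetricSpace X] [CompactSpace X]
    (f : C(Circle, X)) (hf : Function.Surjective f) :
    (∀ q : X, IsCellLikeSpace ↥(f ⁻¹' {q})) ↔
      (Nonempty (X ≃ₜ Circle) ∧
        ∃ h : ℕ → (Circle ≃ₜ X), TendstoUniformly (fun n z => h n z) f atTop) := by
  have hclosed (q : X) : IsClosed (f ⁻¹' {q}) := isClosed_singleton.preimage f.continuous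
  constructor
  · intro h
    refine exists_tendstoUniformly_homeomorph hf (fun q ↦ ?_) fun q ↦ (h q).ne_univ
    have : CompactSpace (f ⁻¹' {q}) := isCompact_iff_compactSpace.1 (hclosed q).isCompact
    exact (isPreconnected_iff_preconnectedSpace.2 (h q).preconnectedSpace).arcConvex
  · rintro ⟨⟨φ⟩, h, hlim⟩ q
    have : LocallyConnectedSpace X := φ.isOpenEmbedding.locallyConnectedSpace
    have hne : f ⁻¹' {q} ≠ univ := by
      intro huniv
      have hq (x : X) : x = q := by
        obtain ⟨z, rfl⟩ := hf x
        exact (huniv ▸ mem_univ z : z ∈ f ⁻¹' {q})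
      have : Circle.exp 0 = Circle.exp Real.pi :=
        φ.symm.injective ((hq _).trans (hq _).symm)
      have := congrArg (fun z : Circle ↦ (z : ℂ)) this
      norm_num [Complex.exp_pi_mul_I] at this
    have : ContractibleSpace (f ⁻¹' {q}) :=
      (arcConvex_fiber_of_tendstoUniformly hlim q).contractibleSpace (hclosed q) (hf q) hne
    obtain ⟨e, he⟩ := Circle.exists_isEmbedding_hilbertCube
    exact isCellLikeSpace_of_contractibleSpace (he.comp IsEmbedding.subtypeVal)
end
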